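/- Fix an integer n ≥ 1. For every continuous compactly supported function f : ℝ^n → ℝ, lim_{N→∞} ∫_{ℝ^n} f(t_1,…,t_n) (π/(2N))^n R^{BT}_{n1}(πt_1/(2N),…,πt_n/(2N)) dt_1⋯dt_n = ∫_{ℝ^n} f(t_1,…,t_n) (det[K^{(1)}_sine(t_j,t_k)]_{j,k=1}^n)^{1/2} dt_1⋯dt_n. (Sine-kernel universality at zero for the bounded trace Gaussian orthogonal ensemble.) -/

import Mathlib

open MeasureTheory Filter Real Topology

noncomputable section

/-- The β-Vandermonde factor `∏_{j<k} |x_j - x_k|^β`. -/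
def vand (β : ℝ) (N : ℕ) (x : Fin N → ℝ) : ℝ :=
  ∏ p ∈ Finset.univ.filter (fun p : Fin N × Fin N => p.1 < p.2), |x p.1 - x p.2| ^ β

/-- `N_β = N + βN(N-1)/2`. -/
def Nbeta (β : ℝ) (N : ℕ) : ℝ := N + β * N * (N - 1) / 2

/-- Surface (Hausdorff) measure on the sphere of radius `r` in Euclidean `ℝ^N`. -/
def sphereMeasure (N : ℕ) (r : ℝ) : Measure (EuclideanSpace ℝ (Fin N)) :=
  (μH[(N : ℝ) - 1]).restrict (Metric.sphere (0 : EuclideanSpace ℝ (Fin N)) r)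

/-- Normalization of the fixed trace ensemble: total `Δ_β`-mass of the sphere of radius `r`. -/
def Zft (β : ℝ) (N : ℕ) (r : ℝ) : ℝ :=
  ∫ x, vand β N x ∂(sphereMeasure N r)

/-- Glue `(x_1,…,x_n)` and `(x_{n+1},…,x_N)` into a vector in `ℝ^N`. -/
def combine (N n : ℕ) (x : Fin n → ℝ) (y : Fin (N - n) → ℝ) : Fin N → ℝ := fun i =>
  if h : (i : ℕ) < n then x ⟨i, h⟩
  else y ⟨(i : ℕ) - n, by have := i.isLt; omega⟩

/-- `n`-point correlation function of the fixed trace Gaussian β-ensemble of strength `r`. -/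
def Rft (β : ℝ) (n N : ℕ) (r : ℝ) (x : Fin n → ℝ) : ℝ :=
  ((N.factorial : ℝ) / ((N - n).factorial : ℝ)) * (Zft β N r)⁻¹ *
    ∫ y, vand β N (combine N n x y)
      ∂(sphereMeasure (N - n) (Real.sqrt (r ^ 2 - ∑ i, x i ^ 2)))

/-- Normalization of the bounded trace ensemble. -/
def Zbt (β : ℝ) (N : ℕ) (r : ℝ) : ℝ :=
  ∫ x : Fin N → ℝ, Set.indicator {z : Fin N → ℝ | ∑ i, z i ^ 2 ≤ r ^ 2} (vand β N) x

/-- `n`-point correlation function of the bounded trace Gaussian β-ensemble of strength `r`. -/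
def Rbt (β : ℝ) (n N : ℕ) (r : ℝ) (x : Fin n → ℝ) : ℝ :=
  ((N.factorial : ℝ) / ((N - n).factorial : ℝ)) * (Zbt β N r)⁻¹ *
    ∫ y : Fin (N - n) → ℝ,
      Set.indicator {z : Fin N → ℝ | ∑ i, z i ^ 2 ≤ r ^ 2} (vand β N) (combine N n x y)

/-- Normalization of the (unconstrained) Gaussian β-ensemble. -/
def Zg (β : ℝ) (N : ℕ) : ℝ :=
  ∫ x : Fin N → ℝ, vand β N x * ∏ i, Real.exp (-(β * N * x i ^ 2))

/-- `n`-point correlation function of the Gaussian β-ensemble. -/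
def Rg (β : ℝ) (n N : ℕ) (x : Fin n → ℝ) : ℝ :=
  ((N.factorial : ℝ) / ((N - n).factorial : ℝ)) * (Zg β N)⁻¹ *
    ∫ y : Fin (N - n) → ℝ,
      vand β N (combine N n x y) * ∏ i, Real.exp (-(β * N * (combine N n x y i) ^ 2))

/-- The sine kernel `sin(π(x-y))/(π(x-y))`, with value `1` on the diagonal. -/
def Ksine (x y : ℝ) : ℝ :=
  if x = y then 1 else Real.sin (π * (x - y)) / (π * (x - y))

/-- `S(t) = sin(πt)/(πt)` with `S(0) = 1`. -/
def Ssin (t : ℝ) : ℝ := if t = 0 then 1 else Real.sin (π * t) / (π * t)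

/-- The 2×2 matrix sine kernel for β = 1. -/
def K1sine (x y : ℝ) : Fin 2 → Fin 2 → ℝ :=
  ![![Ssin (x - y), deriv Ssin (x - y)],
    ![(∫ t in (0:ℝ)..(x - y), Ssin t) - Real.sign (x - y) / 2, Ssin (x - y)]]

/-- The 2×2 matrix sine kernel for β = 4. -/
def K4sine (x y : ℝ) : Fin 2 → Fin 2 → ℝ :=
  ![![Ssin (2 * (x - y)), deriv (fun z => Ssin (2 * (z - y))) x],
    ![(∫ t in (0:ℝ)..(x - y), Ssin (2 * t)) - Real.sign (2 * (x - y)) / 2,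
      Ssin (2 * (x - y))]]

/-- The Airy function `Ai(x) = lim_{T→∞} (1/π) ∫_0^T cos(t³/3 + xt) dt`. -/
def Ai (x : ℝ) : ℝ :=
  limUnder atTop (fun T : ℝ => (1 / π) * ∫ t in (0:ℝ)..T, Real.cos (t ^ 3 / 3 + x * t))

/-- The Airy kernel. -/
def KAiry (x y : ℝ) : ℝ :=
  if x = y then (deriv Ai x) ^ 2 - x * (Ai x) ^ 2
  else (Ai x * deriv Ai y - deriv Ai x * Ai y) / (x - y)

/-- `C_{Nβ} = Γ(N_β/2)·2^{N_β/2−1}·β^{−N_β/2}`. -/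
def Cnb (β : ℝ) (N : ℕ) : ℝ :=
  Real.Gamma (Nbeta β N / 2) * (2 : ℝ) ^ (Nbeta β N / 2 - 1) * β ^ (-(Nbeta β N) / 2)

end

section

open Equiv Finset

noncomputable def pfSum {ι : Type*} [Fintype ι] [DecidableEq ι] {m : ℕ} (e : Fin m × Fin 2 ≃ ι)
    (A : Matrix ι ι ℝ) : ℝ :=
  ∑ σ : Perm ι, ((Perm.sign σ : ℤ) : ℝ) * ∏ i : Fin m, A (σ (e (i, 0))) (σ (e (i, 1)))

section
variable {ι : Type*} [Fintype ι] [DecidableEq ι] {m : ℕ} (e : Fin m × Fin 2 ≃ ι)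

lemma prod_pairs (f : ι → ℝ) : ∏ a, f a = ∏ i : Fin m, f (e (i, 0)) * f (e (i, 1)) := by
  rw [← e.prod_comp, Fintype.prod_prod_type]
  simp

lemma sum_perm_of_support (F : (ι → ι) → ℝ) (hF : ∀ g, ¬ Function.Injective g → F g = 0) :
    ∑ g : ι → ι, F g = ∑ τ : Perm ι, F τ := by
  symm
  refine Finset.sum_of_injOn (fun τ : Perm ι => (τ : ι → ι)) ?_ (by simp) ?_ (by simp)
  · intro a _ b _ h
    exact Equiv.coe_fn_injective h
  · intro g _ hg
    apply hF
    intro hinj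
    apply hg
    refine ⟨Equiv.ofBijective g (Finite.injective_iff_bijective.mp hinj), by simp, rfl⟩

lemma pfSum_congr_mul (A B : Matrix ι ι ℝ) :
    pfSum e (B * A * B.transpose) = B.det * pfSum e A := by
  have hprod : ∀ σ : Perm ι, ∏ i : Fin m, (B * A * B.transpose) (σ (e (i, 0))) (σ (e (i, 1)))
      = ∑ g : ι → ι, (∏ a, B (σ a) (g a)) * ∏ i : Fin m, A (g (e (i, 0))) (g (e (i, 1))) := by
    intro σ
    have h1 : ∀ a b, (B * A * B.transpose) a b = ∑ c : Fin 2 → ι, B a (c 0) * B b (c 1) * A (c 0) (c 1) := by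
      intro a b
      rw [← (finTwoArrowEquiv ι).symm.sum_comp, Fintype.sum_prod_type]
      simp only [Matrix.mul_apply, Matrix.transpose_apply, Finset.sum_mul]
      rw [Finset.sum_comm]
      refine Finset.sum_congr rfl fun c _ => Finset.sum_congr rfl fun d _ => ?_
      simp [finTwoArrowEquiv]; ring
    simp_rw [h1]
    rw [Finset.prod_univ_sum]
    simp only [Fintype.piFinset_univ]
    let E : (ι → ι) ≃ (Fin m → Fin 2 → ι) :=
      (Equiv.arrowCongr e.symm (Equiv.refl ι)).trans (Equiv.curry (Fin m) (Fin 2) ι)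
    rw [← E.sum_comp]
    refine Finset.sum_congr rfl fun g _ => ?_
    rw [prod_pairs e, ← Finset.prod_mul_distrib]
    refine Finset.prod_congr rfl fun i _ => ?_
    simp [E, Equiv.arrowCongr, Function.curry]
  unfold pfSum
  simp_rw [hprod, Finset.mul_sum]
  rw [Finset.sum_comm]
  have h2 : ∀ g : ι → ι, ∑ σ : Perm ι, ((Perm.sign σ : ℤ) : ℝ) * ((∏ a, B (σ a) (g a)) *
      ∏ i : Fin m, A (g (e (i, 0))) (g (e (i, 1))))
      = (B.submatrix id g).det * ∏ i : Fin m, A (g (e (i, 0))) (g (e (i, 1))) := by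
    intro g
    rw [Matrix.det_apply', Finset.sum_mul]
    refine Finset.sum_congr rfl fun σ _ => ?_
    simp [mul_assoc]
  simp_rw [h2]
  rw [sum_perm_of_support]
  · refine Finset.sum_congr rfl fun τ _ => ?_
    rw [Matrix.det_permute']
    ring
  · intro g hg
    simp only [Function.Injective, not_forall] at hg
    obtain ⟨a, b, hab, hne⟩ := hg
    rw [Matrix.det_zero_of_column_eq hne (by intro k; simp [hab]), zero_mul]

/-- The standard symplectic matrix. -/
def stdSympl : Matrix ι ι ℝ := Matrix.of fun a b =>
  if (e.symm a).1 = (e.symm b).1 then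
    (if (e.symm a).2 = 0 ∧ (e.symm b).2 = 1 then 1
      else if (e.symm a).2 = 1 ∧ (e.symm b).2 = 0 then -1 else 0) else 0

lemma pfSum_eq_zero_of_row (A : Matrix ι ι ℝ) (a : ι) (hr : ∀ b, A a b = 0) (hc : ∀ b, A b a = 0) :
    pfSum e A = 0 := by
  unfold pfSum
  refine Finset.sum_eq_zero fun σ _ => ?_
  obtain ⟨⟨i, b⟩, hb⟩ : ∃ p, σ (e p) = a := ⟨e.symm (σ.symm a), by simp⟩
  rw [Finset.prod_eq_zero (Finset.mem_univ i), mul_zero]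
  fin_cases b
  · simp only [Fin.zero_eta] at hb; rw [hb, hr]
  · simp only [Fin.mk_one] at hb; rw [hb, hc]
end

end

section

open Equiv Finset
section
variable {ι : Type*} [Fintype ι] [DecidableEq ι] {m : ℕ} (e : Fin m × Fin 2 ≃ ι)

lemma stdSympl_term_nonneg (σ : Perm (Fin m × Fin 2)) :
    0 ≤ ((Perm.sign σ : ℤ) : ℝ) * ∏ i : Fin m, stdSympl (Equiv.refl _) (σ (i, 0)) (σ (i, 1)) := by
  by_cases h0 : ∏ i : Fin m, stdSympl (Equiv.refl _) (σ (i, 0)) (σ (i, 1)) = 0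
  · rw [h0, mul_zero]
  have hi : ∀ i, stdSympl (Equiv.refl _) (σ (i, 0)) (σ (i, 1)) ≠ 0 := fun i h =>
    h0 (Finset.prod_eq_zero (Finset.mem_univ i) h)
  have hfst : ∀ i, (σ (i, 0)).1 = (σ (i, 1)).1 := by
    intro i; by_contra hne; apply hi i; simp [stdSympl, hne]
  have hsnd : ∀ i, (σ (i, 0)).2 ≠ (σ (i, 1)).2 := by
    intro i hne
    have h : σ (i, 0) = σ (i, 1) := Prod.ext (hfst i) hne
    simpa using σ.injective h
  let ρ : Fin m → Perm (Fin 2) := fun i => if (σ (i, 0)).2 = 0 then 1 else Equiv.swap 0 1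
  have hval : ∀ i c, σ (i, c) = ((σ (i, 0)).1, ρ i c) := by
    intro i c
    have h1 := hsnd i
    have h2 := hfst i
    apply Prod.ext
    · fin_cases c
      · rfl
      · exact h2.symm
    · simp only [ρ]
      generalize hx : (σ (i, 0)).2 = x at *
      generalize hy : (σ (i, 1)).2 = y at *
      fin_cases c <;> fin_cases x <;> fin_cases y <;> simp_all
  have hinj : Function.Injective fun i => (σ (i, 0)).1 := by
    intro i j hij
    simp only at hij
    have h1 : σ (i, (ρ i).symm 0) = σ (j, (ρ j).symm 0) := by
      rw [hval i, hval j, hij]; simp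
    exact congrArg Prod.fst (σ.injective h1)
  let τ : Perm (Fin m) := Equiv.ofBijective _ (Finite.injective_iff_bijective.mp hinj)
  have hdec : σ = Equiv.prodCongrLeft (fun _ : Fin 2 => τ) * Equiv.prodCongrRight ρ := by
    ext1 ⟨i, c⟩
    rw [hval i c]; rfl
  have hs : ((Perm.sign σ : ℤ) : ℝ) = ∏ i, ((Perm.sign (ρ i) : ℤ) : ℝ) := by
    rw [hdec, Perm.sign_mul, Perm.sign_prodCongrLeft, Perm.sign_prodCongrRight]
    simp
  rw [hs, ← Finset.prod_mul_distrib]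
  refine Finset.prod_nonneg fun i _ => ?_
  rw [hval i 0, hval i 1]
  simp only [ρ]
  split_ifs <;> simp [stdSympl]

lemma stdSympl_apply (p q : Fin m × Fin 2) :
    stdSympl e (e p) (e q) = stdSympl (Equiv.refl _) p q := by
  simp only [stdSympl, Matrix.of_apply, Equiv.symm_apply_apply, Equiv.refl_symm, Equiv.refl_apply]
  congr

lemma pfSum_stdSympl_pos : 0 < pfSum e (stdSympl e) := by
  have h : pfSum e (stdSympl e) = pfSum (Equiv.refl _) (stdSympl (Equiv.refl (Fin m × Fin 2))) := by
    unfold pfSum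
    rw [← (e.permCongr).sum_comp]
    refine Finset.sum_congr rfl fun σ _ => ?_
    simp [Equiv.permCongr_apply, stdSympl_apply]
  rw [h]
  refine Finset.sum_pos' (fun σ _ => stdSympl_term_nonneg σ) ⟨1, Finset.mem_univ _, ?_⟩
  simp [stdSympl]

lemma exists_sympl_basis (m : ℕ) : ∀ (V : Type) [AddCommGroup V] [Module ℝ V] [FiniteDimensional ℝ V]
    (B : LinearMap.BilinForm ℝ V) (_ : B.IsAlt) (_ : B.Nondegenerate)
    (_ : Module.finrank ℝ V = 2 * m),
    ∃ b : Fin m × Fin 2 → V, ∀ p q, B (b p) (b q) = stdSympl (Equiv.refl _) p q := by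
  induction m with
  | zero => intro V _ _ _ B _ _ _; exact ⟨fun p => p.1.elim0, fun p => p.1.elim0⟩
  | succ m ih =>
    intro V _ _ _ B hB hnd hfr
    have hnt : Nontrivial V := Module.nontrivial_of_finrank_pos (R := ℝ) (by omega)
    obtain ⟨v, hv⟩ := exists_ne (0 : V)
    obtain ⟨w, hw⟩ : ∃ w, B v w ≠ 0 := by
      by_contra! h
      exact hv (hnd.1 v h)
    set w' := (B v w)⁻¹ • w with hw'
    have hvw : B v w' = 1 := by simp [hw', hw]
    have hwv : B w' v = -1 := by rw [← hB.neg_eq, hvw]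
    let b2 : Fin 2 → V := ![v, w']
    let W : Submodule ℝ V := Submodule.span ℝ (Set.range b2)
    have hlin : LinearIndependent ℝ b2 := by
      rw [LinearIndependent.pair_iff]
      intro s t hst
      have h1 : B v (s • v + t • w') = 0 := by rw [hst]; simp
      have h2 : B w' (s • v + t • w') = 0 := by rw [hst]; simp
      simp [hB.self_eq_zero, hvw, hwv] at h1 h2
      exact ⟨h2, h1⟩
    have hWfr : Module.finrank ℝ W = 2 := by
      have := finrank_span_eq_card hlin
      simpa [W] using this
    have hmem : ∀ x ∈ W, ∃ s t : ℝ, s • v + t • w' = x := by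
      intro x hx
      rw [show W = Submodule.span ℝ {v, w'} by simp [W, b2, Set.pair_comm]] at hx
      exact Submodule.mem_span_pair.mp hx
    have hvW : v ∈ W := Submodule.subset_span ⟨0, rfl⟩
    have hwW : w' ∈ W := Submodule.subset_span ⟨1, rfl⟩
    have hdisj : Disjoint W (B.orthogonal W) := by
      rw [Submodule.disjoint_def]
      intro x hx hxo
      obtain ⟨s, t, rfl⟩ := hmem x hx
      have h1 := hxo v hvW
      have h2 := hxo w' hwW
      simp [hB.self_eq_zero, hvw, hwv] at h1 h2
      simp [h1, h2]
    have hcompl := (LinearMap.BilinForm.isCompl_orthogonal_iff_disjoint hB.isRefl).mpr hdisj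
    have hfrW := Submodule.finrank_add_eq_of_isCompl hcompl
    have hnd' : (B.restrict (B.orthogonal W)).Nondegenerate := by
      have hr : (B.restrict (B.orthogonal W)).IsRefl := fun x y h => hB.isRefl _ _ h
      rw [LinearMap.BilinForm.restrict_nondegenerate_iff_isCompl_orthogonal hB.isRefl]
      rw [LinearMap.BilinForm.orthogonal_orthogonal hnd hB.isRefl]
      exact hcompl.symm
    obtain ⟨b, hb⟩ := ih (B.orthogonal W) (B.restrict (B.orthogonal W))
      (fun x => hB (x : V)) hnd' (by omega)
    have horth : ∀ p (x) (_ : x ∈ W), B x (b p : V) = 0 := fun p x hx => (b p).2 x hx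
    have horth' : ∀ p (x) (_ : x ∈ W), B (b p : V) x = 0 := fun p x hx =>
      hB.isRefl _ _ (horth p x hx)
    refine ⟨fun p => Fin.cases (b2 p.2) (fun i => (b (i, p.2) : V)) p.1, ?_⟩
    rintro ⟨i, c⟩ ⟨j, d⟩
    refine Fin.cases ?_ (fun i => ?_) i <;> refine Fin.cases ?_ (fun j => ?_) j
    · fin_cases c <;> fin_cases d <;> simp [b2, stdSympl, hB.self_eq_zero, hvw, hwv]
    · have := horth (j, d) (b2 c) (Submodule.subset_span ⟨c, rfl⟩)
      simp [this, stdSympl]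
      exact (if_neg (Fin.succ_ne_zero j).symm).symm
    · have := horth' (i, c) (b2 d) (Submodule.subset_span ⟨d, rfl⟩)
      simp [this, stdSympl]
    · have := hb (i, c) (j, d)
      simp [stdSympl] at this ⊢
      exact this
end

end

section

open Equiv Finset
section
variable {ι : Type} [Fintype ι] [DecidableEq ι] {m : ℕ} (e : Fin m × Fin 2 ≃ ι)

lemma det_stdSympl : (stdSympl e).det = 1 := by
  have h : stdSympl e = (Matrix.blockDiagonal fun _ : Fin m => !![(0:ℝ), 1; -1, 0]).submatrix
      (e.symm.trans (Equiv.prodComm _ _)) (e.symm.trans (Equiv.prodComm _ _)) := by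
    ext a b
    simp only [stdSympl, Matrix.of_apply, Matrix.submatrix_apply, Matrix.blockDiagonal_apply,
      Equiv.trans_apply, Equiv.prodComm_apply, Prod.fst_swap, Prod.snd_swap]
    by_cases h : (e.symm a).1 = (e.symm b).1
    · rw [if_pos h, if_pos h]
      generalize (e.symm a).2 = x
      generalize (e.symm b).2 = y
      fin_cases x <;> fin_cases y <;> simp
    · rw [if_neg h, if_neg h]
  rw [h, Matrix.det_submatrix_equiv_self, Matrix.det_blockDiagonal]
  simp

lemma exists_congr_stdSympl (M : Matrix ι ι ℝ) (hM : M.transpose = -M) (hd : M.det ≠ 0) :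
    ∃ C : Matrix ι ι ℝ, C * M * C.transpose = stdSympl e := by
  have hskew : ∀ a b, M a b = - M b a := fun a b => by
    have := congrFun (congrFun hM b) a
    simpa using this
  have halt : (Matrix.toBilin' M).IsAlt := by
    intro x
    rw [Matrix.toBilin'_apply]
    have h : ∑ i, ∑ j, x i * M i j * x j = - ∑ i, ∑ j, x i * M i j * x j := by
      conv_lhs => rw [Finset.sum_comm]
      rw [← Finset.sum_neg_distrib]
      refine Finset.sum_congr rfl fun i _ => ?_
      rw [← Finset.sum_neg_distrib]
      refine Finset.sum_congr rfl fun j _ => ?_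
      rw [hskew j i]; ring
    linarith
  have hcard : Fintype.card ι = 2 * m := by
    rw [← Fintype.card_congr e]; simp [mul_comm]
  obtain ⟨b, hb⟩ := exists_sympl_basis m (ι → ℝ) (Matrix.toBilin' M) halt
    (LinearMap.BilinForm.nondegenerate_toBilin'_iff_det_ne_zero.mpr hd) (by simp [hcard])
  refine ⟨Matrix.of fun a => b (e.symm a), ?_⟩
  ext a c
  obtain ⟨p, rfl⟩ := e.surjective a
  obtain ⟨q, rfl⟩ := e.surjective c
  rw [stdSympl_apply, ← hb, Matrix.toBilin'_apply]
  simp only [Matrix.mul_apply, Matrix.transpose_apply, Matrix.of_apply, Equiv.symm_apply_apply,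
    Finset.sum_mul]
  rw [Finset.sum_comm]

lemma pfSum_sq (M : Matrix ι ι ℝ) (hM : M.transpose = -M) :
    pfSum e M ^ 2 = pfSum e (stdSympl e) ^ 2 * M.det := by
  by_cases hd : M.det = 0
  · obtain ⟨v, hv, hvM⟩ := Matrix.exists_vecMul_eq_zero_iff.mpr hd
    obtain ⟨i, hi⟩ : ∃ i, v i ≠ 0 := by
      by_contra! h; exact hv (funext h)
    set B : Matrix ι ι ℝ := (1 : Matrix ι ι ℝ).updateRow i v with hB
    have hBd : B.det = v i := by
      have := Matrix.det_updateRow_sum (1 : Matrix ι ι ℝ) i v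
      have h2 : (∑ k, v k • (1 : Matrix ι ι ℝ) k) = v := by
        ext j; simp [Finset.sum_apply, Matrix.one_apply]
      rw [h2] at this
      simpa using this
    have hrow : ∀ b, (B * M * B.transpose) i b = 0 := by
      intro b
      rw [Matrix.mul_apply]
      refine Finset.sum_eq_zero fun k _ => ?_
      have : (B * M) i k = (Matrix.vecMul v M) k := by
        simp [Matrix.mul_apply, hB, Matrix.vecMul, dotProduct]
      rw [this, hvM]; simp
    have hcol : ∀ b, (B * M * B.transpose) b i = 0 := by
      intro b
      have : (B * M * B.transpose).transpose = -(B * M * B.transpose) := by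
        simp [Matrix.transpose_mul, hM, Matrix.mul_assoc]
      have h3 := congrFun (congrFun this i) b
      rw [Matrix.transpose_apply, Matrix.neg_apply, hrow] at h3
      simpa using h3
    have := pfSum_congr_mul e M B
    rw [pfSum_eq_zero_of_row e _ i hrow hcol, hBd] at this
    have h0 : pfSum e M = 0 := by
      rcases mul_eq_zero.mp this.symm with h | h
      · exact absurd h hi
      · exact h
    rw [h0, hd]; simp
  · obtain ⟨C, hC⟩ := exists_congr_stdSympl e M hM hd
    have h1 := pfSum_congr_mul e M C
    have h2 := congrArg Matrix.det hC
    rw [det_stdSympl, Matrix.det_mul, Matrix.det_mul, Matrix.det_transpose] at h2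
    rw [hC] at h1
    rw [h1]
    linear_combination -(pfSum e M ^ 2) * h2
end

end

section

open Equiv Finset MeasureTheory
section
variable {ι : Type} [Fintype ι] [DecidableEq ι] {m : ℕ} (e : Fin m × Fin 2 ≃ ι)
variable {X : Type} [MeasurableSpace X] (μ : Measure X) [SigmaFinite μ]

/-- Reassemble a configuration from its pairs. -/
def unpair (z : Fin m → X × X) (a : ι) : X :=
  if (e.symm a).2 = 0 then (z (e.symm a).1).1 else (z (e.symm a).1).2

lemma measurable_unpair : Measurable (unpair (X := X) e) := by
  refine measurable_pi_lambda _ fun a => ?_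
  unfold unpair
  split_ifs <;> fun_prop

lemma map_unpair : (Measure.pi fun _ : Fin m => μ.prod μ).map (unpair e) =
    Measure.pi fun _ : ι => μ := by
  symm
  refine Measure.pi_eq fun s hs => ?_
  rw [Measure.map_apply (measurable_unpair e) (MeasurableSet.univ_pi hs)]
  have h : unpair e ⁻¹' Set.univ.pi s = Set.univ.pi fun i => s (e (i, 0)) ×ˢ s (e (i, 1)) := by
    ext z
    simp only [Set.mem_preimage, Set.mem_univ_pi, Set.mem_prod]
    constructor
    · intro hz i
      have h0 := hz (e (i, 0))
      have h1 := hz (e (i, 1))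
      simp [unpair] at h0 h1
      exact ⟨h0, h1⟩
    · intro hz a
      obtain ⟨⟨i, c⟩, rfl⟩ := e.surjective a
      fin_cases c
      · simpa [unpair] using (hz i).1
      · simpa [unpair] using (hz i).2
  rw [h, Measure.pi_pi]
  simp only [Measure.prod_prod]
  rw [← e.prod_comp, Fintype.prod_prod_type]
  simp

lemma integrable_prod_pairs (F : Fin m → X × X → ℝ) (hF : ∀ i, Integrable (F i) (μ.prod μ))
    (hm : ∀ i, Measurable (F i)) :
    Integrable (fun x : ι → X => ∏ i, F i (x (e (i, 0)), x (e (i, 1)))) (Measure.pi fun _ => μ) := by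
  rw [← map_unpair e μ, integrable_map_measure _ (measurable_unpair e).aemeasurable]
  · simp only [Function.comp_def, unpair, Equiv.symm_apply_apply]
    simpa using Integrable.fintype_prod hF
  · exact Measurable.aestronglyMeasurable (by fun_prop)

lemma integral_prod_pairs (F : Fin m → X × X → ℝ) (hm : ∀ i, Measurable (F i)) :
    ∫ x : ι → X, ∏ i, F i (x (e (i, 0)), x (e (i, 1))) ∂(Measure.pi fun _ => μ) =
    ∏ i, ∫ z, F i z ∂(μ.prod μ) := by
  rw [← map_unpair e μ, integral_map (measurable_unpair e).aemeasurable]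
  · simp only [unpair, Equiv.symm_apply_apply]
    simpa using integral_fintype_prod_eq_prod (𝕜 := ℝ) F
  · exact Measurable.aestronglyMeasurable (by fun_prop)

lemma coe_piCongrLeft_symm (σ : Perm ι) :
    (MeasurableEquiv.piCongrLeft (fun _ : ι => X) σ.symm : (ι → X) → ι → X) = fun x => x ∘ σ := by
  ext x i
  have := MeasurableEquiv.piCongrLeft_apply_apply (β := fun _ : ι => X) (e := σ.symm) x (σ i)
  simpa using this

lemma measurePreserving_comp_perm (σ : Perm ι) : MeasurePreserving (fun x : ι → X => x ∘ σ)
    (Measure.pi fun _ => μ) (Measure.pi fun _ => μ) := by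
  rw [← coe_piCongrLeft_symm]
  exact (measurePreserving_piCongrLeft (fun _ : ι => μ) σ.symm)

lemma measurableEmbedding_comp_perm (σ : Perm ι) :
    MeasurableEmbedding (fun x : ι → X => x ∘ σ) := by
  rw [← coe_piCongrLeft_symm]
  exact (MeasurableEquiv.piCongrLeft (fun _ : ι => X) σ.symm).measurableEmbedding

/-- The de Bruijn integrand. -/
noncomputable def dbInt (ε : X → X → ℝ) (φ : ι → X → ℝ) (x : ι → X) : ℝ :=
  pfSum e (Matrix.of fun i j => ε (x i) (x j)) * (Matrix.of fun i j => φ j (x i)).det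

lemma dbInt_perm (ε : X → X → ℝ) (φ : ι → X → ℝ) (x : ι → X) (σ : Perm ι) :
    dbInt e ε φ (x ∘ σ) = dbInt e ε φ x := by
  have h1 : (Matrix.of fun i j => φ j ((x ∘ σ) i)).det =
      ((Perm.sign σ : ℤ) : ℝ) * (Matrix.of fun i j => φ j (x i)).det := by
    rw [← Matrix.det_permute]; rfl
  have h2 : pfSum e (Matrix.of fun i j => ε ((x ∘ σ) i) ((x ∘ σ) j)) =
      ((Perm.sign σ : ℤ) : ℝ) * pfSum e (Matrix.of fun i j => ε (x i) (x j)) := by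
    unfold pfSum
    rw [Finset.mul_sum, ← Equiv.sum_comp (Equiv.mulLeft σ) (fun τ : Perm ι =>
      ((Perm.sign σ : ℤ) : ℝ) * (((Perm.sign τ : ℤ) : ℝ) *
        ∏ i : Fin m, (Matrix.of fun i j => ε (x i) (x j)) (τ (e (i, 0))) (τ (e (i, 1)))))]
    refine Finset.sum_congr rfl fun τ _ => ?_
    simp only [Equiv.coe_mulLeft, Perm.sign_mul, Units.val_mul, Int.cast_mul, ← mul_assoc]
    rw [show ((Perm.sign σ : ℤ) : ℝ) * ((Perm.sign σ : ℤ) : ℝ) = 1 by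
      rw [← Int.cast_mul, ← Units.val_mul, Int.units_mul_self]; simp]
    simp
  unfold dbInt
  rw [h1, h2]
  rw [show ∀ s a b : ℝ, s * a * (s * b) = (s * s) * (a * b) by intros; ring,
    ← Int.cast_mul, ← Units.val_mul, Int.units_mul_self]
  simp

lemma dbInt_eq_zero (ε : X → X → ℝ) (φ : ι → X → ℝ) (x : ι → X) {i j : ι} (hij : i ≠ j)
    (h : x i = x j) : dbInt e ε φ x = 0 := by
  unfold dbInt
  rw [Matrix.det_zero_of_row_eq hij (by ext k; simp [h]), mul_zero]

lemma dbInt_expand (ε : X → X → ℝ) (φ : ι → X → ℝ) (x : ι → X) :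
    dbInt e ε φ x = ∑ σ : Perm ι, ∑ τ : Perm ι, ((Perm.sign τ : ℤ) : ℝ) *
      ∏ i, (φ (τ (e (i, 0))) (x (σ (e (i, 0)))) * φ (τ (e (i, 1))) (x (σ (e (i, 1)))) *
        ε (x (σ (e (i, 0)))) (x (σ (e (i, 1))))) := by
  unfold dbInt pfSum
  rw [Finset.sum_mul]
  refine Finset.sum_congr rfl fun σ _ => ?_
  have h1 : ((Perm.sign σ : ℤ) : ℝ) * (Matrix.of fun i j => φ j (x i)).det =
      (Matrix.of fun i j => φ j (x (σ i))).det := by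
    rw [← Matrix.det_permute]; rfl
  rw [mul_comm ((Perm.sign σ : ℤ) : ℝ), mul_assoc, h1, ← Matrix.det_transpose, Matrix.det_apply',
    Finset.mul_sum]
  refine Finset.sum_congr rfl fun τ _ => ?_
  simp only [Matrix.transpose_apply, Matrix.of_apply]
  rw [prod_pairs e, Finset.prod_mul_distrib (f := fun i => _ * _)]
  ring

variable {ε : X → X → ℝ} (hε : Measurable (Function.uncurry ε)) (hb : ∀ x y, |ε x y| ≤ 1)
variable {φ : ι → X → ℝ} (hφ : ∀ j, Measurable (φ j)) (hi : ∀ j, Integrable (φ j) μ)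

include hε hb hφ hi
lemma integrable_pair (j k : ι) :
    Integrable (fun z : X × X => φ j z.1 * φ k z.2 * ε z.1 z.2) (μ.prod μ) :=
  ((hi j).mul_prod (hi k)).mul_bdd (c := 1) hε.aestronglyMeasurable
    (ae_of_all _ fun z => by simpa using hb z.1 z.2)

omit [DecidableEq ι] hb hi in
lemma measurable_pair (j k : ι) :
    Measurable (fun z : X × X => φ j z.1 * φ k z.2 * ε z.1 z.2) := by
  have : Measurable fun z : X × X => ε z.1 z.2 := hε
  fun_prop

lemma integral_dbInt : ∫ x, dbInt e ε φ x ∂(Measure.pi fun _ => μ) =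
    (Fintype.card ι).factorial *
      pfSum e (Matrix.of fun j k => ∫ z, φ j z.1 * φ k z.2 * ε z.1 z.2 ∂(μ.prod μ)) := by
  simp_rw [dbInt_expand]
  have mp := measurePreserving_comp_perm (ι := ι) μ
  have me := measurableEmbedding_comp_perm (ι := ι) (X := X)
  set F : Perm ι → (ι → X) → ℝ := fun τ x =>
    ∏ i, (φ (τ (e (i, 0))) (x ((e (i, 0)))) * φ (τ (e (i, 1))) (x ((e (i, 1)))) *
        ε (x ((e (i, 0)))) (x ((e (i, 1))))) with hF
  have hFi : ∀ τ, Integrable (F τ) (Measure.pi fun _ => μ) := fun τ =>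
    integrable_prod_pairs e μ (fun i z => φ (τ (e (i, 0))) z.1 * φ (τ (e (i, 1))) z.2 * ε z.1 z.2)
      (fun i => integrable_pair μ hε hb hφ hi _ _) (fun i => measurable_pair hε hφ _ _)
  have hint : ∀ σ τ : Perm ι, Integrable (fun x : ι → X => ((Perm.sign τ : ℤ) : ℝ) *
      F τ (x ∘ σ)) (Measure.pi fun _ => μ) := fun σ τ =>
    (((mp σ).integrable_comp_emb (me σ)).mpr (hFi τ)).const_mul _
  have := integral_finsetSum (μ := Measure.pi fun _ : ι => μ) (univ : Finset (Perm ι))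
    (f := fun σ x => ∑ τ : Perm ι, ((Perm.sign τ : ℤ) : ℝ) * F τ (x ∘ σ))
    (fun σ _ => integrable_finsetSum _ fun τ _ => hint σ τ)
  refine this.trans ?_
  have h2 : ∀ σ : Perm ι, ∫ x, ∑ τ : Perm ι, ((Perm.sign τ : ℤ) : ℝ) * F τ (x ∘ σ)
      ∂(Measure.pi fun _ => μ) =
      pfSum e (Matrix.of fun j k => ∫ z, φ j z.1 * φ k z.2 * ε z.1 z.2 ∂(μ.prod μ)) := by
    intro σ
    rw [integral_finsetSum _ (fun τ _ => hint σ τ)]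
    refine Finset.sum_congr rfl fun τ _ => ?_
    rw [integral_const_mul, (mp σ).integral_comp (me σ) (F τ)]
    congr 1
    exact integral_prod_pairs e μ
      (fun i z => φ (τ (e (i, 0))) z.1 * φ (τ (e (i, 1))) z.2 * ε z.1 z.2)
      (fun i => measurable_pair hε hφ _ _)
  simp_rw [h2]
  simp [Fintype.card_perm]
end

end

section

open Equiv Finset MeasureTheory Filter Topology
open scoped NNReal
section
variable {X : Type} [MeasurableSpace X] [MeasurableSingletonClass X]

/-- Symmetric integrands vanishing on coinciding coordinates, dominated by a product of `h`. -/
structure AltIntegrand (h : X → ℝ) (k : ℕ) (G : (Fin k → X) → ℝ) : Prop where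
  meas : Measurable G
  symm : ∀ (σ : Perm (Fin k)) x, G (x ∘ σ) = G x
  zero : ∀ x i j, i ≠ j → x i = x j → G x = 0
  bound : ∃ C, ∀ x, |G x| ≤ C * ∏ i, h (x i)

lemma measurable_cons (k : ℕ) : Measurable fun p : X × (Fin k → X) =>
    (Fin.cons p.1 p.2 : Fin (k + 1) → X) := by
  refine measurable_pi_lambda _ fun i => ?_
  refine Fin.cases ?_ (fun i => ?_) i
  · simpa using measurable_fst
  · simp only [Fin.cons_succ]; fun_prop

lemma measurable_cons_right (k : ℕ) (b : X) : Measurable fun p : Fin k → X =>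
    (Fin.cons b p : Fin (k + 1) → X) :=
  (measurable_cons k).comp (measurable_const.prodMk measurable_id)

lemma AltIntegrand.cons {h : X → ℝ} {k : ℕ} {G : (Fin (k + 1) → X) → ℝ}
    (hG : AltIntegrand h (k + 1) G) (b : X) :
    AltIntegrand h k fun y => G (Fin.cons b y) where
  meas := hG.meas.comp (measurable_cons_right k b)
  symm σ x := by
    let σ' : Perm (Fin (k + 1)) := (Equiv.Perm.decomposeFin).symm (0, σ)
    have : (Fin.cons b (x ∘ σ) : Fin (k + 1) → X) = (Fin.cons b x : Fin (k + 1) → X) ∘ σ' := by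
      ext i
      refine Fin.cases ?_ (fun i => ?_) i
      · simp [σ']
      · simp [σ', Equiv.Perm.decomposeFin_symm_apply_succ]
    rw [this, hG.symm]
  zero x i j hij hx := hG.zero _ i.succ j.succ (by simpa using hij) (by simpa using hx)
  bound := by
    obtain ⟨C, hC⟩ := hG.bound
    refine ⟨C * h b, fun x => (hC _).trans (le_of_eq ?_)⟩
    rw [Fin.prod_univ_succ]; simp [mul_assoc]

lemma AltIntegrand.integrable {h : X → ℝ} {k : ℕ} {G : (Fin k → X) → ℝ}
    (hG : AltIntegrand h k G) (ν : Measure X) [SigmaFinite ν] (hh : Integrable h ν) :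
    Integrable G (Measure.pi fun _ => ν) := by
  obtain ⟨C, hC⟩ := hG.bound
  have : Integrable (fun x : Fin k → X => C * ∏ i, h (x i)) (Measure.pi fun _ => ν) :=
    (Integrable.fintype_prod (f := fun _ => h) (fun _ => hh)).const_mul C
  exact this.mono' hG.meas.aestronglyMeasurable (ae_of_all _ hC)

lemma measurePreserving_cons (k : ℕ) (ν : Measure X) [SigmaFinite ν] :
    MeasurePreserving (fun p : X × (Fin k → X) => (Fin.cons p.1 p.2 : Fin (k + 1) → X))
      (ν.prod (Measure.pi fun _ => ν)) (Measure.pi fun _ => ν) := by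
  have := (measurePreserving_piFinSuccAbove (fun _ : Fin (k + 1) => ν) 0).symm
  convert this using 1
  funext p
  simp [MeasurableEquiv.piFinSuccAbove, Fin.consEquiv]

lemma measurableEmbedding_cons (k : ℕ) :
    MeasurableEmbedding (fun p : X × (Fin k → X) => (Fin.cons p.1 p.2 : Fin (k + 1) → X)) := by
  have := (MeasurableEquiv.piFinSuccAbove (fun _ : Fin (k + 1) => X) 0).symm.measurableEmbedding
  convert this using 1
  funext p
  simp [MeasurableEquiv.piFinSuccAbove, Fin.consEquiv]

lemma pi_fin_zero (ν : Measure X) : (Measure.pi fun _ : Fin 0 => ν) = Measure.dirac default :=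
  Measure.pi_of_empty _ _

lemma AltIntegrand.integrable_prod {h : X → ℝ} {k : ℕ} {G : (Fin (k + 1) → X) → ℝ}
    (hG : AltIntegrand h (k + 1) G) (ν : Measure X) [SigmaFinite ν] (hh : Integrable h ν) :
    Integrable (fun p : X × (Fin k → X) => G (Fin.cons p.1 p.2))
      (ν.prod (Measure.pi fun _ => ν)) :=
  ((measurePreserving_cons k ν).integrable_comp_emb (measurableEmbedding_cons k)).mpr
    (hG.integrable ν hh)

lemma AltIntegrand.integral_succ {h : X → ℝ} {k : ℕ} {G : (Fin (k + 1) → X) → ℝ}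
    (hG : AltIntegrand h (k + 1) G) (ν : Measure X) [SigmaFinite ν] (hh : Integrable h ν) :
    ∫ x, G x ∂(Measure.pi fun _ => ν) =
      ∫ x, ∫ y, G (Fin.cons x y) ∂(Measure.pi fun _ => ν) ∂ν := by
  rw [← (measurePreserving_cons k ν).integral_comp (measurableEmbedding_cons k),
    integral_prod _ (hG.integrable_prod ν hh)]

lemma AltIntegrand.swap {h : X → ℝ} {k : ℕ} {G : (Fin (k + 2) → X) → ℝ}
    (hG : AltIntegrand h (k + 2) G) (a b : X) (y : Fin k → X) :
    G (Fin.cons a (Fin.cons b y : Fin (k + 1) → X)) =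
      G (Fin.cons b (Fin.cons a y : Fin (k + 1) → X)) := by
  rw [← hG.symm (Equiv.swap 0 1)]
  congr 1
  ext i
  refine Fin.cases ?_ (fun i => Fin.cases ?_ (fun i => ?_) i) i
  · simp
  · simp
  · have h1 : (i.succ.succ : Fin (k + 2)) ≠ 0 := Fin.succ_ne_zero _
    have h2 : (i.succ.succ : Fin (k + 2)) ≠ 1 := by
      intro h; exact Fin.succ_ne_zero i (Fin.succ_injective _ h)
    simp [Equiv.swap_apply_of_ne_of_ne h1 h2]

lemma AltIntegrand.integral_add_dirac {h : X → ℝ} (μ : Measure X) [SigmaFinite μ]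
    (hh : Integrable h μ) (s : ℝ≥0) (b : X) {k : ℕ} :
    ∀ {G : (Fin (k + 1) → X) → ℝ}, AltIntegrand h (k + 1) G →
    ∫ x, G x ∂(Measure.pi fun _ => μ + s • Measure.dirac b) =
      ∫ x, G x ∂(Measure.pi fun _ => μ) +
        s * (k + 1) * ∫ y, G (Fin.cons b y) ∂(Measure.pi fun _ => μ) := by
  have hd : ∀ f : X → ℝ, Integrable f (s • Measure.dirac b) := fun f =>
    (integrable_dirac (by simp)).smul_measure_nnreal
  have hh' : Integrable h (μ + s • Measure.dirac b) := hh.add_measure (hd h)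
  induction k with
  | zero =>
    intro G hG
    have h0 := (hG.integrable_prod μ hh).integral_prod_left
    rw [hG.integral_succ _ hh', hG.integral_succ _ hh]
    simp only [pi_fin_zero] at h0 ⊢
    rw [integral_add_measure h0]
    · simp [integral_smul_nnreal_measure, NNReal.smul_def]
    · exact hd _
  | succ k ih =>
    intro G hG
    rw [hG.integral_succ _ hh', hG.integral_succ _ hh]
    have h1 : ∀ x, ∫ y, G (Fin.cons x y) ∂(Measure.pi fun _ => μ + s • Measure.dirac b) =
        ∫ y, G (Fin.cons x y) ∂(Measure.pi fun _ => μ) + s * (k + 1) *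
        ∫ y, G (Fin.cons x (Fin.cons b y : Fin (k + 1) → X)) ∂(Measure.pi fun _ => μ) :=
      fun x => ih (hG.cons x)
    simp_rw [h1]
    have hi1 : Integrable (fun x => ∫ y, G (Fin.cons x y) ∂(Measure.pi fun _ => μ)) μ :=
      (hG.integrable_prod μ hh).integral_prod_left
    have hi2 : Integrable (fun x => (s : ℝ) * (k + 1) *
        ∫ y, G (Fin.cons x (Fin.cons b y : Fin (k + 1) → X)) ∂(Measure.pi fun _ => μ)) μ := by
      refine Integrable.const_mul ?_ _
      simp_rw [hG.swap _ b]
      exact ((hG.cons b).integrable_prod μ hh).integral_prod_left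
    rw [integral_add_measure (by exact hi1.add hi2) (hd _)]
    rw [integral_add hi1 hi2, integral_const_mul]
    have h2 : ∫ x, ∫ y, G (Fin.cons x (Fin.cons b y : Fin (k + 1) → X)) ∂(Measure.pi fun _ => μ) ∂μ
        = ∫ y, G (Fin.cons b y) ∂(Measure.pi fun _ => μ) := by
      simp_rw [hG.swap _ b]
      rw [(hG.cons b).integral_succ μ hh]
    rw [h2]
    have h3 : ∀ y : Fin k → X, G (Fin.cons b (Fin.cons b y : Fin (k + 1) → X)) = 0 := fun y =>
      hG.zero _ 0 1 (by simp) (by simp)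
    rw [integral_smul_nnreal_measure, integral_dirac]
    simp only [h3, integral_zero, mul_zero, add_zero, NNReal.smul_def, smul_eq_mul]
    push_cast
    ring

/-- Normalised configuration integral. -/
noncomputable def cfg (k : ℕ) (G : (Fin k → X) → ℝ) (μ : Measure X) : ℝ :=
  (k.factorial : ℝ)⁻¹ * ∫ x, G x ∂(Measure.pi fun _ => μ)

lemma cfg_add_dirac {h : X → ℝ} (μ : Measure X) [SigmaFinite μ]
    (hh : Integrable h μ) (s : ℝ≥0) (b : X) {k : ℕ}
    {G : (Fin (k + 1) → X) → ℝ} (hG : AltIntegrand h (k + 1) G) :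
    cfg (k + 1) G (μ + s • Measure.dirac b) =
      cfg (k + 1) G μ + s * cfg k (fun y => G (Fin.cons b y)) μ := by
  unfold cfg
  rw [hG.integral_add_dirac μ hh s b, Nat.factorial_succ]
  have : (k.factorial : ℝ) ≠ 0 := by positivity
  have h2 : (k : ℝ) + 1 ≠ 0 := by positivity
  push_cast
  field_simp

/-- Add atoms of mass `s` at the given points. -/
noncomputable def addAtoms (μ : Measure X) (s : ℝ≥0) : (n : ℕ) → (Fin n → X) → Measure X
  | 0, _ => μ
  | n + 1, b => addAtoms μ s n (fun i => b i.succ) + s • Measure.dirac (b 0)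

instance sigmaFinite_addAtoms (μ : Measure X) [SigmaFinite μ] (s : ℝ≥0) (n : ℕ) (b : Fin n → X) :
    SigmaFinite (addAtoms μ s n b) := by
  induction n with
  | zero => simpa [addAtoms]
  | succ n ih => unfold addAtoms; have := ih fun i => b i.succ; infer_instance

lemma integrable_addAtoms {μ : Measure X} {s : ℝ≥0} {n : ℕ} {b : Fin n → X} {f : X → ℝ}
    (hf : Integrable f μ) : Integrable f (addAtoms μ s n b) := by
  induction n with
  | zero => simpa [addAtoms]
  | succ n ih =>
    unfold addAtoms
    exact ih.add_measure (integrable_dirac (by simp)).smul_measure_nnreal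

lemma integral_addAtoms {μ : Measure X} {s : ℝ≥0} {n : ℕ} {b : Fin n → X} {f : X → ℝ}
    (hf : Integrable f μ) : ∫ x, f x ∂(addAtoms μ s n b) = ∫ x, f x ∂μ + s * ∑ i, f (b i) := by
  induction n with
  | zero => simp [addAtoms]
  | succ n ih =>
    unfold addAtoms
    rw [integral_add_measure (integrable_addAtoms hf)
      (integrable_dirac (by simp)).smul_measure_nnreal, ih,
      integral_smul_nnreal_measure, integral_dirac, Fin.sum_univ_succ, NNReal.smul_def, smul_eq_mul]
    ring

lemma cfg_addAtoms_bound {h : X → ℝ} (μ : Measure X) [SigmaFinite μ]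
    (hh : Integrable h μ) (n : ℕ) : ∀ (b : Fin n → X) {k : ℕ}
    {G : (Fin k → X) → ℝ} (_ : AltIntegrand h k G),
    ∃ C, ∀ s : ℝ≥0, 1 ≤ s → |cfg k G (addAtoms μ s n b)| ≤ C * s ^ n := by
  induction n with
  | zero => intro b k G hG; exact ⟨|cfg k G μ|, fun s _ => by simp [addAtoms]⟩
  | succ n ih =>
    intro b k G hG
    cases k with
    | zero =>
      refine ⟨|G default|, fun s hs => ?_⟩
      have : (1 : ℝ) ≤ s ^ (n + 1) := one_le_pow₀ (by exact_mod_cast hs)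
      have h0 : cfg 0 G (addAtoms μ s (n + 1) b) = G default := by
        simp [cfg, pi_fin_zero]
      rw [h0]
      exact le_mul_of_one_le_right (abs_nonneg _) this
    | succ k =>
      obtain ⟨C1, h1⟩ := ih (fun i => b i.succ) hG
      obtain ⟨C2, h2⟩ := ih (fun i => b i.succ) (hG.cons (b 0))
      refine ⟨|C1| + C2, fun s hs => ?_⟩
      have hs' : (1 : ℝ) ≤ s := by exact_mod_cast hs
      rw [addAtoms, cfg_add_dirac _ (integrable_addAtoms hh) s (b 0) hG]
      refine (abs_add_le _ _).trans ?_
      rw [abs_mul, abs_of_nonneg s.coe_nonneg, add_mul]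
      refine add_le_add ((h1 s hs).trans ?_) ?_
      · rw [pow_succ]
        have : C1 * (s:ℝ) ^ n ≤ |C1| * (s:ℝ)^n := by gcongr; exact le_abs_self _
        refine this.trans ?_
        gcongr
        exact le_mul_of_one_le_right (by positivity) hs'
      · calc (s : ℝ) * _ ≤ s * (C2 * s ^ n) := by gcongr; exact h2 s hs
          _ = _ := by ring

/-- Concatenation of `b` and `y`. -/
def glue {X : Type} (n k : ℕ) (b : Fin n → X) (y : Fin k → X) : Fin (k + n) → X := fun i =>
  if h : (i : ℕ) < n then b ⟨i, h⟩ else y ⟨i - n, by omega⟩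

lemma glue_zero {X : Type} (k : ℕ) (b : Fin 0 → X) (y : Fin k → X) : glue 0 k b y = y := by
  ext i; simp [glue]

lemma glue_succ {X : Type} (n k : ℕ) (b : Fin (n + 1) → X) (y : Fin k → X) :
    glue (n + 1) k b y = (Fin.cons (b 0) (glue n k (fun i => b i.succ) y) : Fin (k + n + 1) → X) := by
  ext i
  refine Fin.cases ?_ (fun i => ?_) i
  · simp [glue]
  · simp [glue]

lemma tendsto_cfg_addAtoms {h : X → ℝ} (μ : Measure X) [SigmaFinite μ]
    (hh : Integrable h μ) (k n : ℕ) : ∀ (b : Fin n → X)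
    {G : (Fin (k + n) → X) → ℝ} (_ : AltIntegrand h (k + n) G),
    Tendsto (fun s : ℝ≥0 => ((s : ℝ) ^ n)⁻¹ * cfg (k + n) G (addAtoms μ s n b)) atTop
      (𝓝 (cfg k (fun y => G (glue n k b y)) μ)) := by
  induction n with
  | zero => intro b G hG; simp [addAtoms, glue_zero]
  | succ n ih =>
    intro b G hG
    obtain ⟨C, hC⟩ := cfg_addAtoms_bound μ hh n (fun i => b i.succ) hG
    have h1 : Tendsto (fun s : ℝ≥0 => ((s : ℝ) ^ (n + 1))⁻¹ *
        cfg (k + n + 1) G (addAtoms μ s n fun i => b i.succ)) atTop (𝓝 0) := by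
      have hlim : Tendsto (fun s : ℝ≥0 => C * ((s : ℝ))⁻¹) atTop (𝓝 0) := by
        have : Tendsto (fun s : ℝ≥0 => ((s : ℝ))⁻¹) atTop (𝓝 0) :=
          tendsto_inv_atTop_zero.comp (NNReal.tendsto_coe_atTop.mpr tendsto_id)
        simpa using this.const_mul C
      refine squeeze_zero_norm' ?_ hlim
      filter_upwards [eventually_ge_atTop 1] with s hs
      have hs' : (0 : ℝ) < s := by exact_mod_cast (zero_lt_one.trans_le hs)
      rw [norm_mul, Real.norm_eq_abs, Real.norm_eq_abs, abs_of_pos (by positivity)]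
      calc ((s : ℝ) ^ (n + 1))⁻¹ * _ ≤ ((s : ℝ) ^ (n + 1))⁻¹ * (C * s ^ n) := by
            gcongr; exact hC s hs
        _ = C * (s : ℝ)⁻¹ := by field_simp; ring
    have h2 := ih (fun i => b i.succ) (hG.cons (b 0))
    have h3 := h1.add h2
    simp only [glue_succ]
    rw [zero_add] at h3
    refine h3.congr' ?_
    filter_upwards [eventually_ge_atTop 1] with s hs
    have hs' : (0 : ℝ) < s := by exact_mod_cast (zero_lt_one.trans_le hs)
    have h4 := cfg_add_dirac (k := k + n) (addAtoms μ s n fun i => b i.succ) (integrable_addAtoms hh) s (b 0) hG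
    rw [addAtoms]
    refine Eq.trans ?_ (congrArg _ h4.symm)
    generalize cfg (k + n + 1) G (addAtoms μ s n fun i => b i.succ) = A
    have h5 : ∀ B : ℝ, ((s : ℝ) ^ (n + 1))⁻¹ * A + ((s : ℝ) ^ n)⁻¹ * B =
        ((s : ℝ) ^ (n + 1))⁻¹ * (A + s * B) := by
      intro B; field_simp; ring
    exact h5 _
end

end

section

open Equiv Finset MeasureTheory Filter Topology
open scoped NNReal
section
variable {ι : Type} [Fintype ι] [DecidableEq ι] {m : ℕ} (e : Fin m × Fin 2 ≃ ι)

lemma stdSympl_mul_transpose : stdSympl e * (stdSympl e).transpose = 1 := by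
  ext a b
  obtain ⟨⟨i, c⟩, rfl⟩ := e.surjective a
  obtain ⟨⟨j, d⟩, rfl⟩ := e.surjective b
  rw [Matrix.mul_apply, ← e.sum_comp, Fintype.sum_prod_type]
  simp only [Matrix.transpose_apply, stdSympl_apply]
  simp only [stdSympl, Fin.sum_univ_two, Matrix.of_apply, Equiv.refl_symm, Equiv.refl_apply,
    Matrix.one_apply, e.apply_eq_iff_eq, Prod.mk.injEq]
  rw [Finset.sum_eq_single i]
  · by_cases h : j = i
    · subst h; fin_cases c <;> fin_cases d <;> simp
    · simp [h, Ne.symm h]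
  · intro k _ hk
    simp [Ne.symm hk]
  · simp

lemma dotProduct_stdSympl (u v : ι → ℝ) :
    ∑ k, (∑ j, u j * stdSympl e k j) * v k =
      ∑ i, (u (e (i, 1)) * v (e (i, 0)) - u (e (i, 0)) * v (e (i, 1))) := by
  rw [← e.sum_comp, Fintype.sum_prod_type]
  refine Finset.sum_congr rfl fun i _ => ?_
  have : ∀ c, ∑ j, u j * stdSympl e (e (i, c)) j =
      if c = 0 then u (e (i, 1)) else -u (e (i, 0)) := by
    intro c
    rw [← e.sum_comp, Fintype.sum_prod_type, Finset.sum_eq_single i]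
    · simp only [stdSympl_apply]
      fin_cases c <;> simp [stdSympl]
    · intro j _ hj
      simp only [stdSympl_apply]
      simp [stdSympl, Ne.symm hj]
    · simp
  simp only [Fin.sum_univ_two, this]
  simp; ring

lemma det_rank_update {n : ℕ} (Φ Ψ : Matrix ι (Fin n) ℝ) (E : Matrix (Fin n) (Fin n) ℝ) (s : ℝ) :
    (stdSympl e + s • (Φ * Ψ.transpose - Ψ * Φ.transpose + s • (Φ * E * Φ.transpose))).det =
      (1 + s • Matrix.fromBlocks (-(Φ.transpose * (stdSympl e).transpose * Ψ))
        (Φ.transpose * (stdSympl e).transpose * Φ)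
        (-(Ψ.transpose * (stdSympl e).transpose * Ψ) - E)
        (Ψ.transpose * (stdSympl e).transpose * Φ)).det := by
  set J := stdSympl e with hJ
  set U : Matrix ι (Fin n ⊕ Fin n) ℝ := Matrix.fromCols (-Ψ) Φ with hU
  set V : Matrix (Fin n ⊕ Fin n) ι ℝ :=
    Matrix.fromRows Φ.transpose (Ψ.transpose + s • (E * Φ.transpose)) with hV
  have h1 : J + s • (Φ * Ψ.transpose - Ψ * Φ.transpose + s • (Φ * E * Φ.transpose)) =
      J * (1 + (s • (J.transpose * U)) * V) := by
    rw [Matrix.mul_add, Matrix.mul_one, Matrix.smul_mul, Matrix.mul_smul, ← Matrix.mul_assoc,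
      ← Matrix.mul_assoc, hJ, stdSympl_mul_transpose, Matrix.one_mul, hU, hV,
      Matrix.fromCols_mul_fromRows]
    congr 2
    simp only [Matrix.neg_mul, Matrix.mul_add, Matrix.mul_smul, Matrix.mul_assoc]
    abel
  rw [h1, Matrix.det_mul, hJ, det_stdSympl, one_mul, Matrix.det_one_add_mul_comm, ← hJ]
  have h2 : Matrix.fromBlocks (1 : Matrix (Fin n) (Fin n) ℝ) 0 (-(s • E)) 1 *
      (1 + V * (s • (J.transpose * U))) =
      (1 + s • Matrix.fromBlocks (-(Φ.transpose * J.transpose * Ψ))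
        (Φ.transpose * J.transpose * Φ) (-(Ψ.transpose * J.transpose * Ψ) - E)
        (Ψ.transpose * J.transpose * Φ)) := by
    rw [hU, hV, Matrix.mul_smul, Matrix.mul_fromCols, Matrix.fromRows_mul_fromCols,
      ← Matrix.fromBlocks_one, Matrix.fromBlocks_smul, Matrix.fromBlocks_smul,
      Matrix.fromBlocks_add, Matrix.fromBlocks_add, Matrix.fromBlocks_multiply]
    congr 1
    · simp [Matrix.mul_assoc]
    · simp [Matrix.mul_assoc]
    · simp only [Matrix.mul_neg, Matrix.neg_mul, Matrix.smul_mul, Matrix.mul_smul, Matrix.add_mul,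
        Matrix.mul_add, Matrix.mul_one, Matrix.one_mul, Matrix.mul_assoc, zero_add, smul_add,
        smul_neg, smul_sub]
      abel
    · simp only [Matrix.mul_neg, Matrix.neg_mul, Matrix.smul_mul, Matrix.mul_smul, Matrix.add_mul,
        Matrix.mul_add, Matrix.mul_one, Matrix.one_mul, Matrix.mul_assoc, zero_add, smul_add,
        smul_neg, smul_sub, Matrix.mul_zero]
      abel
  rw [← h2, Matrix.det_mul, Matrix.det_fromBlocks_zero₁₂]
  simp

lemma tendsto_det_one_add {n : ℕ} (K : Matrix (Fin n ⊕ Fin n) (Fin n ⊕ Fin n) ℝ) :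
    Tendsto (fun s : ℝ≥0 => ((s : ℝ) ^ n)⁻¹ ^ 2 * (1 + (s : ℝ) • K).det) atTop (𝓝 K.det) := by
  have hinv : Tendsto (fun s : ℝ≥0 => ((s : ℝ))⁻¹) atTop (𝓝 0) :=
    tendsto_inv_atTop_zero.comp (NNReal.tendsto_coe_atTop.mpr tendsto_id)
  have hc : Continuous fun t : ℝ => (t • (1 : Matrix (Fin n ⊕ Fin n) (Fin n ⊕ Fin n) ℝ) + K).det := by
    fun_prop
  have := (hc.tendsto 0).comp hinv
  simp only [zero_smul, zero_add] at this
  refine this.congr' ?_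
  filter_upwards [eventually_ge_atTop 1] with s hs
  have hs' : (s : ℝ) ≠ 0 := by
    have : (0 : ℝ) < s := by exact_mod_cast (zero_lt_one.trans_le hs)
    exact this.ne'
  have h : (s : ℝ)⁻¹ • (1 : Matrix (Fin n ⊕ Fin n) (Fin n ⊕ Fin n) ℝ) + K =
      (s : ℝ)⁻¹ • (1 + (s : ℝ) • K) := by
    rw [smul_add, smul_smul, inv_mul_cancel₀ hs', one_smul]
  simp only [Function.comp]
  rw [h, Matrix.det_smul]
  congr 1
  simp
  ring
end

section
variable {k : ℕ} {m : ℕ} (e : Fin m × Fin 2 ≃ Fin k)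
variable {X : Type} [MeasurableSpace X] [MeasurableSingletonClass X]
variable {ε : X → X → ℝ} (hε : Measurable (Function.uncurry ε)) (hb : ∀ x y, |ε x y| ≤ 1)
  (ha : ∀ x y, ε x y = - ε y x)
variable {φ : Fin k → X → ℝ} (hφ : ∀ j, Measurable (φ j))

include hε hb hφ in
lemma altIntegrand_dbInt : AltIntegrand (fun x => ∑ j, |φ j x|) k (dbInt e ε φ) where
  meas := by
    simp_rw [funext (dbInt_expand e ε φ)]
    have : ∀ a b, Measurable fun x : Fin k → X => ε (x a) (x b) := fun a b => by
      have h : Measurable fun x : Fin k → X => (x a, x b) := by fun_prop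
      exact hε.comp h
    fun_prop
  symm σ x := dbInt_perm e ε φ x σ
  zero x i j hij h := dbInt_eq_zero e ε φ x hij h
  bound := by
    refine ⟨(k.factorial : ℝ) * k.factorial, fun x => ?_⟩
    rw [dbInt_expand]
    have : ∀ σ τ : Perm (Fin k), |((Perm.sign τ : ℤ) : ℝ) *
        ∏ i, (φ (τ (e (i, 0))) (x (σ (e (i, 0)))) * φ (τ (e (i, 1))) (x (σ (e (i, 1)))) *
        ε (x (σ (e (i, 0)))) (x (σ (e (i, 1)))))| ≤ ∏ i, ∑ j, |φ j (x i)| := by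
      intro σ τ
      rw [abs_mul, show |((Perm.sign τ : ℤ) : ℝ)| = 1 by
        rcases Int.units_eq_one_or (Perm.sign τ) with h | h <;> simp [h], one_mul, Finset.abs_prod,
        ← Equiv.prod_comp σ, prod_pairs e]
      refine Finset.prod_le_prod (fun i _ => abs_nonneg _) fun i _ => ?_
      have hs : ∀ a y, |φ a y| ≤ ∑ j, |φ j y| := fun a y =>
        Finset.single_le_sum (f := fun j => |φ j y|) (fun j _ => abs_nonneg _) (Finset.mem_univ a)
      rw [abs_mul, abs_mul]
      calc _ ≤ |φ (τ (e (i, 0))) (x (σ (e (i, 0))))| * |φ (τ (e (i, 1))) (x (σ (e (i, 1))))| * 1 := by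
            gcongr; exact hb _ _
        _ ≤ _ := by
          rw [mul_one]
          gcongr <;> apply hs
    calc _ ≤ ∑ σ : Perm (Fin k), ∑ τ : Perm (Fin k), ∏ i, ∑ j, |φ j (x i)| := by
          refine (Finset.abs_sum_le_sum_abs _ _).trans (Finset.sum_le_sum fun σ _ => ?_)
          exact (Finset.abs_sum_le_sum_abs _ _).trans (Finset.sum_le_sum fun τ _ => this σ τ)
      _ = _ := by simp [Fintype.card_perm]; ring

/-- The integral operator with kernel `ε`. -/
noncomputable def epsOp (ε : X → X → ℝ) (μ : Measure X) (g : X → ℝ) (x : X) : ℝ :=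
  ∫ y, ε x y * g y ∂μ

variable (μ : Measure X) [SigmaFinite μ] (hi : ∀ j, Integrable (φ j) μ)

include hε hb ha hφ hi in
lemma pairing_addAtoms (s : ℝ≥0) (n : ℕ) (b : Fin n → X) (j l : Fin k) :
    ∫ z, φ j z.1 * φ l z.2 * ε z.1 z.2 ∂((addAtoms μ s n b).prod (addAtoms μ s n b)) =
      ∫ z, φ j z.1 * φ l z.2 * ε z.1 z.2 ∂(μ.prod μ) + s *
        ((∑ a, φ j (b a) * epsOp ε μ (φ l) (b a) - ∑ a, epsOp ε μ (φ j) (b a) * φ l (b a)) +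
          s * ∑ a, (∑ c, φ j (b c) * ε (b c) (b a)) * φ l (b a)) := by
  have hε1 : ∀ x, Measurable (ε x) := fun x => hε.comp (measurable_const.prodMk measurable_id)
  have hint : ∀ (ν : Measure X) (_ : ∀ j, Integrable (φ j) ν) x l, Integrable (fun y => ε x y * φ l y) ν := by
    intro ν hν x l
    exact (hν l).bdd_mul (c := 1) (hε1 x).aestronglyMeasurable (ae_of_all _ fun y => by simpa using hb x y)
  have hiν : ∀ j, Integrable (φ j) (addAtoms μ s n b) := fun j => integrable_addAtoms (hi j)
  have key : ∀ (ν : Measure X) [SigmaFinite ν] (_ : ∀ j, Integrable (φ j) ν),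
      Integrable (fun x => φ j x * epsOp ε ν (φ l) x) ν ∧
      ∫ z, φ j z.1 * φ l z.2 * ε z.1 z.2 ∂(ν.prod ν) = ∫ x, φ j x * epsOp ε ν (φ l) x ∂ν := by
    intro ν _ hν
    have h := integrable_pair ν hε hb hφ hν j l
    have heq : ∀ x, ∫ y, φ j x * φ l y * ε x y ∂ν = φ j x * epsOp ε ν (φ l) x := by
      intro x
      rw [epsOp, ← integral_const_mul]
      congr 1; ext y; ring
    refine ⟨?_, ?_⟩
    · have := h.integral_prod_left
      simp only [heq] at this
      exact this
    · rw [integral_prod _ h]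
      simp only [heq]
  have hE : ∀ x, epsOp ε (addAtoms μ s n b) (φ l) x =
      epsOp ε μ (φ l) x + s * ∑ a, ε x (b a) * φ l (b a) := fun x =>
    integral_addAtoms (hint μ hi x l)
  rw [(key _ hiν).2, (key μ hi).2]
  simp_rw [hE]
  have hsum : Integrable (fun x => φ j x * (s * ∑ a, ε x (b a) * φ l (b a))) μ := by
    simp_rw [Finset.mul_sum]
    refine integrable_finsetSum _ fun a _ => ?_
    have h1 := (hint μ hi (b a) j).const_mul (-(s * φ l (b a)))
    refine h1.congr (ae_of_all _ fun x => ?_)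
    simp only [ha (b a) x]; ring
  have hsum' : ∫ x, φ j x * (s * ∑ a, ε x (b a) * φ l (b a)) ∂μ =
      - (s * ∑ a, epsOp ε μ (φ j) (b a) * φ l (b a)) := by
    rw [Finset.mul_sum, ← Finset.sum_neg_distrib]
    have : ∀ x, φ j x * (s * ∑ a, ε x (b a) * φ l (b a)) =
        ∑ a, (-(s * φ l (b a))) * (ε (b a) x * φ j x) := by
      intro x
      rw [Finset.mul_sum, Finset.mul_sum]
      refine Finset.sum_congr rfl fun a _ => ?_
      rw [ha x (b a)]; ring
    simp_rw [this]
    rw [integral_finsetSum _ fun a _ => (hint μ hi (b a) j).const_mul _]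
    refine Finset.sum_congr rfl fun a _ => ?_
    rw [integral_const_mul, epsOp]; ring
  have hsplit : ∀ x, φ j x * (epsOp ε μ (φ l) x + s * ∑ a, ε x (b a) * φ l (b a)) =
      φ j x * epsOp ε μ (φ l) x + φ j x * (s * ∑ a, ε x (b a) * φ l (b a)) := fun x => mul_add _ _ _
  simp_rw [hsplit]
  rw [integral_addAtoms (by exact (key μ hi).1.add hsum), integral_add (key μ hi).1 hsum, hsum',
    Finset.sum_add_distrib]
  have hdouble : ∑ a, (∑ c, φ j (b c) * ε (b c) (b a)) * φ l (b a) =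
      ∑ c, φ j (b c) * ∑ a, ε (b c) (b a) * φ l (b a) := by
    simp_rw [Finset.sum_mul, Finset.mul_sum]
    rw [Finset.sum_comm]
    refine Finset.sum_congr rfl fun a _ => Finset.sum_congr rfl fun c _ => by ring
  have h3 : ∑ i, φ j (b i) * (s * ∑ a, ε (b i) (b a) * φ l (b a)) =
      s * ∑ c, φ j (b c) * ∑ a, ε (b c) (b a) * φ l (b a) := by
    rw [Finset.mul_sum]
    refine Finset.sum_congr rfl fun c _ => by ring
  rw [hdouble, h3]
  ring

/-- The scalar kernel of the Pfaffian process. -/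
noncomputable def kerS (ε : X → X → ℝ) (φ : Fin k → X → ℝ) (x y : X) : ℝ :=
  ∑ i, (φ (e (i, 0)) x * epsOp ε μ (φ (e (i, 1))) y - φ (e (i, 1)) x * epsOp ε μ (φ (e (i, 0))) y)

/-- The derivative-type kernel of the Pfaffian process. -/
noncomputable def kerD (φ : Fin k → X → ℝ) (x y : X) : ℝ :=
  ∑ i, (φ (e (i, 1)) x * φ (e (i, 0)) y - φ (e (i, 0)) x * φ (e (i, 1)) y)

/-- The integral-type kernel of the Pfaffian process. -/
noncomputable def kerI (ε : X → X → ℝ) (φ : Fin k → X → ℝ) (x y : X) : ℝ :=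
  ∑ i, (epsOp ε μ (φ (e (i, 0))) x * epsOp ε μ (φ (e (i, 1))) y -
    epsOp ε μ (φ (e (i, 1))) x * epsOp ε μ (φ (e (i, 0))) y)

/-- The matrix kernel evaluated at the points `b`. -/
noncomputable def kerMat (ε : X → X → ℝ) (φ : Fin k → X → ℝ) {n : ℕ} (b : Fin n → X) :
    Matrix (Fin n ⊕ Fin n) (Fin n ⊕ Fin n) ℝ :=
  Matrix.fromBlocks (Matrix.of fun a c => kerS e μ ε φ (b a) (b c))
    (Matrix.of fun a c => kerD e φ (b a) (b c))
    (Matrix.of fun a c => kerI e μ ε φ (b a) (b c) - ε (b a) (b c))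
    (Matrix.of fun a c => kerS e μ ε φ (b c) (b a))

include hε hb hφ hi in
lemma cfg_dbInt (ν : Measure X) [SigmaFinite ν] (hν : ∀ j, Integrable (φ j) ν) :
    cfg k (dbInt e ε φ) ν =
      pfSum e (Matrix.of fun j k => ∫ z, φ j z.1 * φ k z.2 * ε z.1 z.2 ∂(ν.prod ν)) := by
  rw [cfg, integral_dbInt e ν hε hb hφ hν, Fintype.card_fin, inv_mul_cancel_left₀ (by positivity)]

include hε hb ha hφ hi in
lemma sq_cfg_dbInt_addAtoms
    (hJ : (Matrix.of fun j k => ∫ z, φ j z.1 * φ k z.2 * ε z.1 z.2 ∂(μ.prod μ)) = stdSympl e)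
    (s : ℝ≥0) (n : ℕ) (b : Fin n → X) :
    cfg k (dbInt e ε φ) (addAtoms μ s n b) ^ 2 =
      pfSum e (stdSympl e) ^ 2 * (1 + (s : ℝ) • kerMat e μ ε φ b).det := by
  rw [cfg_dbInt e hε hb hφ μ hi _ fun j => integrable_addAtoms (hi j), pfSum_sq]
  · congr 1
    have h := det_rank_update e (Matrix.of fun j a => φ j (b a))
      (Matrix.of fun j a => epsOp ε μ (φ j) (b a)) (Matrix.of fun a c => ε (b a) (b c)) s
    have h1 : (Matrix.of fun j k => ∫ z, φ j z.1 * φ k z.2 * ε z.1 z.2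
        ∂((addAtoms μ s n b).prod (addAtoms μ s n b))) = stdSympl e + (s : ℝ) •
        ((Matrix.of fun j a => φ j (b a)) * (Matrix.of fun j a => epsOp ε μ (φ j) (b a)).transpose -
        (Matrix.of fun j a => epsOp ε μ (φ j) (b a)) * (Matrix.of fun j a => φ j (b a)).transpose +
        (s : ℝ) • ((Matrix.of fun j a => φ j (b a)) * (Matrix.of fun a c => ε (b a) (b c)) *
          (Matrix.of fun j a => φ j (b a)).transpose)) := by
      rw [← hJ]
      ext j l
      simp only [Matrix.of_apply, Matrix.add_apply, Matrix.smul_apply, Matrix.sub_apply,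
        Matrix.mul_apply, Matrix.transpose_apply, smul_eq_mul]
      exact pairing_addAtoms hε hb ha hφ μ hi s n b j l
    rw [h1, h, kerMat]
    congr 3
    refine Matrix.fromBlocks_inj.mpr ⟨?_, ?_, ?_, ?_⟩
    · ext a c
      simp only [Matrix.neg_apply, Matrix.mul_apply, Matrix.transpose_apply, Matrix.of_apply,
        dotProduct_stdSympl, kerS]
      rw [← Finset.sum_neg_distrib]
      exact Finset.sum_congr rfl fun i _ => by ring
    · ext a c
      simp only [Matrix.mul_apply, Matrix.transpose_apply, Matrix.of_apply,
        dotProduct_stdSympl, kerD]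
    · ext a c
      simp only [Matrix.neg_apply, Matrix.sub_apply, Matrix.mul_apply, Matrix.transpose_apply,
        Matrix.of_apply, dotProduct_stdSympl, kerI]
      rw [← Finset.sum_neg_distrib]
      congr 1
      exact Finset.sum_congr rfl fun i _ => by ring
    · ext a c
      simp only [Matrix.mul_apply, Matrix.transpose_apply, Matrix.of_apply,
        dotProduct_stdSympl, kerS]
      exact Finset.sum_congr rfl fun i _ => by ring
  · ext j l
    simp only [Matrix.transpose_apply, Matrix.of_apply, Matrix.neg_apply]
    rw [← integral_prod_swap, ← integral_neg]
    congr 1; ext z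
    simp only [Prod.fst_swap, Prod.snd_swap]
    rw [ha z.2 z.1]; ring
end

section
variable {k n : ℕ} {m : ℕ} (e : Fin m × Fin 2 ≃ Fin (k + n))
variable {X : Type} [MeasurableSpace X] [MeasurableSingletonClass X]
variable {ε : X → X → ℝ} (hε : Measurable (Function.uncurry ε)) (hb : ∀ x y, |ε x y| ≤ 1)
  (ha : ∀ x y, ε x y = - ε y x)
variable {φ : Fin (k + n) → X → ℝ} (hφ : ∀ j, Measurable (φ j))
variable (μ : Measure X) [SigmaFinite μ] (hi : ∀ j, Integrable (φ j) μ)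
include hε hb ha hφ hi

/-- Correlation functions of a Pfaffian ensemble are square roots of determinants. -/
lemma sq_cfg_dbInt_glue
    (hJ : (Matrix.of fun j k => ∫ z, φ j z.1 * φ k z.2 * ε z.1 z.2 ∂(μ.prod μ)) = stdSympl e)
    (b : Fin n → X) :
    cfg k (fun y => dbInt e ε φ (glue n k b y)) μ ^ 2 =
      cfg (k + n) (dbInt e ε φ) μ ^ 2 * (kerMat e μ ε φ b).det := by
  have hh : Integrable (fun x => ∑ j, |φ j x|) μ := integrable_finsetSum _ fun j _ => (hi j).abs
  have h1 := (tendsto_cfg_addAtoms μ hh k n b (altIntegrand_dbInt e hε hb hφ)).pow 2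
  have h2 := (tendsto_det_one_add (kerMat e μ ε φ b)).const_mul (pfSum e (stdSympl e) ^ 2)
  rw [cfg_dbInt e hε hb hφ μ hi μ hi, hJ]
  refine tendsto_nhds_unique h1 (h2.congr fun s => ?_)
  rw [mul_pow, sq_cfg_dbInt_addAtoms e hε hb ha hφ μ hi hJ]
  ring
end

end

section

open Equiv Finset MeasureTheory Filter Topology
open scoped NNReal

section
variable {X : Type} [MeasurableSpace X] [MeasurableSingletonClass X]

lemma addAtoms_add (μ : Measure X) (ρ : Measure X) (s : ℝ≥0) (n : ℕ) (b : Fin n → X) :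
    addAtoms (μ + ρ) s n b = addAtoms μ s n b + ρ := by
  induction n with
  | zero => rfl
  | succ n ih => simp only [addAtoms, ih]; abel

lemma addAtoms_singleton (μ : Measure X) (s : ℝ≥0) (n : ℕ) (b : Fin n → X) (x₀ : X)
    (h0 : μ {x₀} = 0) (hb : ∀ i, b i ≠ x₀) : addAtoms μ s n b {x₀} = 0 := by
  induction n with
  | zero => exact h0
  | succ n ih =>
    simp only [addAtoms, Measure.add_apply, ih (fun i => b i.succ) (fun i => hb _)]
    simp [hb 0]

variable {k n : ℕ} {m : ℕ} (e : Fin m × Fin 2 ≃ Fin (k + n + 1))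
variable {ε : X → X → ℝ} (hε : Measurable (Function.uncurry ε)) (hb : ∀ x y, |ε x y| ≤ 1)
  (ha : ∀ x y, ε x y = - ε y x)
variable {φ : Fin (k + n + 1) → X → ℝ} (hφ : ∀ j, Measurable (φ j))
variable (μ : Measure X) [SigmaFinite μ] (hi : ∀ j, Integrable (φ j) μ) (x₀ : X)
  (h0 : μ {x₀} = 0) (hv : ∀ x, (∀ i, x i ≠ x₀) → dbInt e ε φ x = 0)
include hε hb ha hφ hi h0 hv

lemma cfg_dbInt_cons (s : ℝ≥0) (n' : ℕ) (b : Fin n' → X) (hbx : ∀ i, b i ≠ x₀) :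
    cfg (k + n) (fun y => dbInt e ε φ (Fin.cons x₀ y)) (addAtoms μ s n' b) =
      cfg (k + n + 1) (dbInt e ε φ) (addAtoms (μ + (1 : ℝ≥0) • Measure.dirac x₀) s n' b) := by
  have hh : Integrable (fun x => ∑ j, |φ j x|) (addAtoms μ s n' b) :=
    integrable_addAtoms (integrable_finsetSum _ fun j _ => (hi j).abs)
  rw [addAtoms_add, cfg_add_dirac _ hh 1 x₀ (altIntegrand_dbInt e hε hb hφ)]
  have hz : cfg (k + n + 1) (dbInt e ε φ) (addAtoms μ s n' b) = 0 := by
    rw [cfg, integral_eq_zero_of_ae, mul_zero]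
    have hae : ∀ᵐ x ∂(Measure.pi fun _ : Fin (k + n + 1) => addAtoms μ s n' b), ∀ i, x i ≠ x₀ := by
      rw [eventually_all]
      intro i
      refine (Measure.quasiMeasurePreserving_eval
        (fun _ : Fin (k + n + 1) => addAtoms μ s n' b) i).ae (p := fun y : X => y ≠ x₀) ?_
      rw [ae_iff]
      simpa using addAtoms_singleton μ s n' b x₀ h0 hbx
    filter_upwards [hae] with x hx using hv x hx
  rw [hz]
  simp

lemma sq_cfg_dbInt_cons_glue
    (hJ : (Matrix.of fun j l => ∫ z, φ j z.1 * φ l z.2 * ε z.1 z.2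
      ∂((μ + (1 : ℝ≥0) • Measure.dirac x₀).prod (μ + (1 : ℝ≥0) • Measure.dirac x₀))) = stdSympl e)
    (b : Fin n → X) (hbx : ∀ i, b i ≠ x₀) :
    cfg k (fun y => dbInt e ε φ (Fin.cons x₀ (glue n k b y))) μ ^ 2 =
      cfg (k + n) (fun y => dbInt e ε φ (Fin.cons x₀ y)) μ ^ 2 *
        (kerMat e (μ + (1 : ℝ≥0) • Measure.dirac x₀) ε φ b).det := by
  have hh : Integrable (fun x => ∑ j, |φ j x|) μ := integrable_finsetSum _ fun j _ => (hi j).abs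
  have hi' : ∀ j, Integrable (φ j) (μ + (1 : ℝ≥0) • Measure.dirac x₀) := fun j =>
    (hi j).add_measure (integrable_dirac (by simp)).smul_measure_nnreal
  have h1 := (tendsto_cfg_addAtoms μ hh k n b
    ((altIntegrand_dbInt e hε hb hφ).cons x₀)).pow 2
  have h2 := (tendsto_det_one_add
    (kerMat e (μ + (1 : ℝ≥0) • Measure.dirac x₀) ε φ b)).const_mul (pfSum e (stdSympl e) ^ 2)
  have h3 := cfg_dbInt_cons e hε hb ha hφ μ hi x₀ h0 hv 0 0 (fun i => i.elim0) (fun i => i.elim0)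
  simp only [addAtoms] at h3
  rw [h3, cfg_dbInt e hε hb hφ _ hi' _ hi', hJ]
  refine tendsto_nhds_unique h1 (h2.congr fun s => ?_)
  rw [mul_pow, cfg_dbInt_cons e hε hb ha hφ μ hi x₀ h0 hv s n b hbx,
    sq_cfg_dbInt_addAtoms e hε hb ha hφ _ hi' hJ]
  ring

lemma cfg_dbInt_cons_ne_zero
    (hJ : (Matrix.of fun j l => ∫ z, φ j z.1 * φ l z.2 * ε z.1 z.2
      ∂((μ + (1 : ℝ≥0) • Measure.dirac x₀).prod (μ + (1 : ℝ≥0) • Measure.dirac x₀))) = stdSympl e) :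
    cfg (k + n) (fun y => dbInt e ε φ (Fin.cons x₀ y)) μ ≠ 0 := by
  have hi' : ∀ j, Integrable (φ j) (μ + (1 : ℝ≥0) • Measure.dirac x₀) := fun j =>
    (hi j).add_measure (integrable_dirac (by simp)).smul_measure_nnreal
  have h3 := cfg_dbInt_cons e hε hb ha hφ μ hi x₀ h0 hv 0 0 (fun i => i.elim0) (fun i => i.elim0)
  simp only [addAtoms] at h3
  rw [h3, cfg_dbInt e hε hb hφ _ hi' _ hi', hJ]
  exact (pfSum_stdSympl_pos e).ne'
end

section
/-- Half the sign of `x - y` on the extended line. -/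
noncomputable def epsK (x y : EReal) : ℝ := if y < x then 1 / 2 else if x < y then -1 / 2 else 0

lemma measurable_epsK : Measurable (Function.uncurry epsK) := by
  unfold epsK Function.uncurry
  refine Measurable.ite (measurableSet_lt measurable_snd measurable_fst) measurable_const ?_
  exact Measurable.ite (measurableSet_lt measurable_fst measurable_snd) measurable_const
    measurable_const

lemma abs_epsK_le (x y : EReal) : |epsK x y| ≤ 1 := by
  unfold epsK; split_ifs <;> norm_num [abs_le]

lemma epsK_antisymm (x y : EReal) : epsK x y = -epsK y x := by
  unfold epsK
  rcases lt_trichotomy x y with h | h | h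
  · simp [h, h.not_gt]; norm_num
  · simp [h]
  · simp [h, h.not_gt]; norm_num

lemma epsK_coe (x y : ℝ) : epsK x y = Real.sign (x - y) / 2 := by
  unfold epsK
  rcases lt_trichotomy x y with h | h | h
  · rw [if_neg (by simpa using h.le), if_pos (by simpa using h), Real.sign_of_neg (by linarith)]
  · simp [h]
  · rw [if_pos (by simpa using h), Real.sign_of_pos (by linarith)]

/-- Lebesgue measure carried to the extended line. -/
noncomputable def volE : Measure EReal := (volume : Measure ℝ).map ((↑) : ℝ → EReal)

lemma measurableEmbedding_coe_ereal : MeasurableEmbedding ((↑) : ℝ → EReal) :=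
  EReal.isOpenEmbedding_coe.measurableEmbedding

instance : SigmaFinite volE := measurableEmbedding_coe_ereal.sigmaFinite_map

lemma integral_volE (f : EReal → ℝ) : ∫ x, f x ∂volE = ∫ x : ℝ, f x :=
  measurableEmbedding_coe_ereal.integral_map f

lemma integrable_volE (f : EReal → ℝ) : Integrable f volE ↔ Integrable fun x : ℝ => f x :=
  measurableEmbedding_coe_ereal.integrable_map_iff

lemma volE_singleton_top : volE {⊤} = 0 := by
  rw [volE, Measure.map_apply measurableEmbedding_coe_ereal.measurable (measurableSet_singleton _)]
  convert measure_empty (μ := (volume : Measure ℝ))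
  ext x; simp

lemma cfg_volE (k : ℕ) (G : (Fin k → EReal) → ℝ) :
    cfg k G volE = (k.factorial : ℝ)⁻¹ * ∫ x : Fin k → ℝ, G (fun i => (x i : EReal)) := by
  unfold cfg
  congr 1
  have hpi : (Measure.pi fun _ : Fin k => volE) =
      (volume : Measure (Fin k → ℝ)).map fun x i => (x i : EReal) := by
    rw [volume_pi]
    have : SigmaFinite ((volume : Measure ℝ).map Real.toEReal) :=
      measurableEmbedding_coe_ereal.sigmaFinite_map
    exact (Measure.pi_map_pi (μ := fun _ : Fin k => (volume : Measure ℝ))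
      (f := fun _ => ((↑) : ℝ → EReal)) fun _ =>
        measurableEmbedding_coe_ereal.measurable.aemeasurable).symm
  have hemb : MeasurableEmbedding fun (x : Fin k → ℝ) i => (x i : EReal) := by
    refine (Topology.IsEmbedding.piMap (f := fun _ : Fin k => Real.toEReal)
      fun _ => EReal.isOpenEmbedding_coe.isEmbedding).measurableEmbedding ?_
    rw [Set.range_piMap]
    exact MeasurableSet.univ_pi fun _ =>
      EReal.isOpenEmbedding_coe.isOpen_range.measurableSet
  rw [hpi, hemb.integral_map]
end

end

section

open MeasureTheory Filter Topology Polynomial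

/-- A polynomial times the Gaussian weight `exp (-x²/4)`. -/
noncomputable def hw (p : ℝ[X]) (x : ℝ) : ℝ := p.eval x * Real.exp (-x ^ 2 / 4)

/-- The polynomial part of the derivative of `hw p`. -/
noncomputable def hwD (p : ℝ[X]) : ℝ[X] := derivative p - C (1 / 2) * X * p

lemma continuous_hw (p : ℝ[X]) : Continuous (hw p) := by
  unfold hw; fun_prop

lemma hw_sub (p q : ℝ[X]) (x : ℝ) : hw (p - q) x = hw p x - hw q x := by
  simp [hw, sub_mul]

lemma hw_C_mul (a : ℝ) (p : ℝ[X]) (x : ℝ) : hw (C a * p) x = a * hw p x := by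
  simp [hw, mul_assoc]

lemma hasDerivAt_hw (p : ℝ[X]) (x : ℝ) : HasDerivAt (hw p) (hw (hwD p) x) x := by
  have h1 : HasDerivAt (fun x : ℝ => Real.exp (-x ^ 2 / 4)) (Real.exp (-x ^ 2 / 4) * (-x / 2)) x := by
    refine HasDerivAt.exp ?_
    have := ((hasDerivAt_pow 2 x).neg.div_const 4)
    refine this.congr_deriv ?_
    simp; ring
  refine ((p.hasDerivAt x).mul h1).congr_deriv ?_
  simp [hw, hwD]; ring

lemma integrable_eval_mul_gauss {b : ℝ} (hb : 0 < b) (p : ℝ[X]) :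
    Integrable fun x => p.eval x * Real.exp (-b * x ^ 2) := by
  induction p using Polynomial.induction_on' with
  | add p q hp hq =>
    simp only [eval_add, add_mul]
    exact hp.add hq
  | monomial n a =>
    have h := (integrable_rpow_mul_exp_neg_mul_sq hb (s := n)
      (by have := n.cast_nonneg (α := ℝ); linarith)).const_mul a
    simpa [mul_assoc] using h

lemma integrable_hw (p : ℝ[X]) : Integrable (hw p) := by
  refine (integrable_eval_mul_gauss (b := 1 / 4) (by norm_num) p).congr (ae_of_all _ fun x => ?_)
  simp only [hw]; congr 2; ring

lemma hw_mul_hw (p q : ℝ[X]) (x : ℝ) :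
    hw p x * hw q x = (p * q).eval x * Real.exp (-(1 / 2) * x ^ 2) := by
  have : Real.exp (-(1 / 2) * x ^ 2) = Real.exp (-x ^ 2 / 4) * Real.exp (-x ^ 2 / 4) := by
    rw [← Real.exp_add]; congr 1; ring
  rw [this, hw, hw, eval_mul]; ring

lemma integrable_hw_mul_hw (p q : ℝ[X]) : Integrable fun x => hw p x * hw q x := by
  simp_rw [hw_mul_hw]
  exact integrable_eval_mul_gauss (by norm_num) _

lemma tendsto_hw_atTop (p : ℝ[X]) : Tendsto (hw p) atTop (𝓝 0) :=
  tendsto_zero_of_hasDerivAt_of_integrableOn_Ioi (a := 0) (fun x _ => hasDerivAt_hw p x)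
    (integrable_hw _).integrableOn (integrable_hw _).integrableOn

lemma tendsto_hw_atBot (p : ℝ[X]) : Tendsto (hw p) atBot (𝓝 0) :=
  tendsto_zero_of_hasDerivAt_of_integrableOn_Iic (a := 0) (fun x _ => hasDerivAt_hw p x)
    (integrable_hw _).integrableOn (integrable_hw _).integrableOn

lemma integral_hw_hwD (p : ℝ[X]) : ∫ x, hw (hwD p) x = 0 :=
  integral_eq_zero_of_hasDerivAt_of_integrable (fun x => hasDerivAt_hw p x)
    (integrable_hw _) (integrable_hw _)

/-- The probabilists' Hermite polynomials over the reals. -/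
noncomputable def He (n : ℕ) : ℝ[X] := (hermite n).map (Int.castRingHom ℝ)

lemma He_zero : He 0 = 1 := by simp [He]

lemma He_succ (n : ℕ) : He (n + 1) = X * He n - derivative (He n) := by
  simp [He, hermite_succ, derivative_map]

lemma natDegree_He (n : ℕ) : (He n).natDegree = n := by
  rw [He, natDegree_map_eq_of_injective (Int.cast_injective), natDegree_hermite]

lemma derivative_He_succ (n : ℕ) : derivative (He (n + 1)) = C ((n : ℝ) + 1) * He n := by
  induction n with
  | zero => simp [He_succ, He_zero]
  | succ n ih =>
    rw [He_succ (n + 1)]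
    simp only [derivative_sub, derivative_mul, derivative_X, ih, derivative_C]
    rw [He_succ n]
    push_cast
    simp only [C_add, C_1]
    ring

lemma He_succ_succ (n : ℕ) : He (n + 2) = X * He (n + 1) - C ((n : ℝ) + 1) * He n := by
  rw [He_succ (n + 1), derivative_He_succ]

lemma derivative2_He (n : ℕ) :
    derivative (derivative (He n)) = X * derivative (He n) - C (n : ℝ) * He n := by
  have h := derivative_He_succ n
  rw [He_succ] at h
  simp only [derivative_sub, derivative_mul, derivative_X, C_add, C_1] at h
  linear_combination -h

lemma integral_He_succ_mul (n : ℕ) (q : ℝ[X]) :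
    ∫ x, hw (He (n + 1)) x * hw q x = ∫ x, hw (He n) x * hw (derivative q) x := by
  have h1 : ∀ x, HasDerivAt (fun x => hw (He n) x * hw q x)
      (hw (He n) x * hw (derivative q) x - hw (He (n + 1)) x * hw q x) x := fun x => by
    refine ((hasDerivAt_hw (He n) x).mul (hasDerivAt_hw q x)).congr_deriv ?_
    simp [hw, hwD, He_succ]; ring
  have h2 := integral_eq_zero_of_hasDerivAt_of_integrable h1
    ((integrable_hw_mul_hw _ _).sub (integrable_hw_mul_hw _ _)) (integrable_hw_mul_hw _ _)
  rw [integral_sub (integrable_hw_mul_hw _ _) (integrable_hw_mul_hw _ _)] at h2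
  linarith

lemma integral_He_mul_He (n k : ℕ) : ∫ x, hw (He n) x * hw (He k) x =
    if n = k then (n.factorial : ℝ) * √(2 * Real.pi) else 0 := by
  induction n generalizing k with
  | zero =>
    cases k with
    | zero =>
      simp only [hw_mul_hw, He_zero]
      simp only [mul_one, eval_one, one_mul, integral_gaussian]
      simp [mul_comm]
    | succ k =>
      simp_rw [mul_comm (hw (He 0) _)]
      rw [integral_He_succ_mul]
      simp [He_zero, hw]
  | succ n ih =>
    rw [integral_He_succ_mul]
    cases k with
    | zero => simp [He_zero, hw]
    | succ k =>
      rw [derivative_He_succ]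
      have hm : ∀ x, hw (He n) x * hw (C ((k : ℝ) + 1) * He k) x =
          ((k : ℝ) + 1) * (hw (He n) x * hw (He k) x) := fun x => by rw [hw_C_mul]; ring
      simp_rw [hm]
      rw [integral_const_mul, ih]
      by_cases h : n = k
      · subst h; simp [Nat.factorial_succ]; ring
      · simp [h]

lemma integral_He_add_two (n : ℕ) :
    ∫ x, hw (He (n + 2)) x = ((n : ℝ) + 1) * ∫ x, hw (He n) x := by
  have h := integral_hw_hwD (He (n + 1))
  have h1 : hwD (He (n + 1)) = C (1 / 2) * (C ((n : ℝ) + 1) * He n - He (n + 2)) := by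
    rw [hwD, derivative_He_succ, He_succ_succ]
    have : (1 : ℝ[X]) = C (1 / 2) + C (1 / 2) := by rw [← C_add]; norm_num
    linear_combination (C ((n : ℝ) + 1) * He n) * this
  simp_rw [h1, hw_C_mul, hw_sub, hw_C_mul] at h
  rw [integral_const_mul, integral_sub ((integrable_hw _).const_mul _) (integrable_hw _),
    integral_const_mul] at h
  linarith

lemma integral_He_zero : ∫ x, hw (He 0) x = 2 * √Real.pi := by
  have : ∀ x : ℝ, hw (He 0) x = Real.exp (-(1 / 4) * x ^ 2) := fun x => by
    simp only [hw, He_zero, eval_one, one_mul]; congr 1; ring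
  simp_rw [this]
  rw [integral_gaussian, show Real.pi / (1 / 4) = 2 ^ 2 * Real.pi by ring,
    Real.sqrt_mul (by positivity), Real.sqrt_sq (by norm_num)]

lemma eval_He_add_two (n : ℕ) : (He (n + 2)).eval 0 = -((n : ℝ) + 1) * (He n).eval 0 := by
  simp [He_succ_succ]; ring

/-- The constants `(2 j)! / (4 ^ j * (j !) ^ 2)`. -/
noncomputable def wal (j : ℕ) : ℝ := (He (2 * j)).eval 0 ^ 2 / (2 * j).factorial

lemma wal_zero : wal 0 = 1 := by simp [wal, He_zero]

lemma wal_succ (j : ℕ) : wal (j + 1) = wal j * ((2 * j + 1) / (2 * j + 2)) := by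
  have h : (2 * (j + 1)).factorial = (2 * j + 2) * ((2 * j + 1) * (2 * j).factorial) := by
    rw [show 2 * (j + 1) = 2 * j + 1 + 1 by ring, Nat.factorial_succ, Nat.factorial_succ]
  rw [wal, wal, show 2 * (j + 1) = 2 * j + 2 by ring, eval_He_add_two,
    show 2 * j + 2 = 2 * (j + 1) by ring, h]
  push_cast
  field_simp

lemma wal_pos (j : ℕ) : 0 < wal j := by
  induction j with
  | zero => simp [wal_zero]
  | succ j ih => rw [wal_succ]; positivity

lemma wal_sq_mul_W (j : ℕ) : wal j ^ 2 * (2 * j + 1) * Real.Wallis.W j = 1 := by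
  induction j with
  | zero => simp [wal_zero, Real.Wallis.W]
  | succ j ih =>
    rw [wal_succ, Real.Wallis.W_succ]
    refine Eq.trans ?_ ih
    push_cast
    field_simp
    ring

lemma tendsto_wal : Tendsto (fun j : ℕ => wal j ^ 2 * (2 * j + 1)) atTop (𝓝 (2 / Real.pi)) := by
  have h := Real.Wallis.tendsto_W_nhds_pi_div_two.inv₀ (by positivity)
  rw [inv_div] at h
  refine h.congr fun j => ?_
  rw [eq_comm]
  exact eq_inv_of_mul_eq_one_left (wal_sq_mul_W j)

lemma wal_le (j : ℕ) : wal j ^ 2 * (2 * j + 1) ≤ 1 := by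
  induction j with
  | zero => simp [wal_zero]
  | succ j ih =>
    refine le_trans (le_of_eq ?_) ((mul_le_of_le_one_right (by positivity)
      (?_ : ((2 * j + 1 : ℝ) * (2 * j + 3)) / (2 * j + 2) ^ 2 ≤ 1)).trans ih)
    · rw [wal_succ]; push_cast; field_simp; ring
    · rw [div_le_one (by positivity)]; nlinarith

/-- The normalization constant of the Hermite functions of even order. -/
noncomputable def hnu (j : ℕ) : ℝ := √((2 * j).factorial * √(2 * Real.pi))

lemma hnu_pos (j : ℕ) : 0 < hnu j := by unfold hnu; positivity

lemma hnu_sq (j : ℕ) : hnu j ^ 2 = (2 * j).factorial * √(2 * Real.pi) :=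
  Real.sq_sqrt (by positivity)

lemma hnu_sq_succ (j : ℕ) : hnu (j + 1) ^ 2 = (2 * j + 2) * (2 * j + 1) * hnu j ^ 2 := by
  rw [hnu_sq, hnu_sq, show 2 * (j + 1) = 2 * j + 1 + 1 by ring, Nat.factorial_succ,
    Nat.factorial_succ]
  push_cast; ring

/-- Normalized Hermite polynomials of even order. -/
noncomputable def hp (j : ℕ) : ℝ[X] := C (hnu j)⁻¹ * He (2 * j)

/-- Normalized Hermite functions of even order. -/
noncomputable def hf (j : ℕ) : ℝ → ℝ := hw (hp j)

/-- Derivatives of the Hermite functions. -/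
noncomputable def hd (j : ℕ) : ℝ → ℝ := hw (hwD (hp j))

/-- Total integrals of the Hermite functions. -/
noncomputable def hc (j : ℕ) : ℝ := ∫ x, hf j x

lemma natDegree_hp (j : ℕ) : (hp j).natDegree ≤ 2 * j :=
  (natDegree_C_mul_le _ _).trans (natDegree_He _).le

lemma natDegree_hwD (p : ℝ[X]) : (hwD p).natDegree ≤ p.natDegree + 1 := by
  refine (natDegree_sub_le _ _).trans (max_le ((natDegree_derivative_le p).trans (by omega)) ?_)
  rw [mul_assoc]
  refine (natDegree_C_mul_le _ _).trans (natDegree_mul_le.trans ?_)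
  have := natDegree_X_le (R := ℝ); omega

lemma hasDerivAt_hf (j : ℕ) (x : ℝ) : HasDerivAt (hf j) (hd j x) x := hasDerivAt_hw _ _

lemma hasDerivAt_hd (j : ℕ) (x : ℝ) :
    HasDerivAt (hd j) ((x ^ 2 / 4 - (2 * j + 1 / 2)) * hf j x) x := by
  refine (hasDerivAt_hw _ _).congr_deriv ?_
  have h := derivative2_He (2 * j)
  have h' := congrArg (eval x) h
  simp at h'
  simp [hf, hw, hwD, hp]
  rw [h']
  ring

lemma eval_neg_He (n : ℕ) (x : ℝ) : (He n).eval (-x) = (-1) ^ n * (He n).eval x := by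
  induction n using Nat.twoStepInduction with
  | zero => simp [He_zero]
  | one => simp [He_succ, He_zero]
  | more n h1 h2 => simp [He_succ_succ, h1, h2]; ring

lemma hf_neg (j : ℕ) (x : ℝ) : hf j (-x) = hf j x := by
  simp [hf, hw, hp, eval_neg_He]

lemma hd_zero (j : ℕ) : hd j 0 = 0 := by
  have h1 : HasDerivAt (fun x => hf j (-x)) (-(hd j 0)) 0 := by
    have := (hasDerivAt_hf j (-0)).scomp (0 : ℝ) (hasDerivAt_neg (0 : ℝ))
    simpa [Function.comp_def] using this
  simp_rw [hf_neg] at h1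
  have := h1.unique (hasDerivAt_hf j 0)
  linarith

lemma integral_hf_mul_hf (j k : ℕ) : ∫ x, hf j x * hf k x = if j = k then 1 else 0 := by
  have : ∀ x, hf j x * hf k x = ((hnu j)⁻¹ * (hnu k)⁻¹) * (hw (He (2 * j)) x * hw (He (2 * k)) x) :=
    fun x => by simp only [hf, hp, hw_C_mul]; ring
  simp_rw [this]
  rw [integral_const_mul, integral_He_mul_He]
  by_cases h : j = k
  · subst h
    rw [if_pos rfl, if_pos rfl, ← hnu_sq]
    have := (hnu_pos j).ne'
    field_simp
  · simp [h]

lemma hf_zero (j : ℕ) : hf j 0 = (hnu j)⁻¹ * (He (2 * j)).eval 0 := by simp [hf, hw, hp]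

lemma hc_eq_integral (j : ℕ) : hc j = (hnu j)⁻¹ * ∫ x, hw (He (2 * j)) x := by
  simp only [hc, hf, hp, hw_C_mul, integral_const_mul]

lemma integral_He_even (j : ℕ) :
    ∫ x, hw (He (2 * j)) x = 2 * √Real.pi * ((-1) ^ j * (He (2 * j)).eval 0) := by
  induction j with
  | zero => simpa [He_zero] using integral_He_zero
  | succ j ih =>
    rw [show 2 * (j + 1) = 2 * j + 2 by ring, integral_He_add_two, eval_He_add_two, ih]
    ring

lemma hc_eq (j : ℕ) : hc j = 2 * √Real.pi * ((-1) ^ j * hf j 0) := by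
  rw [hc_eq_integral, integral_He_even, hf_zero]; ring

lemma hf_zero_sq (j : ℕ) : hf j 0 ^ 2 = wal j / √(2 * Real.pi) := by
  rw [hf_zero, mul_pow, inv_pow, hnu_sq, wal]
  field_simp

lemma hf_zero_ne (j : ℕ) : hf j 0 ≠ 0 := by
  have h : 0 < hf j 0 ^ 2 := by rw [hf_zero_sq]; have := wal_pos j; positivity
  exact fun h0 => by simp [h0] at h

lemma hc_ne_zero (j : ℕ) : hc j ≠ 0 := by
  rw [hc_eq]
  have := hf_zero_ne j
  have := Real.pi_pos
  positivity

/-- Derivative of `∑ c_j h_j`. -/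
lemma sum_hc_mul_hd (m : ℕ) (x : ℝ) :
    ∑ j ∈ Finset.range m, hc j * hd j x = -(hc m / 2) * (x / 2 * hf m x + hd m x) := by
  have key : ∀ j, x / 2 * hf j x + hd j x = (hnu j)⁻¹ * hw (derivative (He (2 * j))) x := fun j => by
    simp [hf, hd, hp, hw, hwD]; ring
  have key2 : ∀ j, x / 2 * hf j x - hd j x = (hnu j)⁻¹ * hw (He (2 * j + 1)) x := fun j => by
    simp [hf, hd, hp, hw, hwD, He_succ]; ring
  induction m with
  | zero => simp [key, He_zero, hw]
  | succ m ih =>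
    rw [Finset.sum_range_succ, ih, key (m + 1)]
    have h2 : derivative (He (2 * (m + 1))) = C ((2 * m + 1 : ℕ) + 1 : ℝ) * He (2 * m + 1) := by
      rw [show 2 * (m + 1) = 2 * m + 1 + 1 by ring, derivative_He_succ]
    have h3 : hc (m + 1) = (hnu (m + 1))⁻¹ * ((2 * m + 1) * (hnu m * hc m)) := by
      rw [hc_eq_integral (m + 1), hc_eq_integral m, show 2 * (m + 1) = 2 * m + 2 by ring,
        integral_He_add_two]
      have := (hnu_pos m).ne'
      push_cast
      field_simp
    rw [h2, hw_C_mul]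
    have h4 : hw (He (2 * m + 1)) x = hnu m * (x / 2 * hf m x - hd m x) := by
      rw [key2]; have := (hnu_pos m).ne'; field_simp
    rw [h3, h4]
    have h6 := (hnu_pos m).ne'
    have h7 := (hnu_pos (m + 1)).ne'
    have h8 := hnu_sq_succ m
    have h9 : (hnu (m + 1))⁻¹ * (hnu (m + 1))⁻¹ * ((2 * m + 2) * (2 * m + 1)) * hnu m ^ 2 = 1 := by
      rw [← mul_inv, ← sq, h8]; field_simp
    push_cast
    linear_combination (hc m / 2 * (x / 2 * hf m x - hd m x)) * h9

end

section

open MeasureTheory Filter Topology Polynomial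
open scoped NNReal

/-- Half the sign convolution on the line. -/
noncomputable def epsR (g : ℝ → ℝ) (x : ℝ) : ℝ := ∫ y, Real.sign (x - y) / 2 * g y

lemma epsR_eq {g : ℝ → ℝ} (hg : Integrable g) (x : ℝ) :
    epsR g x = 1 / 2 * ((∫ y in Set.Iic x, g y) - ∫ y in Set.Ioi x, g y) := by
  have h1 : ∀ᵐ y, Real.sign (x - y) / 2 * g y =
      1 / 2 * ((Set.Iic x).indicator g y - (Set.Ioi x).indicator g y) := by
    filter_upwards [Measure.ae_ne volume x] with y hy
    rcases lt_or_gt_of_ne hy with h | h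
    · rw [Real.sign_of_pos (by linarith), Set.indicator_of_mem (by exact h.le),
        Set.indicator_of_notMem (by simpa using h.le)]; ring
    · rw [Real.sign_of_neg (by linarith), Set.indicator_of_notMem (by simpa using h),
        Set.indicator_of_mem (by exact h)]; ring
  rw [epsR, integral_congr_ae h1, integral_const_mul,
    integral_sub (hg.indicator measurableSet_Iic) (hg.indicator measurableSet_Ioi),
    integral_indicator measurableSet_Iic, integral_indicator measurableSet_Ioi]

lemma epsR_hwD (p : ℝ[X]) (x : ℝ) : epsR (hw (hwD p)) x = hw p x := by
  rw [epsR_eq (integrable_hw _),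
    integral_Iic_of_hasDerivAt_of_tendsto' (fun x _ => hasDerivAt_hw p x)
      (integrable_hw _).integrableOn (tendsto_hw_atBot p),
    integral_Ioi_of_hasDerivAt_of_tendsto' (fun x _ => hasDerivAt_hw p x)
      (integrable_hw _).integrableOn (tendsto_hw_atTop p)]
  ring

lemma epsR_even {g : ℝ → ℝ} (hg : Integrable g) (he : ∀ x, g (-x) = g x) (x : ℝ) :
    epsR g x = ∫ y in (0 : ℝ)..x, g y := by
  rw [epsR_eq hg]
  have h0 : ∫ y in Set.Iic (0 : ℝ), g y = ∫ y in Set.Ioi (0 : ℝ), g y := by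
    have := integral_comp_neg_Iic (0 : ℝ) g
    simpa [he] using this
  have h1 : (∫ y in Set.Iic x, g y) - ∫ y in Set.Iic (0 : ℝ), g y = ∫ y in (0 : ℝ)..x, g y :=
    intervalIntegral.integral_Iic_sub_Iic hg.integrableOn hg.integrableOn
  have h2 := intervalIntegral.integral_Iic_add_Ioi (b := x) (f := g) (μ := volume) hg.integrableOn hg.integrableOn
  have h3 := intervalIntegral.integral_Iic_add_Ioi (b := (0 : ℝ)) (f := g) (μ := volume) hg.integrableOn hg.integrableOn
  linarith

lemma integral_odd_eq_zero {g : ℝ → ℝ} (ho : ∀ x, g (-x) = -g x) : ∫ x, g x = 0 := by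
  have h := integral_neg_eq_self g volume
  simp_rw [ho, integral_neg] at h
  linarith

lemma epsR_neg_of_even {g : ℝ → ℝ} (hg : Integrable g) (he : ∀ x, g (-x) = g x) (x : ℝ) :
    epsR g (-x) = -epsR g x := by
  rw [epsR_even hg he, epsR_even hg he]
  have := intervalIntegral.integral_comp_neg (a := 0) (b := x) g
  simp only [he, neg_zero] at this
  rw [this, intervalIntegral.integral_symm]

/-- Extension by zero to the extended line. -/
noncomputable def extE (g : ℝ → ℝ) (x : EReal) : ℝ := if x = ⊤ ∨ x = ⊥ then 0 else g x.toReal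

@[simp] lemma extE_coe (g : ℝ → ℝ) (x : ℝ) : extE g x = g x := by simp [extE]

@[simp] lemma extE_top (g : ℝ → ℝ) : extE g ⊤ = 0 := by simp [extE]

lemma measurable_extE {g : ℝ → ℝ} (hg : Measurable g) : Measurable (extE g) := by
  unfold extE
  refine Measurable.ite ?_ measurable_const (hg.comp measurable_ereal_toReal)
  exact (measurableSet_singleton (⊤ : EReal)).union (measurableSet_singleton ⊥)

/-- Lebesgue measure on the extended line with an atom at infinity. -/
noncomputable def nuE (c : ℝ≥0) : Measure EReal := volE + c • Measure.dirac ⊤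

instance (c : ℝ≥0) : SigmaFinite (nuE c) := by unfold nuE; infer_instance

lemma integrable_nuE (c : ℝ≥0) {g : EReal → ℝ} (hg : Integrable fun x : ℝ => g x) :
    Integrable g (nuE c) :=
  ((integrable_volE g).2 hg).add_measure (integrable_dirac (by simp)).smul_measure_nnreal

lemma integral_nuE (c : ℝ≥0) {g : EReal → ℝ} (hg : Integrable fun x : ℝ => g x) :
    ∫ x, g x ∂(nuE c) = (∫ x : ℝ, g x) + c * g ⊤ := by
  rw [nuE, integral_add_measure ((integrable_volE g).2 hg)
    (integrable_dirac (by simp)).smul_measure_nnreal, integral_volE, integral_smul_nnreal_measure,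
    integral_dirac]
  rfl

lemma measurable_sign_sub (x : ℝ) : Measurable fun y => Real.sign (x - y) / 2 := by
  have : Measurable fun y : ℝ => epsK x y :=
    measurable_epsK.comp (measurable_const.prodMk measurable_coe_real_ereal)
  simpa only [epsK_coe] using this

lemma abs_sign_half_le (x : ℝ) : |Real.sign x / 2| ≤ 1 := by
  rcases Real.sign_apply_eq x with h | h | h <;> rw [h] <;> norm_num [abs_le]

lemma integrable_sign_mul {g : ℝ → ℝ} (hg : Integrable g) (x : ℝ) :
    Integrable fun y => Real.sign (x - y) / 2 * g y :=
  hg.bdd_mul (c := 1) (measurable_sign_sub x).aestronglyMeasurable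
    (ae_of_all _ fun y => abs_sign_half_le (x - y))

lemma epsOp_extE (c : ℝ≥0) {g : ℝ → ℝ} (hg : Integrable g) (x : ℝ) :
    epsOp epsK (nuE c) (extE g) x = epsR g x := by
  rw [epsOp, integral_nuE]
  · simp [epsR, epsK_coe]
  · simpa [epsK_coe] using integrable_sign_mul hg x

/-- The skew inner product on the extended line. -/
noncomputable def skE (c : ℝ≥0) (φ ψ : EReal → ℝ) : ℝ :=
  ∫ z, φ z.1 * ψ z.2 * epsK z.1 z.2 ∂((nuE c).prod (nuE c))

lemma skE_antisymm (c : ℝ≥0) (φ ψ : EReal → ℝ) : skE c φ ψ = -skE c ψ φ := by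
  unfold skE
  rw [← integral_prod_swap, ← integral_neg]
  congr 1; ext z
  simp only [Prod.fst_swap, Prod.snd_swap]
  rw [epsK_antisymm z.2 z.1]; ring

lemma skE_eq (c : ℝ≥0) {φ ψ : EReal → ℝ} (hφ : Integrable φ (nuE c)) (hψ : Integrable ψ (nuE c)) :
    skE c φ ψ = ∫ x, φ x * epsOp epsK (nuE c) ψ x ∂(nuE c) := by
  unfold skE
  rw [integral_prod]
  · congr 1; ext x
    rw [epsOp, ← integral_const_mul]
    congr 1; ext y; ring
  · exact (hφ.mul_prod hψ).mul_bdd (c := 1) measurable_epsK.aestronglyMeasurable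
      (ae_of_all _ fun z => by simpa using abs_epsK_le z.1 z.2)

lemma abs_epsR_le {g : ℝ → ℝ} (hg : Integrable g) (x : ℝ) : |epsR g x| ≤ ∫ y, |g y| := by
  refine abs_integral_le_integral_abs.trans (integral_mono (integrable_sign_mul hg x).abs hg.abs
    fun y => ?_)
  rw [abs_mul]
  exact mul_le_of_le_one_left (abs_nonneg _) (abs_sign_half_le _)

lemma skE_extE (c : ℝ≥0) {g k : ℝ → ℝ} (hg : Integrable g) (hk : Integrable k)
    (hkc : Continuous (epsR k)) :
    skE c (extE g) (extE k) = ∫ x, g x * epsR k x := by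
  have hb : Integrable fun x => g x * epsR k x :=
    hg.mul_bdd (c := ∫ y, |k y|) hkc.aestronglyMeasurable (ae_of_all _ fun x => abs_epsR_le hk x)
  rw [skE_eq c (integrable_nuE c (by simpa using hg)) (integrable_nuE c (by simpa using hk)),
    integral_nuE]
  · simp [epsOp_extE c hk]
  · simpa [epsOp_extE c hk] using hb

/-- The indicator of the point at infinity. -/
noncomputable def phiTop : EReal → ℝ := Set.indicator {⊤} 1

@[simp] lemma phiTop_coe (x : ℝ) : phiTop x = 0 := by simp [phiTop]

@[simp] lemma phiTop_top : phiTop ⊤ = 1 := by simp [phiTop]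

lemma measurable_phiTop : Measurable phiTop := measurable_one.indicator (measurableSet_singleton _)

lemma epsOp_phiTop (c : ℝ≥0) (x : EReal) : epsOp epsK (nuE c) phiTop x = c * epsK x ⊤ := by
  rw [epsOp, integral_nuE] <;> simp

lemma epsK_coe_top (x : ℝ) : epsK x ⊤ = -1 / 2 := by simp [epsK]

lemma epsK_top_top : epsK ⊤ ⊤ = 0 := by simp [epsK]

lemma epsK_top_coe (x : ℝ) : epsK ⊤ x = 1 / 2 := by simp [epsK]

lemma skE_extE_phiTop {g : ℝ → ℝ} (hg : Integrable g) :
    skE 1 (extE g) phiTop = -(1 / 2) * ∫ x, g x := by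
  rw [skE_eq 1 (integrable_nuE 1 (by simpa using hg)) (integrable_nuE 1 (by simp)), integral_nuE]
  · simp only [epsOp_phiTop, epsK_coe_top, extE_coe, extE_top]
    rw [← integral_const_mul]
    simp only [NNReal.coe_one, one_mul, zero_mul, mul_zero, add_zero]
    congr 1; ext x; ring
  · simpa [epsOp_phiTop, epsK_coe_top] using hg.mul_const _

lemma skE_phiTop_phiTop : skE 1 phiTop phiTop = 0 := by
  rw [skE_eq 1 (integrable_nuE 1 (by simp)) (integrable_nuE 1 (by simp)), integral_nuE]
  · simp [epsOp_phiTop, epsK_top_top]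
  · simp

lemma eq_stdSympl {m : ℕ} {ι : Type} [Fintype ι] [DecidableEq ι] (e : Fin m × Fin 2 ≃ ι)
    (M : Matrix ι ι ℝ) (hanti : ∀ a b, M a b = -M b a) (h00 : ∀ i j, M (e (i, 0)) (e (j, 0)) = 0)
    (h11 : ∀ i j, M (e (i, 1)) (e (j, 1)) = 0)
    (h01 : ∀ i j, M (e (i, 0)) (e (j, 1)) = if i = j then 1 else 0) : M = stdSympl e := by
  ext a b
  obtain ⟨⟨i, s⟩, rfl⟩ := e.surjective a
  obtain ⟨⟨j, t⟩, rfl⟩ := e.surjective b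
  fin_cases s <;> fin_cases t
  · simpa [stdSympl] using h00 i j
  · simpa [stdSympl] using h01 i j
  · have h := hanti (e (i, 1)) (e (j, 0))
    rw [h01 j i] at h
    by_cases hij : i = j
    · simp [stdSympl, hij] at h ⊢; exact h
    · simp [stdSympl, hij, Ne.symm hij] at h ⊢; exact h
  · simpa [stdSympl] using h11 i j

end

section

open MeasureTheory Filter Topology Polynomial
open scoped NNReal

lemma vand_one_eq (N : ℕ) (x : Fin N → ℝ) : vand 1 N x = |(Matrix.vandermonde x).det| := by
  rw [Matrix.det_vandermonde, vand, Finset.abs_prod, Finset.prod_filter, Fintype.prod_prod_type]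
  refine Finset.prod_congr rfl fun i _ => ?_
  rw [Finset.abs_prod, ← Finset.prod_filter]
  refine Finset.prod_congr ?_ fun j _ => ?_
  · ext j; simp
  · rw [Real.rpow_one, abs_sub_comm]

lemma vand_perm (N : ℕ) (x : Fin N → ℝ) (σ : Equiv.Perm (Fin N)) :
    vand 1 N (x ∘ σ) = vand 1 N x := by
  rw [vand_one_eq, vand_one_eq]
  have : Matrix.vandermonde (x ∘ σ) = (Matrix.vandermonde x).submatrix σ id := by
    ext i j; simp [Matrix.vandermonde]
  rw [this, Matrix.det_permute, abs_mul]
  rcases Int.units_eq_one_or (Equiv.Perm.sign σ) with h | h <;> simp [h]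

lemma vand_of_strictMono (N : ℕ) {x : Fin N → ℝ} (hx : StrictMono x) :
    vand 1 N x = (Matrix.vandermonde x).det := by
  rw [vand_one_eq, abs_of_nonneg]
  rw [Matrix.det_vandermonde]
  refine Finset.prod_nonneg fun i _ => Finset.prod_nonneg fun j hj => ?_
  rw [Finset.mem_Ioi] at hj
  linarith [hx hj]

/-- The unnormalized density of the Gaussian orthogonal ensemble. -/
noncomputable def goe (N : ℕ) (x : Fin N → ℝ) : ℝ := vand 1 N x * ∏ i, Real.exp (-x i ^ 2 / 4)

lemma goe_perm (N : ℕ) (x : Fin N → ℝ) (σ : Equiv.Perm (Fin N)) : goe N (x ∘ σ) = goe N x := by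
  unfold goe
  rw [vand_perm]
  congr 1
  exact Equiv.prod_comp σ fun i => Real.exp (-x i ^ 2 / 4)

lemma det_hw_eq (N : ℕ) (p : Fin N → ℝ[X]) (hp : ∀ j, (p j).natDegree < N) (x : Fin N → ℝ) :
    (Matrix.of fun i j => hw (p j) (x i)).det =
      (Matrix.of fun i j : Fin N => (p j).coeff i).det * (Matrix.vandermonde x).det *
        ∏ i, Real.exp (-x i ^ 2 / 4) := by
  have : (Matrix.of fun i j => hw (p j) (x i)) = Matrix.of fun i j =>
      Real.exp (-x i ^ 2 / 4) *
        (Matrix.vandermonde x * Matrix.of fun i j : Fin N => (p j).coeff i) i j := by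
    ext i j
    simp only [Matrix.of_apply, hw, Matrix.mul_apply, Matrix.vandermonde_apply]
    rw [Polynomial.eval_eq_sum_range' (hp j), mul_comm, ← Fin.sum_univ_eq_sum_range
      (fun l => (p j).coeff l * x i ^ l)]
    congr 1
    exact Finset.sum_congr rfl fun l _ => mul_comm _ _
  rw [this, Matrix.det_mul_column, Matrix.det_mul]
  ring

lemma eq_const_mul_goe (N : ℕ) {h : EReal → ℝ} {G : (Fin N → EReal) → ℝ} (hG : AltIntegrand h N G)
    (C : ℝ) (hC : ∀ x : Fin N → ℝ, StrictMono x → G (fun i => (x i : EReal)) =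
      C * ((Matrix.vandermonde x).det * ∏ i, Real.exp (-x i ^ 2 / 4))) (x : Fin N → ℝ) :
    G (fun i => (x i : EReal)) = C * goe N x := by
  by_cases hx : Function.Injective x
  · have hs : StrictMono (x ∘ Tuple.sort x) :=
      (Tuple.monotone_sort x).strictMono_of_injective (hx.comp (Tuple.sort x).injective)
    have h1 := hC _ hs
    rw [← vand_of_strictMono N hs] at h1
    change _ = C * goe N (x ∘ Tuple.sort x) at h1
    rw [goe_perm] at h1
    rw [← h1]
    exact (hG.symm (Tuple.sort x) fun i => (x i : EReal)).symm
  · simp only [Function.Injective, not_forall] at hx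
    obtain ⟨i, j, hij, hne⟩ := hx
    rw [hG.zero _ i j hne (by simp [hij]), goe, vand_one_eq, Matrix.det_vandermonde_eq_zero_iff.2
      ⟨i, j, hij, hne⟩]
    simp

lemma epsK_strictMono {N : ℕ} {x : Fin N → ℝ} (hx : StrictMono x) (i j : Fin N) :
    epsK (x i) (x j) = epsK ((i : ℕ) : ℝ) ((j : ℕ) : ℝ) := by
  unfold epsK
  simp only [EReal.coe_lt_coe_iff, hx.lt_iff_lt, Nat.cast_lt, Fin.val_fin_lt]

section
variable {N m : ℕ} (e : Fin m × Fin 2 ≃ Fin N) (p : Fin N → ℝ[X])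

lemma measurable_extE_hw (p : ℝ[X]) : Measurable (extE (hw p)) :=
  measurable_extE (continuous_hw p).measurable

lemma dbInt_extE_hw (hp : ∀ j, (p j).natDegree < N) :
    ∃ C, ∀ x : Fin N → ℝ, dbInt e epsK (fun j => extE (hw (p j))) (fun i => (x i : EReal)) =
      C * goe N x := by
  refine ⟨pfSum e (Matrix.of fun i j : Fin N => epsK ((i : ℕ) : ℝ) ((j : ℕ) : ℝ)) *
    (Matrix.of fun i j : Fin N => (p j).coeff i).det,
    eq_const_mul_goe N (altIntegrand_dbInt e measurable_epsK abs_epsK_le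
      fun j => measurable_extE_hw (p j)) _ fun x hx => ?_⟩
  unfold dbInt
  simp only [extE_coe, epsK_strictMono hx]
  rw [det_hw_eq N p hp]
  ring
end

section
variable {N m : ℕ} (e : Fin m × Fin 2 ≃ Fin (N + 1)) (φ : Fin (N + 1) → EReal → ℝ)
  (a₀ : Fin (N + 1)) (p : Fin N → ℝ[X])

lemma dbInt_cons_top (h0 : φ a₀ = phiTop) (h1 : ∀ j, φ (a₀.succAbove j) = extE (hw (p j)))
    (hp : ∀ j, (p j).natDegree < N) :
    ∃ C, ∀ x : Fin N → ℝ, dbInt e epsK φ (Fin.cons ⊤ fun i => (x i : EReal)) = C * goe N x := by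
  have hm : ∀ j, Measurable (φ j) := fun j => by
    rcases Fin.eq_self_or_eq_succAbove a₀ j with h | ⟨k, h⟩
    · rw [h, h0]; exact measurable_phiTop
    · rw [h, h1]; exact measurable_extE_hw _
  refine ⟨pfSum e (Matrix.of fun i j : Fin (N + 1) =>
      epsK ((Fin.cons ⊤ (fun i : Fin N => (((i : ℕ) : ℝ) : EReal)) : Fin (N + 1) → EReal) i)
        ((Fin.cons ⊤ (fun i : Fin N => (((i : ℕ) : ℝ) : EReal)) : Fin (N + 1) → EReal) j)) *
    ((-1) ^ (a₀ : ℕ) * (Matrix.of fun i j : Fin N => (p j).coeff i).det),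
    eq_const_mul_goe N ((altIntegrand_dbInt e measurable_epsK abs_epsK_le hm).cons ⊤) _
      fun x hx => ?_⟩
  unfold dbInt
  rw [Matrix.det_succ_row_zero, Finset.sum_eq_single a₀]
  · have hsub : ((Matrix.of fun i j => φ j ((Fin.cons ⊤ (fun i : Fin N => (x i : EReal)) :
        Fin (N + 1) → EReal) i)).submatrix Fin.succ a₀.succAbove) =
        Matrix.of fun i j => hw (p j) (x i) := by
      ext i j; simp [h1]
    have heps : (Matrix.of fun i j : Fin (N + 1) =>
        epsK ((Fin.cons ⊤ (fun i : Fin N => (x i : EReal)) : Fin (N + 1) → EReal) i)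
        ((Fin.cons ⊤ (fun i : Fin N => (x i : EReal)) : Fin (N + 1) → EReal) j)) =
        Matrix.of fun i j : Fin (N + 1) =>
      epsK ((Fin.cons ⊤ (fun i : Fin N => (((i : ℕ) : ℝ) : EReal)) : Fin (N + 1) → EReal) i)
        ((Fin.cons ⊤ (fun i : Fin N => (((i : ℕ) : ℝ) : EReal)) : Fin (N + 1) → EReal) j) := by
      ext i j
      refine Fin.cases ?_ (fun i => ?_) i <;> refine Fin.cases ?_ (fun j => ?_) j
      · simp
      · simp only [Matrix.of_apply, Fin.cons_zero, Fin.cons_succ, epsK_top_coe]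
      · simp only [Matrix.of_apply, Fin.cons_zero, Fin.cons_succ, epsK_coe_top]
      · simp only [Matrix.of_apply, Fin.cons_succ, epsK_strictMono hx]
    rw [hsub, heps, det_hw_eq N p hp]
    simp only [Matrix.of_apply, Fin.cons_zero, h0, phiTop_top]
    ring
  · intro b _ hb
    obtain ⟨k, rfl⟩ := Fin.exists_succAbove_eq hb
    simp [h1]
  · simp

lemma dbInt_eq_zero_of_ne_top (hφ : φ a₀ = phiTop) (x : Fin (N + 1) → EReal) (hx : ∀ i, x i ≠ ⊤) :
    dbInt e epsK φ x = 0 := by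
  unfold dbInt
  rw [Matrix.det_eq_zero_of_column_eq_zero a₀, mul_zero]
  intro i
  simp [hφ, phiTop, hx i]
end

/-- The block matrix kernel on the line. -/
noncomputable def kerBlock {n : ℕ} (S D I : ℝ → ℝ → ℝ) (x : Fin n → ℝ) :
    Matrix (Fin n ⊕ Fin n) (Fin n ⊕ Fin n) ℝ :=
  Matrix.fromBlocks (Matrix.of fun a c => S (x a) (x c)) (Matrix.of fun a c => D (x a) (x c))
    (Matrix.of fun a c => I (x a) (x c) - Real.sign (x a - x c) / 2)
    (Matrix.of fun a c => S (x c) (x a))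

lemma glue_coe {n k : ℕ} (x : Fin n → ℝ) (y : Fin k → ℝ) :
    glue n k (fun i => (x i : EReal)) (fun i => (y i : EReal)) =
      fun i => ((glue n k x y i : ℝ) : EReal) := by
  ext i; unfold glue; split_ifs <;> rfl

/-- Transfer of the squared correlation identity from the extended line. -/
lemma goe_correlation {n k : ℕ} {G : (Fin (k + n) → EReal) → ℝ} {C : ℝ}
    (hG : ∀ x : Fin (k + n) → ℝ, G (fun i => (x i : EReal)) = C * goe (k + n) x)
    (hne : cfg (k + n) G volE ≠ 0) (x : Fin n → ℝ) (d : ℝ)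
    (hd : cfg k (fun y => G (glue n k (fun i => (x i : EReal)) y)) volE ^ 2 =
      cfg (k + n) G volE ^ 2 * d) :
    (∫ z, goe (k + n) z) ≠ 0 ∧
    (((k + n).factorial : ℝ) / k.factorial * (∫ z, goe (k + n) z)⁻¹ *
      ∫ y, goe (k + n) (glue n k x y)) ^ 2 = d := by
  rw [cfg_volE, cfg_volE] at hd
  rw [cfg_volE] at hne
  simp only [glue_coe, hG, integral_const_mul] at hd hne
  have hC : C ≠ 0 := fun h => hne (by simp [h])
  have hZ : (∫ z, goe (k + n) z) ≠ 0 := fun h => hne (by simp [h])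
  refine ⟨hZ, ?_⟩
  have h1 : (k.factorial : ℝ) ≠ 0 := by positivity
  have h2 : ((k + n).factorial : ℝ) ≠ 0 := by positivity
  field_simp at hd ⊢
  linear_combination hd

/-- The primitive of a Hermite function vanishing at zero. -/
noncomputable def hI (j : ℕ) (x : ℝ) : ℝ := ∫ y in (0 : ℝ)..x, hf j y

lemma integrable_hf (j : ℕ) : Integrable (hf j) := integrable_hw _

lemma integrable_hd (j : ℕ) : Integrable (hd j) := integrable_hw _

lemma epsR_hd (j : ℕ) (x : ℝ) : epsR (hd j) x = hf j x := epsR_hwD _ _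

lemma epsR_hf (j : ℕ) (x : ℝ) : epsR (hf j) x = hI j x := epsR_even (integrable_hf j) (hf_neg j) x

lemma hd_neg (j : ℕ) (x : ℝ) : hd j (-x) = -hd j x := by
  have h1 : HasDerivAt (fun x => hf j (-x)) (-(hd j (-x))) x := by
    have := (hasDerivAt_hf j (-x)).scomp x (hasDerivAt_neg x)
    simpa [Function.comp_def] using this
  simp_rw [hf_neg] at h1
  have := h1.unique (hasDerivAt_hf j x)
  linarith

lemma continuous_epsR_of_even {g : ℝ → ℝ} (hg : Integrable g) (he : ∀ x, g (-x) = g x) :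
    Continuous (epsR g) := by
  rw [funext (epsR_even hg he)]
  exact intervalIntegral.continuous_primitive (fun a b => hg.intervalIntegrable) 0

lemma skE_even_even (c : ℝ≥0) {g k : ℝ → ℝ} (hg : Integrable g) (hk : Integrable k)
    (hge : ∀ x, g (-x) = g x) (hke : ∀ x, k (-x) = k x) : skE c (extE g) (extE k) = 0 := by
  rw [skE_extE c hg hk (continuous_epsR_of_even hk hke)]
  exact integral_odd_eq_zero fun x => by rw [hge, epsR_neg_of_even hk hke]; ring

lemma skE_hd (c : ℝ≥0) {g : ℝ → ℝ} (hg : Integrable g) (j : ℕ) :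
    skE c (extE g) (extE (hd j)) = ∫ x, g x * hf j x := by
  have h : epsR (hd j) = hf j := funext fun x => epsR_hd j x
  rw [skE_extE c hg (integrable_hd j) (by rw [h]; exact continuous_hw _), h]

lemma skE_hd_hd (c : ℝ≥0) (i j : ℕ) : skE c (extE (hd i)) (extE (hd j)) = 0 := by
  rw [skE_hd c (integrable_hd i)]
  exact integral_odd_eq_zero fun x => by rw [hd_neg, hf_neg]; ring

/-- The scalar kernel for an even number of particles. -/
noncomputable def kS (m : ℕ) (x y : ℝ) : ℝ :=
  ∑ j ∈ Finset.range m, (hf j x * hf j y - hd j x * hI j y)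

/-- The derivative kernel for an even number of particles. -/
noncomputable def kD (m : ℕ) (x y : ℝ) : ℝ :=
  ∑ j ∈ Finset.range m, (hd j x * hf j y - hf j x * hd j y)

/-- The integral kernel for an even number of particles. -/
noncomputable def kI (m : ℕ) (x y : ℝ) : ℝ :=
  ∑ j ∈ Finset.range m, (hI j x * hf j y - hf j x * hI j y)

lemma nuE_zero : nuE 0 = volE := by simp [nuE]

/-- Correlation functions of the Gaussian orthogonal ensemble with an even number of particles. -/
lemma goe_correlation_even {n k m : ℕ} (hN : k + n = 2 * m) (x : Fin n → ℝ) :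
    (∫ z, goe (k + n) z) ≠ 0 ∧
    (((k + n).factorial : ℝ) / k.factorial * (∫ z, goe (k + n) z)⁻¹ *
      ∫ y, goe (k + n) (glue n k x y)) ^ 2 = (kerBlock (kS m) (kD m) (kI m) x).det := by
  obtain ⟨e⟩ : Nonempty (Fin m × Fin 2 ≃ Fin (k + n)) :=
    ⟨Fintype.equivOfCardEq (by simp [hN, mul_comm])⟩
  let P : Fin m × Fin 2 → ℝ[X] := fun q => if q.2 = 0 then hp q.1 else hwD (hp q.1)
  let φ : Fin (k + n) → EReal → ℝ := fun a => extE (hw (P (e.symm a)))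
  have hP : ∀ q, (P q).natDegree < k + n := fun q => by
    have h1 := natDegree_hp q.1
    have h2 := natDegree_hwD (hp q.1)
    have h3 := q.1.2
    simp only [P]
    split_ifs <;> omega
  have hφ0 : ∀ i, φ (e (i, 0)) = extE (hf i) := fun i => by simp [φ, P, hf]
  have hφ1 : ∀ i, φ (e (i, 1)) = extE (hd i) := fun i => by simp [φ, P, hd]
  have hm : ∀ j, Measurable (φ j) := fun j => measurable_extE_hw _
  have hi : ∀ j, Integrable (φ j) (nuE 0) := fun j =>
    integrable_nuE 0 (by simpa [φ] using integrable_hw _)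
  obtain ⟨C, hC⟩ := dbInt_extE_hw e (fun a => P (e.symm a)) fun a => hP _
  have hJ : (Matrix.of fun j l => ∫ z, φ j z.1 * φ l z.2 * epsK z.1 z.2
      ∂((nuE 0).prod (nuE 0))) = stdSympl e := by
    refine eq_stdSympl e _ (fun a b => skE_antisymm 0 _ _) (fun i j => ?_) (fun i j => ?_)
      (fun i j => ?_)
    · change skE 0 (φ _) (φ _) = 0
      rw [hφ0, hφ0]
      exact skE_even_even 0 (integrable_hf _) (integrable_hf _) (hf_neg _) (hf_neg _)
    · change skE 0 (φ _) (φ _) = 0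
      rw [hφ1, hφ1, skE_hd_hd]
    · change skE 0 (φ _) (φ _) = _
      rw [hφ0, hφ1, skE_hd 0 (integrable_hf _), integral_hf_mul_hf]
      simp [Fin.ext_iff]
  have hne : cfg (k + n) (dbInt e epsK φ) volE ≠ 0 := by
    rw [← nuE_zero, cfg_dbInt e measurable_epsK abs_epsK_le hm _ hi _ hi, hJ]
    exact (pfSum_stdSympl_pos e).ne'
  refine goe_correlation hC hne x _ ?_
  have main := sq_cfg_dbInt_glue e measurable_epsK abs_epsK_le epsK_antisymm hm (nuE 0) hi hJ
    (fun i => (x i : EReal))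
  have hker : kerMat e (nuE 0) epsK φ (fun i => (x i : EReal)) =
      kerBlock (kS m) (kD m) (kI m) x := by
    have hS : ∀ a c : ℝ, kerS e (nuE 0) epsK φ a c = kS m a c := fun a c => by
      simp only [kerS, kS, hφ0, hφ1, epsOp_extE 0 (integrable_hf _),
        epsOp_extE 0 (integrable_hd _), epsR_hd, epsR_hf, extE_coe]
      exact Fin.sum_univ_eq_sum_range (fun j => hf j a * hf j c - hd j a * hI j c) m
    have hD : ∀ a c : ℝ, kerD e φ (a : EReal) c = kD m a c := fun a c => by
      simp only [kerD, kD, hφ0, hφ1, extE_coe]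
      exact Fin.sum_univ_eq_sum_range (fun j => hd j a * hf j c - hf j a * hd j c) m
    have hI' : ∀ a c : ℝ, kerI e (nuE 0) epsK φ a c = kI m a c := fun a c => by
      simp only [kerI, kI, hφ0, hφ1, epsOp_extE 0 (integrable_hf _),
        epsOp_extE 0 (integrable_hd _), epsR_hd, epsR_hf]
      exact Fin.sum_univ_eq_sum_range (fun j => hI j a * hf j c - hf j a * hI j c) m
    simp only [kerMat, kerBlock, hS, hD, hI', epsK_coe]
  rw [hker, nuE_zero] at main
  exact main

end

section

open MeasureTheory Filter Topology Polynomial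
open scoped NNReal

/-- Hermite functions corrected to have integral zero. -/
noncomputable def gf (m j : ℕ) (x : ℝ) : ℝ := hf j x - hc j / hc m * hf m x

/-- Primitives of the corrected Hermite functions. -/
noncomputable def gI (m j : ℕ) (x : ℝ) : ℝ := hI j x - hc j / hc m * hI m x

/-- The scalar kernel for an odd number of particles. -/
noncomputable def oS (m : ℕ) (x y : ℝ) : ℝ :=
  ∑ j ∈ Finset.range m, (gf m j x * hf j y - hd j x * gI m j y) + hf m x / hc m

/-- The derivative kernel for an odd number of particles. -/
noncomputable def oD (m : ℕ) (x y : ℝ) : ℝ :=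
  ∑ j ∈ Finset.range m, (hd j x * gf m j y - gf m j x * hd j y)

/-- The integral kernel for an odd number of particles. -/
noncomputable def oI (m : ℕ) (x y : ℝ) : ℝ :=
  ∑ j ∈ Finset.range m, (gI m j x * hf j y - hf j x * gI m j y) + (hI m x - hI m y) / hc m

lemma integrable_gf (m j : ℕ) : Integrable (gf m j) :=
  (integrable_hf j).sub ((integrable_hf m).const_mul _)

lemma gf_neg (m j : ℕ) (x : ℝ) : gf m j (-x) = gf m j x := by simp [gf, hf_neg]

lemma integral_gf (m j : ℕ) : ∫ x, gf m j x = 0 := by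
  simp only [gf]
  rw [integral_sub (integrable_hf j) ((integrable_hf m).const_mul _), integral_const_mul]
  change hc j - hc j / hc m * hc m = 0
  rw [div_mul_cancel₀ _ (hc_ne_zero m), sub_self]

lemma epsR_gf (m j : ℕ) (x : ℝ) : epsR (gf m j) x = gI m j x := by
  rw [epsR_even (integrable_gf m j) (gf_neg m j), gI, hI, hI]
  simp only [gf]
  rw [intervalIntegral.integral_sub (integrable_hf j).intervalIntegrable
    ((integrable_hf m).const_mul _).intervalIntegrable, intervalIntegral.integral_const_mul]

lemma epsR_const_mul (a : ℝ) (g : ℝ → ℝ) (x : ℝ) :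
    epsR (fun y => a * g y) x = a * epsR g x := by
  simp only [epsR, mul_left_comm _ a, integral_const_mul]

lemma integral_gf_mul_hf {m i j : ℕ} (hj : j < m) :
    ∫ x, gf m i x * hf j x = if i = j then 1 else 0 := by
  have h : ∀ i, Integrable fun x => hf i x * hf j x := fun i => integrable_hw_mul_hw _ _
  simp only [gf, sub_mul, mul_assoc]
  rw [integral_sub (h i) ((h m).const_mul _), integral_const_mul, integral_hf_mul_hf, integral_hf_mul_hf, if_neg hj.ne', mul_zero, sub_zero]

/-- Correlation functions of the Gaussian orthogonal ensemble with an odd number of particles. -/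
lemma goe_correlation_odd {n k m : ℕ} (hN : k + n = 2 * m + 1) (x : Fin n → ℝ) :
    (∫ z, goe (k + n) z) ≠ 0 ∧
    (((k + n).factorial : ℝ) / k.factorial * (∫ z, goe (k + n) z)⁻¹ *
      ∫ y, goe (k + n) (glue n k x y)) ^ 2 = (kerBlock (oS m) (oD m) (oI m) x).det := by
  obtain ⟨e⟩ : Nonempty (Fin (m + 1) × Fin 2 ≃ Fin (k + n + 1)) :=
    ⟨Fintype.equivOfCardEq (by simp only [Fintype.card_prod, Fintype.card_fin]; omega)⟩
  let P : Fin (m + 1) × Fin 2 → ℝ[X] := fun q =>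
    if q.2 = 0 then (if q.1 = Fin.last m then C (-2 / hc m) * hp m
      else hp q.1 - C (hc q.1 / hc m) * hp m)
    else if q.1 = Fin.last m then 0 else hwD (hp q.1)
  let a₀ : Fin (k + n + 1) := e (Fin.last m, 1)
  let φ : Fin (k + n + 1) → EReal → ℝ := fun a =>
    if a = a₀ then phiTop else extE (hw (P (e.symm a)))
  have hP : ∀ q, (P q).natDegree < k + n := fun q => by
    have h1 := natDegree_hp q.1
    have h2 := natDegree_hwD (hp q.1)
    have h3 := q.1.2
    have h4 := natDegree_hp m
    have h5 := natDegree_sub_le (hp q.1) (C (hc q.1 / hc m) * hp m)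
    have h6 := natDegree_C_mul_le (hc q.1 / hc m) (hp m)
    have h7 := natDegree_C_mul_le (-2 / hc m) (hp m)
    have h8 : (0 : ℝ[X]).natDegree = 0 := natDegree_zero
    simp only [P]
    split_ifs with hq hl hl
    · omega
    · have := max_le (h1.trans (by omega : 2 * (q.1 : ℕ) ≤ 2 * m)) (h6.trans h4)
      omega
    · omega
    · have : (q.1 : ℕ) ≠ m := fun h => hl (Fin.ext (by simpa using h))
      omega
  have hφt : φ a₀ = phiTop := by simp [φ]
  have hφne : ∀ q, q ≠ (Fin.last m, 1) → φ (e q) = extE (hw (P q)) := fun q hq => by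
    simp [φ, a₀, hq]
  have hφ0 : ∀ i : Fin m, φ (e (i.castSucc, 0)) = extE (gf m i) := fun i => by
    rw [hφne _ (by simp)]
    congr 1; ext x
    simp [P, gf, hf, hw_sub, hw_C_mul]
  have hlastZero : φ (e (Fin.last m, 0)) = extE (fun x => -2 / hc m * hf m x) := by
    rw [hφne _ (by simp)]
    congr 1; ext x
    simp [P, hf, hw_C_mul]
  have hφ1 : ∀ i : Fin m, φ (e (i.castSucc, 1)) = extE (hd i) := fun i => by
    rw [hφne _ (by simp)]
    congr 1; ext x
    simp [P, hd]
  have hlastOne : φ (e (Fin.last m, 1)) = phiTop := hφt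
  have hm : ∀ j, Measurable (φ j) := fun j => by
    simp only [φ]; split_ifs
    · exact measurable_phiTop
    · exact measurable_extE_hw _
  have hiR : ∀ j, Integrable fun x : ℝ => φ j x := fun j => by
    simp only [φ]; split_ifs
    · simp
    · simpa using integrable_hw _
  have hi : ∀ j, Integrable (φ j) volE := fun j => (integrable_volE _).2 (hiR j)
  have hv : Integrable fun x => -2 / hc m * hf m x := (integrable_hf m).const_mul _
  have hve : ∀ x, -2 / hc m * hf m (-x) = -2 / hc m * hf m x := fun x => by rw [hf_neg]
  obtain ⟨C, hC⟩ := dbInt_cons_top e φ a₀ (fun j => P (e.symm (a₀.succAbove j))) hφt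
    (fun j => by simp [φ, Fin.succAbove_ne]) fun a => hP _
  have hzero : ∀ y : Fin (k + n + 1) → EReal, (∀ i, y i ≠ ⊤) → dbInt e epsK φ y = 0 :=
    dbInt_eq_zero_of_ne_top e φ a₀ hφt
  have hJ : (Matrix.of fun j l => ∫ z, φ j z.1 * φ l z.2 * epsK z.1 z.2
      ∂((nuE 1).prod (nuE 1))) = stdSympl e := by
    refine eq_stdSympl e _ (fun a b => skE_antisymm 1 _ _) (fun i j => ?_) (fun i j => ?_)
      (fun i j => ?_)
    · change skE 1 (φ _) (φ _) = 0
      refine Fin.lastCases ?_ (fun i => ?_) i <;> refine Fin.lastCases ?_ (fun j => ?_) j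
      · rw [hlastZero]; exact skE_even_even 1 hv hv hve hve
      · rw [hlastZero, hφ0]; exact skE_even_even 1 hv (integrable_gf _ _) hve (gf_neg _ _)
      · rw [hlastZero, hφ0]; exact skE_even_even 1 (integrable_gf _ _) hv (gf_neg _ _) hve
      · rw [hφ0, hφ0]
        exact skE_even_even 1 (integrable_gf _ _) (integrable_gf _ _) (gf_neg _ _) (gf_neg _ _)
    · have hz : ∀ i : ℕ, skE 1 (extE (hd i)) phiTop = 0 := fun i => by
        rw [skE_extE_phiTop (integrable_hd _), hd, integral_hw_hwD, mul_zero]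
      change skE 1 (φ _) (φ _) = 0
      refine Fin.lastCases ?_ (fun i => ?_) i <;> refine Fin.lastCases ?_ (fun j => ?_) j
      · rw [hlastOne, skE_phiTop_phiTop]
      · rw [hlastOne, hφ1, skE_antisymm, hz, neg_zero]
      · rw [hlastOne, hφ1, hz]
      · rw [hφ1, hφ1, skE_hd_hd]
    · change skE 1 (φ _) (φ _) = _
      refine Fin.lastCases ?_ (fun i => ?_) i <;> refine Fin.lastCases ?_ (fun j => ?_) j
      · rw [hlastZero, hlastOne, skE_extE_phiTop hv, integral_const_mul]
        change -(1 / 2) * (-2 / hc m * hc m) = _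
        rw [div_mul_cancel₀ _ (hc_ne_zero m)]; norm_num
      · rw [hlastZero, hφ1, skE_hd 1 hv]
        simp only [mul_assoc]
        rw [integral_const_mul, integral_hf_mul_hf, if_neg j.2.ne', mul_zero,
          if_neg (Fin.castSucc_lt_last j).ne']
      · rw [hφ0, hlastOne, skE_extE_phiTop (integrable_gf _ _), integral_gf, mul_zero,
          if_neg (Fin.castSucc_lt_last i).ne]
      · rw [hφ0, hφ1, skE_hd 1 (integrable_gf _ _), integral_gf_mul_hf j.2]
        simp [Fin.ext_iff]
  refine goe_correlation hC (cfg_dbInt_cons_ne_zero e measurable_epsK abs_epsK_le epsK_antisymm hm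
    volE hi ⊤ volE_singleton_top hzero hJ) x _ ?_
  have main := sq_cfg_dbInt_cons_glue e measurable_epsK abs_epsK_le epsK_antisymm hm volE hi ⊤
    volE_singleton_top hzero hJ (fun i => (x i : EReal)) (fun i => EReal.coe_ne_top _)
  have hker : kerMat e (nuE 1) epsK φ (fun i => (x i : EReal)) =
      kerBlock (oS m) (oD m) (oI m) x := by
    have hpt : ∀ a : ℝ, epsOp epsK (nuE 1) phiTop a = -1 / 2 := fun a => by
      rw [epsOp_phiTop, epsK_coe_top]; simp
    have hS : ∀ a c : ℝ, kerS e (nuE 1) epsK φ a c = oS m a c := fun a c => by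
      rw [kerS, oS, Fin.sum_univ_castSucc]
      simp only [hφ0, hφ1, hlastZero, hlastOne, epsOp_extE 1 (integrable_gf _ _), hpt,
        epsOp_extE 1 (integrable_hd _), epsR_hd, epsR_gf, extE_coe, phiTop_coe]
      rw [Fin.sum_univ_eq_sum_range (fun j => gf m j a * hf j c - hd j a * gI m j c) m]
      ring
    have hD : ∀ a c : ℝ, kerD e φ (a : EReal) c = oD m a c := fun a c => by
      rw [kerD, oD, Fin.sum_univ_castSucc]
      simp only [hφ0, hφ1, hlastZero, hlastOne, extE_coe, phiTop_coe]
      rw [Fin.sum_univ_eq_sum_range (fun j => hd j a * gf m j c - gf m j a * hd j c) m]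
      ring
    have hI' : ∀ a c : ℝ, kerI e (nuE 1) epsK φ a c = oI m a c := fun a c => by
      rw [kerI, oI, Fin.sum_univ_castSucc]
      simp only [hφ0, hφ1, hlastZero, hlastOne, epsOp_extE 1 (integrable_gf _ _), hpt,
        epsOp_extE 1 (integrable_hd _), epsOp_extE 1 hv, epsR_const_mul, epsR_hf, epsR_hd, epsR_gf]
      rw [Fin.sum_univ_eq_sum_range (fun j => gI m j a * hf j c - hf j a * gI m j c) m]
      ring
    simp only [kerMat, kerBlock, hS, hD, hI', epsK_coe]
  rw [← hker]
  exact main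

end

section

open MeasureTheory Filter Topology

/-- The local frequency of the Hermite function of order `2j` at the origin. -/
noncomputable def om (j : ℕ) : ℝ := √(2 * j + 1 / 2)

lemma om_sq (j : ℕ) : om j ^ 2 = 2 * j + 1 / 2 := Real.sq_sqrt (by positivity)

lemma om_pos (j : ℕ) : 0 < om j := Real.sqrt_pos.2 (by positivity)

lemma half_le_om (j : ℕ) : 1 / 2 ≤ om j := by
  have h := om_sq j
  have := om_pos j
  have hj : (0 : ℝ) ≤ j := j.cast_nonneg
  nlinarith

lemma hf_abs (j : ℕ) (x : ℝ) : hf j |x| = hf j x := by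
  rcases abs_choice x with h | h <;> rw [h]
  exact hf_neg j x

lemma hd_abs_sq (j : ℕ) (x : ℝ) : hd j |x| ^ 2 = hd j x ^ 2 := by
  rcases abs_choice x with h | h <;> rw [h]
  rw [hd_neg]; ring

lemma hermite_energy (j : ℕ) (x : ℝ) :
    hd j x ^ 2 + (om j ^ 2 - x ^ 2 / 4) * hf j x ^ 2 ≤ om j ^ 2 * hf j 0 ^ 2 := by
  have hder : ∀ x, HasDerivAt (fun x => hd j x ^ 2 + (om j ^ 2 - x ^ 2 / 4) * hf j x ^ 2)
      (-(x / 2) * hf j x ^ 2) x := fun x => by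
    have h1 := (hasDerivAt_hd j x).pow 2
    have h2 := (hasDerivAt_hf j x).pow 2
    have h3 := ((hasDerivAt_pow 2 x).div_const 4).const_sub (om j ^ 2)
    refine (h1.add (h3.mul h2)).congr_deriv ?_
    rw [om_sq]
    simp
    ring
  have hanti : AntitoneOn (fun x => hd j x ^ 2 + (om j ^ 2 - x ^ 2 / 4) * hf j x ^ 2)
      (Set.Ici 0) := by
    refine antitoneOn_of_deriv_nonpos (convex_Ici 0)
      (fun x _ => (hder x).continuousAt.continuousWithinAt)
      (fun x _ => (hder x).differentiableAt.differentiableWithinAt) fun x hx => ?_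
    rw [interior_Ici, Set.mem_Ioi] at hx
    rw [(hder x).deriv]
    nlinarith [sq_nonneg (hf j x)]
  have h := hanti (Set.mem_Ici.2 le_rfl) (Set.mem_Ici.2 (abs_nonneg x)) (abs_nonneg x)
  simp only [hf_abs, hd_abs_sq, sq_abs, hd_zero] at h
  nlinarith

lemma abs_hf_le (j : ℕ) {x : ℝ} (hx : |x| ≤ 1) : |hf j x| ≤ 2 * |hf j 0| := by
  have h := hermite_energy j x
  have hx2 : x ^ 2 ≤ 1 := by rw [← sq_abs]; nlinarith [abs_nonneg x]
  have ho := om_sq j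
  have hj : (0 : ℝ) ≤ j := j.cast_nonneg
  refine abs_le_of_sq_le_sq' ?_ (by positivity) |> abs_le.2 |> fun h => h
  have h1 : om j ^ 2 / 2 * hf j x ^ 2 ≤ om j ^ 2 * hf j 0 ^ 2 := by
    have : om j ^ 2 / 2 * hf j x ^ 2 ≤ (om j ^ 2 - x ^ 2 / 4) * hf j x ^ 2 :=
      mul_le_mul_of_nonneg_right (by nlinarith) (sq_nonneg _)
    nlinarith [sq_nonneg (hd j x)]
  have h2 : 0 < om j ^ 2 := by have := om_pos j; positivity
  have h3 : hf j x ^ 2 ≤ 2 * hf j 0 ^ 2 := by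
    by_contra hcon
    push Not at hcon
    nlinarith
  rw [mul_pow, sq_abs]
  nlinarith [sq_nonneg (hf j 0)]

lemma abs_hd_le (j : ℕ) {x : ℝ} (hx : |x| ≤ 1) : |hd j x| ≤ om j * |hf j 0| := by
  have h := hermite_energy j x
  have hx2 : x ^ 2 ≤ 1 := by rw [← sq_abs]; nlinarith [abs_nonneg x]
  have ho := om_sq j
  have hj : (0 : ℝ) ≤ j := j.cast_nonneg
  have := om_pos j
  refine abs_le.2 (abs_le_of_sq_le_sq' ?_ (by positivity))
  rw [mul_pow, sq_abs]
  nlinarith [mul_nonneg (by nlinarith : (0 : ℝ) ≤ om j ^ 2 - x ^ 2 / 4) (sq_nonneg (hf j x))]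

lemma abs_sub_le_of_deriv {g g' : ℝ → ℝ} (hg : ∀ x, HasDerivAt g (g' x) x) {ρ C : ℝ} (x : ℝ)
    (hx : |x| ≤ ρ) (hb : ∀ y, |y| ≤ ρ → |g' y| ≤ C) : |g x - g 0| ≤ C * |x| := by
  have := (convex_Icc (-ρ) ρ).norm_image_sub_le_of_norm_hasDerivWithin_le (f := g) (f' := g')
    (C := C) (x := 0) (y := x) (fun y _ => (hg y).hasDerivWithinAt)
    (fun y hy => hb y (abs_le.2 hy)) (by
      have := (abs_nonneg x).trans hx
      constructor <;> linarith) (abs_le.1 hx)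
  simpa using this

lemma hermite_local (j : ℕ) {x ρ : ℝ} (hx : |x| ≤ ρ) (hρ : ρ ≤ 1) :
    |hf j x - hf j 0 * Real.cos (om j * x)| ≤ 2 * ρ ^ 3 * |hf j 0| / om j ∧
    |hd j x + om j * hf j 0 * Real.sin (om j * x)| ≤ 2 * ρ ^ 3 * |hf j 0| := by
  have ho := om_pos j
  have hρ0 : 0 ≤ ρ := (abs_nonneg x).trans hx
  have hc : ∀ x, HasDerivAt (fun x => Real.cos (om j * x)) (-(om j * Real.sin (om j * x))) x :=
    fun x => by
      have := ((hasDerivAt_id x).const_mul (om j)).cos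
      refine this.congr_deriv ?_
      simp; ring
  have hs : ∀ x, HasDerivAt (fun x => Real.sin (om j * x)) (om j * Real.cos (om j * x)) x :=
    fun x => by
      have := ((hasDerivAt_id x).const_mul (om j)).sin
      refine this.congr_deriv ?_
      simp; ring
  set A : ℝ → ℝ := fun x => hf j x * Real.cos (om j * x) - hd j x * Real.sin (om j * x) / om j
    with hA
  set B : ℝ → ℝ := fun x => hf j x * Real.sin (om j * x) + hd j x * Real.cos (om j * x) / om j
    with hB
  have hA' : ∀ x, HasDerivAt A (-(x ^ 2 / 4) * hf j x * Real.sin (om j * x) / om j) x := fun x => by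
    refine (((hasDerivAt_hf j x).mul (hc x)).sub
      (((hasDerivAt_hd j x).mul (hs x)).div_const (om j))).congr_deriv ?_
    rw [← om_sq]; field_simp; ring
  have hB' : ∀ x, HasDerivAt B (x ^ 2 / 4 * hf j x * Real.cos (om j * x) / om j) x := fun x => by
    refine (((hasDerivAt_hf j x).mul (hs x)).add
      (((hasDerivAt_hd j x).mul (hc x)).div_const (om j))).congr_deriv ?_
    rw [← om_sq]; field_simp; ring
  have hbd : ∀ y t, |y| ≤ ρ → |t| ≤ 1 → |y ^ 2 / 4 * hf j y * t / om j| ≤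
      ρ ^ 2 * |hf j 0| / om j := fun y t hy ht => by
    rw [abs_div, abs_of_pos ho, abs_mul, abs_mul]
    have h1 := abs_hf_le j (hy.trans hρ)
    have h2 : |y ^ 2 / 4| ≤ ρ ^ 2 / 4 := by
      rw [abs_of_nonneg (by positivity), ← sq_abs]; gcongr
    refine div_le_div_of_nonneg_right ?_ ho.le
    calc |y ^ 2 / 4| * |hf j y| * |t| ≤ ρ ^ 2 / 4 * (2 * |hf j 0|) * 1 := by gcongr
      _ ≤ ρ ^ 2 * |hf j 0| := by nlinarith [mul_nonneg (sq_nonneg ρ) (abs_nonneg (hf j 0))]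
  have hAb : |A x - hf j 0| ≤ ρ ^ 3 * |hf j 0| / om j := by
    have h := abs_sub_le_of_deriv hA' x hx fun y hy => by
      have := hbd y (-Real.sin (om j * y)) hy (by rw [abs_neg]; exact Real.abs_sin_le_one _)
      convert this using 2; ring
    have h0 : A 0 = hf j 0 := by simp [hA]
    rw [h0] at h
    refine h.trans ?_
    calc ρ ^ 2 * |hf j 0| / om j * |x| ≤ ρ ^ 2 * |hf j 0| / om j * ρ := by gcongr
      _ = _ := by ring
  have hBb : |B x| ≤ ρ ^ 3 * |hf j 0| / om j := by
    have h := abs_sub_le_of_deriv hB' x hx fun y hy => hbd y _ hy (Real.abs_cos_le_one _)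
    have h0 : B 0 = 0 := by simp [hB, hd_zero]
    rw [h0, sub_zero] at h
    refine h.trans ?_
    calc ρ ^ 2 * |hf j 0| / om j * |x| ≤ ρ ^ 2 * |hf j 0| / om j * ρ := by gcongr
      _ = _ := by ring
  have hcs := Real.sin_sq_add_cos_sq (om j * x)
  have comb : ∀ a b c d M : ℝ, |a| ≤ M → |b| ≤ M → |c| ≤ 1 → |d| ≤ 1 → |a * c + b * d| ≤ 2 * M :=
    fun a b c d M ha hb hc hd => by
      refine (abs_add_le _ _).trans ?_
      rw [abs_mul, abs_mul]
      nlinarith [mul_le_of_le_one_right (abs_nonneg a) hc, mul_le_of_le_one_right (abs_nonneg b) hd]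
  constructor
  · have e : hf j x - hf j 0 * Real.cos (om j * x) =
        (A x - hf j 0) * Real.cos (om j * x) + B x * Real.sin (om j * x) := by
      simp only [hA, hB]
      linear_combination -(hf j x) * hcs
    rw [e]
    refine (comb _ _ _ _ _ hAb hBb (Real.abs_cos_le_one _) (Real.abs_sin_le_one _)).trans_eq ?_
    ring
  · have e : hd j x + om j * hf j 0 * Real.sin (om j * x) =
        om j * (B x * Real.cos (om j * x) + (A x - hf j 0) * (-Real.sin (om j * x))) := by
      simp only [hA, hB]
      field_simp
      linear_combination -(hd j x) * hcs
    rw [e, abs_mul, abs_of_pos ho]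
    have := comb _ _ _ (-Real.sin (om j * x)) _ hBb hAb (Real.abs_cos_le_one (om j * x))
      (by rw [abs_neg]; exact Real.abs_sin_le_one _)
    calc om j * _ ≤ om j * (2 * (ρ ^ 3 * |hf j 0| / om j)) := by gcongr
      _ = _ := by field_simp

lemma hasDerivAt_hI (j : ℕ) (x : ℝ) : HasDerivAt (hI j) (hf j x) x :=
  intervalIntegral.integral_hasDerivAt_right (integrable_hf j).intervalIntegrable
    ((continuous_hw _).stronglyMeasurableAtFilter _ _) (continuous_hw _).continuousAt

lemma hI_zero (j : ℕ) : hI j 0 = 0 := by simp [hI]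

lemma hermite_local_primitive (j : ℕ) {x ρ : ℝ} (hx : |x| ≤ ρ) (hρ : ρ ≤ 1) :
    |hI j x - hf j 0 * Real.sin (om j * x) / om j| ≤ 2 * ρ ^ 3 * |hf j 0| / om j := by
  have ho := om_pos j
  have hs : ∀ x, HasDerivAt (fun x => Real.sin (om j * x)) (om j * Real.cos (om j * x)) x :=
    fun x => by
      have := ((hasDerivAt_id x).const_mul (om j)).sin
      refine this.congr_deriv ?_
      simp; ring
  have h := abs_sub_le_of_deriv (g := fun x => hI j x - hf j 0 * Real.sin (om j * x) / om j)
    (fun x => (hasDerivAt_hI j x).sub (((hs x).const_mul (hf j 0)).div_const (om j))) x hx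
    fun y hy => by
      have := (hermite_local j hy hρ).1
      convert this using 2
      field_simp
  simp only [hI_zero, mul_zero, Real.sin_zero, zero_div, sub_zero] at h
  refine h.trans (mul_le_of_le_one_right ?_ (hx.trans hρ))
  have := (abs_nonneg x).trans hx
  positivity

lemma abs_hI_le (j : ℕ) {x : ℝ} (hx : |x| ≤ 1) : |hI j x| ≤ 2 * |hf j 0| * |x| := by
  have h := abs_sub_le_of_deriv (hasDerivAt_hI j) x hx fun y hy => abs_hf_le j hy
  simpa [hI_zero] using h

end

section

open MeasureTheory Filter Topology

lemma om_mono : Monotone om := fun i j h => Real.sqrt_le_sqrt (by gcongr)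

/-- Spacing of consecutive local frequencies. -/
lemma om_succ_sub (j : ℕ) : om (j + 1) - om j = 2 / (om (j + 1) + om j) := by
  have h1 := om_sq j
  have h2 := om_sq (j + 1)
  have := om_pos j
  have := om_pos (j + 1)
  push_cast at h2
  rw [eq_div_iff (by positivity)]
  linear_combination h2 - h1

lemma om_succ_sub_le (j : ℕ) : om (j + 1) - om j ≤ 2 := by
  rw [om_succ_sub, div_le_iff₀ (by linarith [om_pos j, om_pos (j + 1)])]
  linarith [half_le_om j, half_le_om (j + 1)]

lemma sum_om_succ_sub (m : ℕ) : ∑ j ∈ Finset.range m, (om (j + 1) - om j) = om m - om 0 :=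
  Finset.sum_range_sub om m

lemma tendsto_om : Tendsto om atTop atTop := by
  refine Real.tendsto_sqrt_atTop.comp ?_
  refine tendsto_atTop_add_const_right _ _ (Tendsto.const_mul_atTop two_pos ?_)
  exact tendsto_natCast_atTop_atTop

lemma wal_mul_sqrt_le (j : ℕ) : wal j * √(2 * j + 1) ≤ 1 := by
  have h := wal_le j
  have h0 := wal_pos j
  refine abs_le_of_sq_le_sq' ?_ zero_le_one |>.2
  rw [mul_pow, Real.sq_sqrt (by positivity)]
  linarith

lemma hf_zero_sq_le (j : ℕ) : hf j 0 ^ 2 ≤ om (j + 1) - om j := by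
  rw [om_succ_sub, hf_zero_sq]
  have hp := Real.pi_gt_three
  have hj : (0 : ℝ) ≤ j := j.cast_nonneg
  have h1 : om (j + 1) ≤ √(2 * Real.pi) * √(2 * j + 1) := by
    rw [← Real.sqrt_mul (by positivity), om]
    refine Real.sqrt_le_sqrt ?_
    push_cast
    nlinarith
  have h2 := om_mono (Nat.le_succ j)
  have h3 := wal_mul_sqrt_le j
  have h4 := wal_pos j
  have h5 : 0 < √(2 * Real.pi) := by positivity
  rw [div_le_div_iff₀ h5 (by linarith [om_pos j, om_pos (j + 1)])]
  simp only [Nat.succ_eq_add_one] at h2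
  calc wal j * (om (j + 1) + om j) ≤ wal j * (2 * (√(2 * Real.pi) * √(2 * j + 1))) := by
        gcongr; linarith
    _ = 2 * √(2 * Real.pi) * (wal j * √(2 * j + 1)) := by ring
    _ ≤ 2 * √(2 * Real.pi) * 1 := by gcongr
    _ = _ := by ring

lemma sum_hf_zero_sq_le (m : ℕ) : ∑ j ∈ Finset.range m, hf j 0 ^ 2 ≤ om m := by
  refine (Finset.sum_le_sum fun j _ => hf_zero_sq_le j).trans ?_
  rw [sum_om_succ_sub]
  linarith [om_pos 0]

lemma tendsto_om_div (c : ℕ) : Tendsto (fun j : ℕ => om (j + c) / √(2 * j + 1)) atTop (𝓝 1) := by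
  have h : Tendsto (fun j : ℕ => (1 : ℝ) + (2 * c - 1 / 2) / (2 * j + 1)) atTop (𝓝 (1 + 0)) := by
    refine tendsto_const_nhds.add (Tendsto.div_atTop tendsto_const_nhds ?_)
    exact tendsto_atTop_add_const_right _ _
      (Tendsto.const_mul_atTop two_pos tendsto_natCast_atTop_atTop)
  have h2 := h.sqrt
  simp only [add_zero, Real.sqrt_one] at h2
  refine h2.congr fun j => ?_
  rw [om, ← Real.sqrt_div' _ (by positivity)]
  congr 1
  push_cast
  field_simp
  ring

lemma hf_zero_sq_isLittleO : (fun j => hf j 0 ^ 2 - (om (j + 1) - om j) / Real.pi) =o[atTop]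
    (fun j => om (j + 1) - om j) := by
  have hne : ∀ j, om (j + 1) - om j ≠ 0 := fun j => by
    rw [om_succ_sub]; have := om_pos j; have := om_pos (j + 1); positivity
  rw [Asymptotics.isLittleO_iff_tendsto fun j h => absurd h (hne j)]
  have hw : Tendsto (fun j : ℕ => wal j * √(2 * j + 1)) atTop (𝓝 (√(2 / Real.pi))) := by
    refine tendsto_wal.sqrt.congr fun j => ?_
    rw [Real.sqrt_mul (sq_nonneg _), Real.sqrt_sq (wal_pos j).le]
  have h := ((hw.div_const √(2 * Real.pi)).mul
    (((tendsto_om_div 1).add (tendsto_om_div 0)).div_const 2)).sub_const (1 / Real.pi)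
  have e : √(2 / Real.pi) / √(2 * Real.pi) * ((1 + 1) / 2) - 1 / Real.pi = 0 := by
    rw [← Real.sqrt_div' _ (by positivity)]
    have : 2 / Real.pi / (2 * Real.pi) = (1 / Real.pi) ^ 2 := by field_simp
    rw [this, Real.sqrt_sq (by positivity)]
    ring
  rw [e] at h
  refine h.congr fun j => ?_
  have h1 := om_pos j
  have h2 := om_pos (j + 1)
  have h3 : 0 < √(2 * j + 1 : ℝ) := by positivity
  rw [sub_div, div_right_comm, div_self (hne j), hf_zero_sq, om_succ_sub]
  simp only [add_zero]
  field_simp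

/-- Riemann sums over the local frequencies, weighted by the squared values at the origin. -/
lemma tendsto_riemann {κ : ℕ → ℝ} (hκ : ∀ m, 0 ≤ κ m)
    (hlim : Tendsto (fun m => κ m * om m) atTop (𝓝 Real.pi)) {F : ℝ → ℝ} (hF : Continuous F) :
    Tendsto (fun m => ∑ j ∈ Finset.range m, κ m * hf j 0 ^ 2 * F (κ m * om j)) atTop
      (𝓝 ((∫ v in (0 : ℝ)..Real.pi, F v) / Real.pi)) := by
  have hκ0 : Tendsto κ atTop (𝓝 0) := by
    have := hlim.div_atTop tendsto_om
    refine this.congr fun m => ?_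
    have := om_pos m
    field_simp
  have hle4 : ∀ᶠ m in atTop, κ m * om m ≤ 4 :=
    (hlim.eventually_lt_const Real.pi_lt_four).mono fun m h => h.le
  obtain ⟨M, hM⟩ := (isCompact_Icc (a := (0 : ℝ)) (b := 4)).exists_bound_of_continuousOn
    hF.continuousOn
  have hin : ∀ m, κ m * om m ≤ 4 → ∀ j ≤ m, κ m * om j ∈ Set.Icc (0 : ℝ) 4 := fun m h j hj =>
    ⟨mul_nonneg (hκ m) (om_pos j).le, (mul_le_mul_of_nonneg_left (om_mono hj) (hκ m)).trans h⟩
  have hM0 : 0 ≤ M := (norm_nonneg _).trans (hM 0 (by norm_num))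
  -- replacing the weights by the spacings
  have h1 : Tendsto (fun m => ∑ j ∈ Finset.range m,
      κ m * (hf j 0 ^ 2 - (om (j + 1) - om j) / Real.pi) * F (κ m * om j)) atTop (𝓝 0) := by
    have ho := hf_zero_sq_isLittleO.norm_left.sum_range
      (fun j => sub_nonneg.2 (om_mono (Nat.le_succ j))) (by
        simp only [sum_om_succ_sub]
        exact tendsto_atTop_add_const_right _ _ tendsto_om)
    have ho2 : (fun m => ∑ j ∈ Finset.range m, ‖hf j 0 ^ 2 - (om (j + 1) - om j) / Real.pi‖)
        =o[atTop] om := by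
      refine ho.trans_isBigO (Asymptotics.IsBigO.of_bound 1 (Eventually.of_forall fun m => ?_))
      rw [sum_om_succ_sub, one_mul, Real.norm_of_nonneg (sub_nonneg.2 (om_mono (Nat.zero_le m))),
        Real.norm_of_nonneg (om_pos m).le]
      linarith [om_pos 0]
    have ht := (Asymptotics.isLittleO_iff_tendsto
      (fun m h => absurd h (om_pos m).ne')).1 ho2
    have ht2 := (ht.mul hlim).mul_const M
    rw [zero_mul, zero_mul] at ht2
    refine squeeze_zero_norm' (hle4.mono fun m hm => ?_) ht2
    refine (norm_sum_le _ _).trans ?_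
    have : (∑ j ∈ Finset.range m, ‖hf j 0 ^ 2 - (om (j + 1) - om j) / Real.pi‖) / om m *
        (κ m * om m) * M =
        ∑ j ∈ Finset.range m, κ m * ‖hf j 0 ^ 2 - (om (j + 1) - om j) / Real.pi‖ * M := by
      rw [← Finset.sum_mul, ← Finset.mul_sum]
      generalize ∑ j ∈ Finset.range m, ‖hf j 0 ^ 2 - (om (j + 1) - om j) / Real.pi‖ = s
      have := om_pos m
      field_simp
    rw [this]
    refine Finset.sum_le_sum fun j hj => ?_
    rw [norm_mul, norm_mul, Real.norm_of_nonneg (hκ m)]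
    have := hM _ (hin m hm j (Finset.mem_range.1 hj).le)
    have := hκ m
    gcongr
  -- comparing with the integral
  have h2 : Tendsto (fun m => ∑ j ∈ Finset.range m, κ m * (om (j + 1) - om j) * F (κ m * om j) -
      ∫ v in (κ m * om 0)..(κ m * om m), F v) atTop (𝓝 0) := by
    rw [Metric.tendsto_nhds]
    intro ε hε
    obtain ⟨δ, hδ, hu⟩ := Metric.uniformContinuousOn_iff_le.1
      ((isCompact_Icc (a := (0 : ℝ)) (b := 4)).uniformContinuousOn_of_continuous hF.continuousOn)
      (ε / 8) (by positivity)
    filter_upwards [hle4, hκ0.eventually_lt_const (show (0 : ℝ) < δ / 2 by positivity)]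
      with m hm hmδ
    rw [dist_zero_right, ← intervalIntegral.sum_integral_adjacent_intervals
      (a := fun j => κ m * om j) fun j _ => hF.intervalIntegrable _ _, ← Finset.sum_sub_distrib]
    refine (norm_sum_le _ _).trans_lt ?_
    have hterm : ∀ j ∈ Finset.range m, ‖κ m * (om (j + 1) - om j) * F (κ m * om j) -
        ∫ v in (κ m * om j)..(κ m * om (j + 1)), F v‖ ≤
        ε / 8 * (κ m * (om (j + 1) - om j)) := fun j hj => by
      have hjm := Finset.mem_range.1 hj
      have hmono : κ m * om j ≤ κ m * om (j + 1) :=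
        mul_le_mul_of_nonneg_left (om_mono (Nat.le_succ j)) (hκ m)
      have e : κ m * (om (j + 1) - om j) * F (κ m * om j) =
          ∫ v in (κ m * om j)..(κ m * om (j + 1)), F (κ m * om j) := by
        rw [intervalIntegral.integral_const, smul_eq_mul, mul_sub]
      rw [e, ← intervalIntegral.integral_sub intervalIntegrable_const (hF.intervalIntegrable _ _)]
      have := intervalIntegral.norm_integral_le_of_norm_le_const (a := κ m * om j)
        (b := κ m * om (j + 1)) (C := ε / 8) (f := fun v => F (κ m * om j) - F v) fun v hv => by
          rw [Set.uIoc_of_le hmono] at hv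
          have hj1 := hin m hm j hjm.le
          have hj2 := hin m hm (j + 1) hjm
          rw [← dist_eq_norm]
          refine hu _ hj1 v ⟨hj1.1.trans hv.1.le, hv.2.trans hj2.2⟩ ?_
          rw [Real.dist_eq, abs_sub_comm, abs_of_pos (sub_pos.2 hv.1)]
          have := om_succ_sub_le j
          have h3 : κ m * (om (j + 1) - om j) ≤ κ m * 2 := mul_le_mul_of_nonneg_left this (hκ m)
          linarith [hv.2]
      refine this.trans_eq ?_
      rw [abs_of_nonneg (sub_nonneg.2 hmono)]
      ring
    refine (Finset.sum_le_sum hterm).trans_lt ?_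
    rw [← Finset.mul_sum, ← Finset.mul_sum, sum_om_succ_sub]
    have h5 : κ m * (om m - om 0) ≤ 4 := by
      have := mul_nonneg (hκ m) (om_pos 0).le
      linarith
    nlinarith
  have h3 : Tendsto (fun m => ∫ v in (κ m * om 0)..(κ m * om m), F v) atTop
      (𝓝 (∫ v in (0 : ℝ)..Real.pi, F v)) := by
    have hG : Continuous fun b => ∫ v in (0 : ℝ)..b, F v :=
      intervalIntegral.continuous_primitive (fun a b => hF.intervalIntegrable a b) 0
    have ha := (hG.tendsto Real.pi).comp hlim
    have hb : Tendsto (fun m => κ m * om 0) atTop (𝓝 0) := by simpa using hκ0.mul_const (om 0)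
    have hb := (hG.tendsto 0).comp hb
    have := ha.sub hb
    simp only [intervalIntegral.integral_same, sub_zero] at this
    refine this.congr fun m => ?_
    exact intervalIntegral.integral_interval_sub_left (hF.intervalIntegrable _ _)
      (hF.intervalIntegrable _ _)
  have := (h1.add ((h2.add h3).div_const Real.pi))
  simp only [zero_add, sub_add_cancel] at this
  refine this.congr fun m => ?_
  rw [Finset.sum_div, ← Finset.sum_add_distrib]
  refine Finset.sum_congr rfl fun j _ => ?_
  ring

end

section

open MeasureTheory Filter Topology

lemma abs_mul_sub_mul_le {p q p' q' a b c d : ℝ} (h1 : |p - p'| ≤ a) (h2 : |q| ≤ b)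
    (h3 : |p'| ≤ c) (h4 : |q - q'| ≤ d) : |p * q - p' * q'| ≤ a * b + c * d := by
  have e : p * q - p' * q' = (p - p') * q + p' * (q - q') := by ring
  rw [e]
  refine (abs_add_le _ _).trans ?_
  rw [abs_mul, abs_mul]
  have := (abs_nonneg _).trans h1
  have := (abs_nonneg _).trans h3
  gcongr

lemma abs_mul_le_of_abs_le_one {a t : ℝ} (ht : |t| ≤ 1) : |a * t| ≤ |a| := by
  rw [abs_mul]; exact mul_le_of_le_one_right (abs_nonneg a) ht

lemma div_om_le {a : ℝ} (ha : 0 ≤ a) (j : ℕ) : a / om j ≤ 2 * a := by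
  rw [div_le_iff₀ (om_pos j)]
  nlinarith [half_le_om j]

section
variable {x y ρ : ℝ}

lemma kS_term_local (j : ℕ) (hx : |x| ≤ ρ) (hy : |y| ≤ ρ) (hρ : ρ ≤ 1) :
    |hf j x * hf j y - hd j x * hI j y - hf j 0 ^ 2 * Real.cos (om j * (x - y))| ≤
      56 * ρ ^ 3 * hf j 0 ^ 2 := by
  have hρ0 := (abs_nonneg x).trans hx
  have hA := abs_nonneg (hf j 0)
  have hδ : 0 ≤ 2 * ρ ^ 3 * |hf j 0| := by positivity
  have ho := om_pos j
  have h1 := abs_mul_sub_mul_le (hermite_local j hx hρ).1 (abs_hf_le j (hy.trans hρ))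
    (abs_mul_le_of_abs_le_one (a := hf j 0) (Real.abs_cos_le_one (om j * x)))
    (hermite_local j hy hρ).1
  have h2 := abs_mul_sub_mul_le (p := hd j x) (p' := -(om j * hf j 0 * Real.sin (om j * x)))
      (a := 2 * ρ ^ 3 * |hf j 0|)
    (by rw [sub_neg_eq_add]; exact (hermite_local j hx hρ).2)
    (abs_hI_le j (hy.trans hρ)) (c := om j * |hf j 0|)
    (by
      rw [abs_neg]
      refine (abs_mul_le_of_abs_le_one (Real.abs_sin_le_one _)).trans_eq ?_
      rw [abs_mul, abs_of_pos ho])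
    (hermite_local_primitive j hy hρ)
  have h3 := div_om_le hδ j
  have e : hf j x * hf j y - hd j x * hI j y - hf j 0 ^ 2 * Real.cos (om j * (x - y)) =
      (hf j x * hf j y - hf j 0 * Real.cos (om j * x) * (hf j 0 * Real.cos (om j * y))) -
      (hd j x * hI j y - -(om j * hf j 0 * Real.sin (om j * x)) *
        (hf j 0 * Real.sin (om j * y) / om j)) := by
    rw [mul_sub, Real.cos_sub]
    field_simp
    ring
  rw [e]
  refine (abs_sub _ _).trans ((add_le_add h1 h2).trans ?_)
  have h4 : om j * |hf j 0| * (2 * ρ ^ 3 * |hf j 0| / om j) = 2 * ρ ^ 3 * |hf j 0| ^ 2 := by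
    field_simp
  have h5 : 2 * ρ ^ 3 * |hf j 0| * (2 * |hf j 0| * |y|) ≤
      2 * ρ ^ 3 * |hf j 0| * (2 * |hf j 0| * 1) := by
    gcongr; exact hy.trans hρ
  rw [h4]
  have h6 : 2 * ρ ^ 3 * |hf j 0| / om j * (2 * |hf j 0|) ≤
      2 * (2 * ρ ^ 3 * |hf j 0|) * (2 * |hf j 0|) := by gcongr
  have h7 : |hf j 0| * (2 * ρ ^ 3 * |hf j 0| / om j) ≤
      |hf j 0| * (2 * (2 * ρ ^ 3 * |hf j 0|)) := by gcongr
  have h8 : 0 ≤ ρ ^ 3 * |hf j 0| ^ 2 := by positivity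
  rw [← sq_abs (hf j 0)]
  nlinarith

lemma kD_term_local (j : ℕ) (hx : |x| ≤ ρ) (hy : |y| ≤ ρ) (hρ : ρ ≤ 1) :
    |hd j x * hf j y - hf j x * hd j y + hf j 0 ^ 2 * om j * Real.sin (om j * (x - y))| ≤
      56 * ρ ^ 3 * hf j 0 ^ 2 := by
  have hρ0 := (abs_nonneg x).trans hx
  have hA := abs_nonneg (hf j 0)
  have ho := om_pos j
  have key : ∀ x y, |x| ≤ ρ → |y| ≤ ρ → |hd j x * hf j y -
      -(om j * hf j 0 * Real.sin (om j * x)) * (hf j 0 * Real.cos (om j * y))| ≤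
      6 * ρ ^ 3 * hf j 0 ^ 2 := fun x y hx hy => by
    refine (abs_mul_sub_mul_le (p := hd j x) (p' := -(om j * hf j 0 * Real.sin (om j * x)))
      (a := 2 * ρ ^ 3 * |hf j 0|)
      (by rw [sub_neg_eq_add]; exact (hermite_local j hx hρ).2)
      (abs_hf_le j (hy.trans hρ)) (c := om j * |hf j 0|)
      (by
        rw [abs_neg]
        refine (abs_mul_le_of_abs_le_one (Real.abs_sin_le_one _)).trans_eq ?_
        rw [abs_mul, abs_of_pos ho])
      (hermite_local j hy hρ).1).trans_eq ?_
    rw [← sq_abs (hf j 0)]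
    field_simp
    ring
  have e : hd j x * hf j y - hf j x * hd j y + hf j 0 ^ 2 * om j * Real.sin (om j * (x - y)) =
      (hd j x * hf j y - -(om j * hf j 0 * Real.sin (om j * x)) * (hf j 0 * Real.cos (om j * y))) -
      (hd j y * hf j x - -(om j * hf j 0 * Real.sin (om j * y)) *
        (hf j 0 * Real.cos (om j * x))) := by
    rw [mul_sub, Real.sin_sub]
    ring
  rw [e]
  refine (abs_sub _ _).trans ((add_le_add (key x y hx hy) (key y x hy hx)).trans ?_)
  have h8 : 0 ≤ ρ ^ 3 * hf j 0 ^ 2 := by positivity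
  nlinarith

lemma kI_term_local (j : ℕ) (hx : |x| ≤ ρ) (hy : |y| ≤ ρ) (hρ : ρ ≤ 1) :
    |hI j x * hf j y - hf j x * hI j y - hf j 0 ^ 2 * Real.sin (om j * (x - y)) / om j| ≤
      56 * ρ ^ 3 * hf j 0 ^ 2 := by
  have hρ0 := (abs_nonneg x).trans hx
  have hA := abs_nonneg (hf j 0)
  have ho := om_pos j
  have hδ : 0 ≤ 2 * ρ ^ 3 * |hf j 0| := by positivity
  have h3 := div_om_le hδ j
  have key : ∀ x y, |x| ≤ ρ → |y| ≤ ρ → |hI j x * hf j y -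
      hf j 0 * Real.sin (om j * x) / om j * (hf j 0 * Real.cos (om j * y))| ≤
      24 * ρ ^ 3 * hf j 0 ^ 2 := fun x y hx hy => by
    refine (abs_mul_sub_mul_le ((hermite_local_primitive j hx hρ).trans h3)
      (abs_hf_le j (hy.trans hρ)) (c := 2 * |hf j 0|)
      (by
        rw [abs_div, abs_of_pos ho]
        refine (div_le_div_of_nonneg_right
          (abs_mul_le_of_abs_le_one (Real.abs_sin_le_one _)) ho.le).trans (div_om_le hA j))
      ((hermite_local j hy hρ).1.trans h3)).trans ?_
    rw [← sq_abs (hf j 0)]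
    have h8 : 0 ≤ ρ ^ 3 * |hf j 0| ^ 2 := by positivity
    nlinarith
  have e : hI j x * hf j y - hf j x * hI j y - hf j 0 ^ 2 * Real.sin (om j * (x - y)) / om j =
      (hI j x * hf j y - hf j 0 * Real.sin (om j * x) / om j * (hf j 0 * Real.cos (om j * y))) -
      (hI j y * hf j x - hf j 0 * Real.sin (om j * y) / om j *
        (hf j 0 * Real.cos (om j * x))) := by
    rw [mul_sub, Real.sin_sub]
    ring
  rw [e]
  refine (abs_sub _ _).trans ((add_le_add (key x y hx hy) (key y x hy hx)).trans ?_)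
  have h8 : 0 ≤ ρ ^ 3 * hf j 0 ^ 2 := by positivity
  nlinarith

end

/-- A scaling sequence under which the top local frequency tends to `π`. -/
structure IsLocalScale (κ : ℕ → ℝ) : Prop where
  nonneg : ∀ m, 0 ≤ κ m
  lim : Tendsto (fun m => κ m * om m) atTop (𝓝 Real.pi)

variable {κ : ℕ → ℝ}

lemma IsLocalScale.tendsto_zero (h : IsLocalScale κ) : Tendsto κ atTop (𝓝 0) := by
  refine (h.lim.div_atTop tendsto_om).congr fun m => ?_
  have := om_pos m
  field_simp

lemma IsLocalScale.le_four (h : IsLocalScale κ) : ∀ᶠ m in atTop, κ m * om m ≤ 4 :=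
  (h.lim.eventually_lt_const Real.pi_lt_four).mono fun _ h => h.le

lemma IsLocalScale.mul_le_one (h : IsLocalScale κ) (R : ℝ) : ∀ᶠ m in atTop, κ m * R ≤ 1 := by
  have := h.tendsto_zero.mul_const R
  rw [zero_mul] at this
  exact (this.eventually_lt_const one_pos).mono fun _ h => h.le

/-- Term-by-term replacement of a weighted sum by a Riemann sum. -/
lemma IsLocalScale.tendsto_sum (h : IsLocalScale κ) {F : ℝ → ℝ} (hF : Continuous F)
    {T : ℕ → ℕ → ℝ} {R : ℝ}
    (hT : ∀ᶠ m in atTop, ∀ j < m, |T m j - κ m * hf j 0 ^ 2 * F (κ m * om j)| ≤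
      κ m ^ 2 * R * (κ m * hf j 0 ^ 2)) :
    Tendsto (fun m => ∑ j ∈ Finset.range m, T m j) atTop
      (𝓝 ((∫ v in (0 : ℝ)..Real.pi, F v) / Real.pi)) := by
  have h0 : Tendsto (fun m => κ m ^ 2 * |R| * 4) atTop (𝓝 0) := by
    have := ((h.tendsto_zero.pow 2).mul_const |R|).mul_const 4
    simpa using this
  have h1 : Tendsto (fun m => ∑ j ∈ Finset.range m, T m j -
      ∑ j ∈ Finset.range m, κ m * hf j 0 ^ 2 * F (κ m * om j)) atTop (𝓝 0) := by
    refine squeeze_zero_norm' ?_ h0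
    filter_upwards [hT, h.le_four] with m hm hm4
    rw [← Finset.sum_sub_distrib]
    refine (norm_sum_le _ _).trans ?_
    have hκ := h.nonneg m
    calc _ ≤ ∑ j ∈ Finset.range m, κ m ^ 2 * |R| * (κ m * hf j 0 ^ 2) :=
          Finset.sum_le_sum fun j hj => (hm j (Finset.mem_range.1 hj)).trans (by
            gcongr; exact le_abs_self R)
      _ = κ m ^ 2 * |R| * (κ m * ∑ j ∈ Finset.range m, hf j 0 ^ 2) := by
          rw [← Finset.mul_sum, ← Finset.mul_sum]
      _ ≤ κ m ^ 2 * |R| * (κ m * om m) := by gcongr; exact sum_hf_zero_sq_le m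
      _ ≤ _ := by gcongr
  have := h1.add (tendsto_riemann h.nonneg h.lim hF)
  simpa using this

lemma IsLocalScale.abs_mul_le (h : IsLocalScale κ) (m : ℕ) {s R : ℝ} (hs : |s| ≤ R) :
    |κ m * s| ≤ κ m * R := by
  rw [abs_mul, abs_of_nonneg (h.nonneg m)]
  exact mul_le_mul_of_nonneg_left hs (h.nonneg m)

lemma IsLocalScale.tendsto_kS (h : IsLocalScale κ) (s t : ℝ) :
    Tendsto (fun m => κ m * kS m (κ m * s) (κ m * t)) atTop
      (𝓝 ((∫ v in (0 : ℝ)..Real.pi, Real.cos (v * (s - t))) / Real.pi)) := by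
  set R := max |s| |t|
  have hR : 0 ≤ R := (abs_nonneg s).trans (le_max_left _ _)
  refine (h.tendsto_sum (F := fun v => Real.cos (v * (s - t))) (by fun_prop)
    (T := fun m j => κ m * (hf j (κ m * s) * hf j (κ m * t) - hd j (κ m * s) * hI j (κ m * t)))
    (R := 56 * R ^ 2) ?_).congr fun m => by rw [kS, Finset.mul_sum]
  filter_upwards [h.mul_le_one R] with m hm j _
  have hκ := h.nonneg m
  have := kS_term_local j (h.abs_mul_le m (le_max_left |s| |t|))
    (h.abs_mul_le m (le_max_right |s| |t|)) hm
  rw [show κ m * om j * (s - t) = om j * (κ m * s - κ m * t) by ring, mul_assoc, ← mul_sub,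
    abs_mul, abs_of_nonneg hκ]
  calc _ ≤ κ m * (56 * (κ m * R) ^ 3 * hf j 0 ^ 2) := by gcongr
    _ = κ m ^ 2 * (56 * R ^ 2) * (κ m * hf j 0 ^ 2) * (κ m * R) := by ring
    _ ≤ _ := mul_le_of_le_one_right (by positivity) hm

lemma IsLocalScale.tendsto_kD (h : IsLocalScale κ) (s t : ℝ) :
    Tendsto (fun m => κ m ^ 2 * kD m (κ m * s) (κ m * t)) atTop
      (𝓝 ((∫ v in (0 : ℝ)..Real.pi, -(v * Real.sin (v * (s - t)))) / Real.pi)) := by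
  set R := max |s| |t|
  have hR : 0 ≤ R := (abs_nonneg s).trans (le_max_left _ _)
  refine (h.tendsto_sum (F := fun v => -(v * Real.sin (v * (s - t)))) (by fun_prop)
    (T := fun m j => κ m ^ 2 *
      (hd j (κ m * s) * hf j (κ m * t) - hf j (κ m * s) * hd j (κ m * t)))
    (R := 56 * R ^ 2) ?_).congr fun m => by rw [kD, Finset.mul_sum]
  filter_upwards [h.mul_le_one R, h.mul_le_one 1] with m hm hm1 j _
  have hκ := h.nonneg m
  have := kD_term_local j (h.abs_mul_le m (le_max_left |s| |t|))
    (h.abs_mul_le m (le_max_right |s| |t|)) hm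
  rw [show κ m ^ 2 * (hd j (κ m * s) * hf j (κ m * t) - hf j (κ m * s) * hd j (κ m * t)) -
    κ m * hf j 0 ^ 2 * -(κ m * om j * Real.sin (κ m * om j * (s - t))) =
    κ m ^ 2 * (hd j (κ m * s) * hf j (κ m * t) - hf j (κ m * s) * hd j (κ m * t) +
      hf j 0 ^ 2 * om j * Real.sin (om j * (κ m * s - κ m * t))) by ring_nf,
    abs_mul, abs_of_nonneg (sq_nonneg _)]
  calc _ ≤ κ m ^ 2 * (56 * (κ m * R) ^ 3 * hf j 0 ^ 2) := by gcongr
    _ = κ m ^ 2 * (56 * R ^ 2) * (κ m * hf j 0 ^ 2) * (κ m * R) * (κ m * 1) := by ring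
    _ ≤ κ m ^ 2 * (56 * R ^ 2) * (κ m * hf j 0 ^ 2) * (κ m * R) :=
      mul_le_of_le_one_right (by positivity) hm1
    _ ≤ _ := mul_le_of_le_one_right (by positivity) hm

lemma IsLocalScale.tendsto_kI (h : IsLocalScale κ) (s t : ℝ) :
    Tendsto (fun m => kI m (κ m * s) (κ m * t)) atTop
      (𝓝 ((∫ v in (0 : ℝ)..Real.pi, (s - t) * Real.sinc (v * (s - t))) / Real.pi)) := by
  set R := max |s| |t|
  have hR : 0 ≤ R := (abs_nonneg s).trans (le_max_left _ _)
  refine (h.tendsto_sum (F := fun v => (s - t) * Real.sinc (v * (s - t)))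
    (continuous_const.mul (Real.continuous_sinc.comp (by fun_prop)))
    (T := fun m j =>
      (hI j (κ m * s) * hf j (κ m * t) - hf j (κ m * s) * hI j (κ m * t)))
    (R := 56 * R ^ 3) ?_).congr fun m => by rw [kI]
  filter_upwards [h.mul_le_one R, h.mul_le_one 1] with m hm hm1 j _
  have hκ := h.nonneg m
  have ho := om_pos j
  have := kI_term_local j (h.abs_mul_le m (le_max_left |s| |t|))
    (h.abs_mul_le m (le_max_right |s| |t|)) hm
  have e : κ m * hf j 0 ^ 2 * ((s - t) * Real.sinc (κ m * om j * (s - t))) =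
      hf j 0 ^ 2 * Real.sin (om j * (κ m * s - κ m * t)) / om j := by
    rcases eq_or_ne (κ m * (s - t)) 0 with h0 | h0
    · rw [show κ m * hf j 0 ^ 2 * ((s - t) * Real.sinc (κ m * om j * (s - t))) =
        κ m * (s - t) * (hf j 0 ^ 2 * Real.sinc (κ m * om j * (s - t))) by ring, h0, ← mul_sub, h0]
      simp
    · rw [Real.sinc_of_ne_zero (by
        rw [show κ m * om j * (s - t) = om j * (κ m * (s - t)) by ring]; positivity),
        show κ m * om j * (s - t) = om j * (κ m * s - κ m * t) by ring]
      rw [← mul_sub]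
      obtain ⟨h1, h2⟩ := mul_ne_zero_iff.1 h0
      field_simp
  rw [e]
  calc _ ≤ (56 * (κ m * R) ^ 3 * hf j 0 ^ 2) := by gcongr
    _ = _ := by ring

end

section

open MeasureTheory Filter Topology

lemma Ssin_eq_sinc (u : ℝ) : Ssin u = Real.sinc (Real.pi * u) := by
  have := Real.pi_ne_zero
  simp [Ssin, Real.sinc_apply, this]

lemma Ssin_neg (u : ℝ) : Ssin (-u) = Ssin u := by
  rw [Ssin_eq_sinc, Ssin_eq_sinc, mul_neg, Real.sinc_neg]

lemma integral_cos_mul (a u : ℝ) : ∫ v in (0 : ℝ)..a, Real.cos (v * u) = a * Real.sinc (a * u) := by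
  rcases eq_or_ne u 0 with rfl | hu
  · simp
  rcases eq_or_ne a 0 with rfl | ha
  · simp
  rw [intervalIntegral.integral_comp_mul_right _ hu, Real.sinc_of_ne_zero (mul_ne_zero ha hu)]
  simp
  field_simp

lemma integral_cos_div_pi (u : ℝ) :
    (∫ v in (0 : ℝ)..Real.pi, Real.cos (v * u)) / Real.pi = Ssin u := by
  rw [integral_cos_mul, Ssin_eq_sinc]
  have := Real.pi_ne_zero
  field_simp

lemma hasDerivAt_Ssin (u : ℝ) : HasDerivAt Ssin
    ((∫ v in (0 : ℝ)..Real.pi, -(v * Real.sin (v * u))) / Real.pi) u := by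
  have e : Ssin = fun u => (∫ v in (0 : ℝ)..Real.pi, Real.cos (v * u)) / Real.pi :=
    funext fun u => (integral_cos_div_pi u).symm
  rw [e]
  refine HasDerivAt.div_const ?_ _
  refine (intervalIntegral.hasDerivAt_integral_of_dominated_loc_of_deriv_le
    (F := fun u v => Real.cos (v * u)) (F' := fun u v => -(v * Real.sin (v * u)))
    (bound := fun v => |v|) (x₀ := u) (s := Set.univ) univ_mem
    (Eventually.of_forall fun x => ?_) (Continuous.intervalIntegrable (by fun_prop) _ _) ?_
    (Eventually.of_forall fun v _ x _ => ?_)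
    (Continuous.intervalIntegrable (by fun_prop) _ _)
    (Eventually.of_forall fun v _ x _ => ?_)).2
  · exact Continuous.aestronglyMeasurable (by fun_prop)
  · exact Continuous.aestronglyMeasurable (by fun_prop)
  · rw [norm_neg]
    exact abs_mul_le_of_abs_le_one (Real.abs_sin_le_one _)
  · have := ((hasDerivAt_id x).const_mul v).cos
    refine this.congr_deriv ?_
    simp; ring

lemma integral_sinc_div_pi (u : ℝ) :
    (∫ v in (0 : ℝ)..Real.pi, u * Real.sinc (v * u)) / Real.pi = ∫ t in (0 : ℝ)..u, Ssin t := by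
  have h1 : ∀ t, Ssin t = (∫ v in (0 : ℝ)..Real.pi, Real.cos (v * t)) / Real.pi :=
    fun t => (integral_cos_div_pi t).symm
  simp only [h1, intervalIntegral.integral_div]
  congr 1
  rw [intervalIntegral_intervalIntegral_swap]
  · refine intervalIntegral.integral_congr fun v _ => ?_
    simp only [mul_comm v, integral_cos_mul]
  · refine (ContinuousOn.integrableOn_compact (isCompact_uIcc.prod isCompact_uIcc)
      (Continuous.continuousOn ?_)).mono_set
      (Set.prod_mono Set.uIoc_subset_uIcc Set.uIoc_subset_uIcc)
    simp only [Function.uncurry_def]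
    fun_prop

/-- Local convergence of a scaled matrix kernel to the sine kernel. -/
structure IsSineLimit (κ : ℕ → ℝ) (S D I : ℕ → ℝ → ℝ → ℝ) : Prop where
  tendsto_S : ∀ s t, Tendsto (fun m => κ m * S m (κ m * s) (κ m * t)) atTop (𝓝 (Ssin (s - t)))
  tendsto_D : ∀ s t, Tendsto (fun m => κ m ^ 2 * D m (κ m * s) (κ m * t)) atTop
    (𝓝 (deriv Ssin (s - t)))
  tendsto_I : ∀ s t, Tendsto (fun m => I m (κ m * s) (κ m * t)) atTop
    (𝓝 (∫ v in (0 : ℝ)..(s - t), Ssin v))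
  bound : ∀ R, ∃ C, ∀ᶠ m in atTop, ∀ s t, |s| ≤ R → |t| ≤ R →
    |κ m * S m (κ m * s) (κ m * t)| ≤ C ∧ |κ m ^ 2 * D m (κ m * s) (κ m * t)| ≤ C ∧
    |I m (κ m * s) (κ m * t)| ≤ C

variable {κ : ℕ → ℝ}

lemma sum_abs_le_of_le_hf_zero_sq {T : ℕ → ℝ} {m : ℕ} {C : ℝ} (hC : 0 ≤ C)
    (h : ∀ j < m, |T j| ≤ C * hf j 0 ^ 2) : |∑ j ∈ Finset.range m, T j| ≤ C * om m := by
  refine (Finset.abs_sum_le_sum_abs _ _).trans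
    ((Finset.sum_le_sum fun j hj => h j (Finset.mem_range.1 hj)).trans ?_)
  rw [← Finset.mul_sum]
  exact mul_le_mul_of_nonneg_left (sum_hf_zero_sq_le m) hC

lemma abs_mul_le_mul {a b c d : ℝ} (h1 : |a| ≤ c) (h2 : |b| ≤ d) : |a * b| ≤ c * d := by
  rw [abs_mul]
  exact mul_le_mul h1 h2 (abs_nonneg _) ((abs_nonneg _).trans h1)

/-- The even-size Gaussian orthogonal kernels converge to the sine kernel. -/
lemma isSineLimit_even (h : IsLocalScale κ) : IsSineLimit κ kS kD kI where
  tendsto_S s t := by simpa only [integral_cos_div_pi] using h.tendsto_kS s t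
  tendsto_D s t := by simpa only [← (hasDerivAt_Ssin _).deriv] using h.tendsto_kD s t
  tendsto_I s t := by simpa only [integral_sinc_div_pi] using h.tendsto_kI s t
  bound R := by
    refine ⟨64 * (1 + |R|), ?_⟩
    filter_upwards [h.le_four, h.mul_le_one R, h.mul_le_one 1] with m hm hmR hm1 s t hs ht
    have hκ := h.nonneg m
    have ho := om_pos m
    have hR : 0 ≤ R := (abs_nonneg s).trans hs
    have hx := (h.abs_mul_le m hs)
    have hy := (h.abs_mul_le m ht)
    rw [abs_of_nonneg hR, abs_mul, abs_mul, abs_of_nonneg hκ, abs_of_nonneg (sq_nonneg (κ m))]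
    have hom : ∀ j < m, om j ≤ om m := fun j hj => om_mono hj.le
    set x := κ m * s
    set y := κ m * t
    have f1 := fun j => abs_hf_le j (hx.trans hmR)
    have f2 := fun j => abs_hf_le j (hy.trans hmR)
    have d1 := fun j => abs_hd_le j (hx.trans hmR)
    have d2 := fun j => abs_hd_le j (hy.trans hmR)
    have i1 : ∀ j, |hI j x| ≤ 2 * |hf j 0| * (κ m * R) := fun j =>
      (abs_hI_le j (hx.trans hmR)).trans (by gcongr)
    have i2 : ∀ j, |hI j y| ≤ 2 * |hf j 0| * (κ m * R) := fun j =>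
      (abs_hI_le j (hy.trans hmR)).trans (by gcongr)
    refine ⟨?_, ?_, ?_⟩
    · have := sum_abs_le_of_le_hf_zero_sq (m := m) (C := 4 + 8 * R)
        (T := fun j => hf j x * hf j y - hd j x * hI j y) (by positivity) fun j hj => by
          refine (abs_sub _ _).trans
            ((add_le_add (abs_mul_le_mul (f1 j) (f2 j)) (abs_mul_le_mul (d1 j) (i2 j))).trans ?_)
          rw [← sq_abs (hf j 0)]
          have h5 : κ m * om j ≤ 4 := (mul_le_mul_of_nonneg_left (hom j hj) hκ).trans hm
          have h6 : 0 ≤ R * |hf j 0| ^ 2 := by positivity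
          nlinarith
      calc _ ≤ κ m * ((4 + 8 * R) * om m) := by gcongr; exact this
        _ = (4 + 8 * R) * (κ m * om m) := by ring
        _ ≤ (4 + 8 * R) * 4 := by gcongr
        _ ≤ _ := by linarith
    · have := sum_abs_le_of_le_hf_zero_sq (m := m) (C := 4 * om m)
        (T := fun j => hd j x * hf j y - hf j x * hd j y) (by positivity) fun j hj => by
          refine (abs_sub _ _).trans
            ((add_le_add (abs_mul_le_mul (d1 j) (f2 j)) (abs_mul_le_mul (f1 j) (d2 j))).trans ?_)
          rw [← sq_abs (hf j 0)]
          nlinarith [mul_le_mul_of_nonneg_right (hom j hj) (sq_nonneg |hf j 0|)]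
      calc _ ≤ κ m ^ 2 * (4 * om m * om m) := by gcongr; exact this
        _ = 4 * ((κ m * om m) * (κ m * om m)) := by ring
        _ ≤ 4 * (4 * 4) := by gcongr
        _ ≤ _ := by linarith
    · have := sum_abs_le_of_le_hf_zero_sq (m := m) (C := 8 * (κ m * R))
        (T := fun j => hI j x * hf j y - hf j x * hI j y) (by positivity) fun j hj => by
          refine (abs_sub _ _).trans
            ((add_le_add (abs_mul_le_mul (i1 j) (f2 j)) (abs_mul_le_mul (f1 j) (i2 j))).trans ?_)
          rw [← sq_abs (hf j 0)]
          exact le_of_eq (by ring)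
      refine this.trans ?_
      calc 8 * (κ m * R) * om m = 8 * R * (κ m * om m) := by ring
        _ ≤ 8 * R * 4 := by gcongr
        _ ≤ _ := by linarith

lemma IsSineLimit.of_close (h : IsLocalScale κ) {S D I S' D' I' : ℕ → ℝ → ℝ → ℝ}
    (hk : IsSineLimit κ S D I) {C : ℝ} (hC : 0 ≤ C)
    (hS : ∀ m x y, |x| ≤ 1 → |y| ≤ 1 → |S' m x y - S m x y| ≤ C)
    (hD : ∀ m x y, |x| ≤ 1 → |y| ≤ 1 → |D' m x y - D m x y| ≤ C)
    (hI : ∀ m x y, |x| ≤ 1 → |y| ≤ 1 → |I' m x y - I m x y| ≤ C * (|x| + |y|)) :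
    IsSineLimit κ S' D' I' := by
  have key : ∀ R, ∀ᶠ m in atTop, ∀ s t, |s| ≤ R → |t| ≤ R →
      |κ m * S' m (κ m * s) (κ m * t) - κ m * S m (κ m * s) (κ m * t)| ≤ κ m * (C * (1 + 2 * R)) ∧
      |κ m ^ 2 * D' m (κ m * s) (κ m * t) - κ m ^ 2 * D m (κ m * s) (κ m * t)| ≤
        κ m * (C * (1 + 2 * R)) ∧
      |I' m (κ m * s) (κ m * t) - I m (κ m * s) (κ m * t)| ≤ κ m * (C * (1 + 2 * R)) := fun R => by
    filter_upwards [h.mul_le_one R, h.mul_le_one 1] with m hmR hm1 s t hs ht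
    have hκ := h.nonneg m
    have hR : 0 ≤ R := (abs_nonneg s).trans hs
    have hx := (h.abs_mul_le m hs)
    have hy := (h.abs_mul_le m ht)
    have hx1 := hx.trans hmR
    have hy1 := hy.trans hmR
    rw [← mul_sub, ← mul_sub, abs_mul, abs_mul, abs_of_nonneg hκ, abs_of_nonneg (sq_nonneg (κ m))]
    refine ⟨?_, ?_, ?_⟩
    · have := hS m _ _ hx1 hy1
      gcongr
      exact this.trans (le_mul_of_one_le_right hC (by linarith))
    · have h1 := hD m _ _ hx1 hy1
      rw [sq, mul_assoc]
      refine mul_le_mul_of_nonneg_left ?_ hκ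
      rw [mul_one] at hm1
      calc _ ≤ 1 * C := by gcongr
        _ ≤ _ := by rw [one_mul]; exact (le_mul_of_one_le_right hC (by linarith))
    · refine (hI m _ _ hx1 hy1).trans ?_
      calc C * (|κ m * s| + |κ m * t|) ≤ C * (κ m * R + κ m * R) := by gcongr
        _ ≤ _ := by nlinarith [mul_nonneg hC hκ]
  have hz : ∀ R, Tendsto (fun m => κ m * (C * (1 + 2 * R))) atTop (𝓝 0) := fun R => by
    simpa using h.tendsto_zero.mul_const (C * (1 + 2 * R))
  have comb : ∀ {u v : ℕ → ℝ} {L R : ℝ}, Tendsto u atTop (𝓝 L) →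
      (∀ᶠ m in atTop, |v m - u m| ≤ κ m * (C * (1 + 2 * R))) → Tendsto v atTop (𝓝 L) :=
    fun {u v L R} hu hv => by
      have := hu.add (squeeze_zero_norm' hv (hz R))
      simpa using this
  have le1 : ∀ s t : ℝ, |s| ≤ max |s| |t| := fun s t => le_max_left _ _
  have le2 : ∀ s t : ℝ, |t| ≤ max |s| |t| := fun s t => le_max_right _ _
  refine ⟨fun s t => ?_, fun s t => ?_, fun s t => ?_, fun R => ?_⟩
  · exact comb (hk.tendsto_S s t)
      ((key (max |s| |t|)).mono fun m hm => (hm s t (le1 s t) (le2 s t)).1)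
  · exact comb (hk.tendsto_D s t)
      ((key (max |s| |t|)).mono fun m hm => (hm s t (le1 s t) (le2 s t)).2.1)
  · exact comb (hk.tendsto_I s t)
      ((key (max |s| |t|)).mono fun m hm => (hm s t (le1 s t) (le2 s t)).2.2)
  · obtain ⟨C', hC'⟩ := hk.bound R
    refine ⟨C' + 1, ?_⟩
    filter_upwards [hC', key R, (hz R).eventually_lt_const one_pos] with m h1 h2 h3 s t hs ht
    obtain ⟨a1, a2, a3⟩ := h1 s t hs ht
    obtain ⟨b1, b2, b3⟩ := h2 s t hs ht
    have tri : ∀ {p q a b : ℝ}, |q| ≤ a → |p - q| ≤ b → b < 1 → |p| ≤ a + 1 :=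
      fun {p q a b} h1 h2 h3 => by
        have := abs_sub_abs_le_abs_sub p q
        linarith
    exact ⟨tri a1 b1 h3, tri a2 b2 h3, tri a3 b3 h3⟩

lemma alternating_sum_mem (b : ℕ → ℝ) (hb : Antitone b) (h0 : ∀ j, 0 ≤ b j) (m : ℕ) :
    0 ≤ ∑ j ∈ Finset.range m, (-1) ^ j * b j ∧ ∑ j ∈ Finset.range m, (-1) ^ j * b j ≤ b 0 := by
  induction m generalizing b with
  | zero => simpa using h0 0
  | succ m ih =>
    have := ih (fun j => b (j + 1)) (fun i j hij => hb (by omega)) fun j => h0 _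
    have e : ∑ j ∈ Finset.range (m + 1), (-1) ^ j * b j =
        b 0 - ∑ j ∈ Finset.range m, (-1) ^ j * b (j + 1) := by
      rw [Finset.sum_range_succ', sub_eq_add_neg, ← Finset.sum_neg_distrib, add_comm]
      simp [pow_succ]
    rw [e]
    have := hb (Nat.zero_le 1)
    constructor <;> simp only [zero_add] at * <;> linarith

lemma hf_zero_sq_antitone : Antitone fun j => hf j 0 ^ 2 := by
  refine antitone_nat_of_succ_le fun j => ?_
  rw [hf_zero_sq, hf_zero_sq, wal_succ]
  have := wal_pos j
  gcongr
  refine mul_le_of_le_one_right this.le ?_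
  rw [div_le_one (by positivity)]
  linarith

lemma hf_zero_sq_mul_om_le (j : ℕ) : hf j 0 ^ 2 * om j ≤ 1 := by
  have h := hf_zero_sq_le j
  rw [om_succ_sub, le_div_iff₀ (by linarith [om_pos j, om_pos (j + 1)])] at h
  have := om_mono (Nat.le_succ j)
  simp only [Nat.succ_eq_add_one] at this
  nlinarith [sq_nonneg (hf j 0)]

lemma sqrt_pi_bounds : 1 ≤ √Real.pi ∧ √Real.pi ≤ 2 := by
  constructor
  · rw [Real.one_le_sqrt]; linarith [Real.pi_gt_three]
  · rw [Real.sqrt_le_left (by norm_num)]; linarith [Real.pi_lt_four]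

lemma abs_hc (m : ℕ) : |hc m| = 2 * √Real.pi * |hf m 0| := by
  rw [hc_eq, abs_mul, abs_mul, abs_mul, abs_pow, abs_neg, abs_one, one_pow, one_mul,
    abs_of_nonneg (Real.sqrt_nonneg _), abs_two]

lemma abs_hf_div_hc_le (m : ℕ) {x : ℝ} (hx : |x| ≤ 1) : |hf m x / hc m| ≤ 1 := by
  rw [abs_div, div_le_one (abs_pos.2 (hc_ne_zero m)), abs_hc]
  refine (abs_hf_le m hx).trans ?_
  nlinarith [sqrt_pi_bounds.1, abs_nonneg (hf m 0)]

lemma abs_hI_div_hc_le (m : ℕ) {x : ℝ} (hx : |x| ≤ 1) : |hI m x / hc m| ≤ |x| := by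
  rw [abs_div, div_le_iff₀ (abs_pos.2 (hc_ne_zero m)), abs_hc]
  refine (abs_hI_le m hx).trans ?_
  have := mul_le_mul_of_nonneg_right sqrt_pi_bounds.1 (mul_nonneg (abs_nonneg x) (abs_nonneg (hf m 0)))
  linarith

lemma abs_sum_hc_mul_hd_le (m : ℕ) {x : ℝ} (hx : |x| ≤ 1) :
    |∑ j ∈ Finset.range m, hc j * hd j x| ≤ 6 := by
  rw [sum_hc_mul_hd, abs_mul, abs_neg, abs_div, abs_hc, abs_two]
  have h1 : |x / 2 * hf m x + hd m x| ≤ |hf m 0| * (1 + om m) := by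
    refine (abs_add_le _ _).trans ?_
    rw [abs_mul, abs_div, abs_two]
    have := abs_hf_le m hx
    have := abs_hd_le m hx
    nlinarith [abs_nonneg x, abs_nonneg (hf m x), mul_le_of_le_one_left (abs_nonneg (hf m x)) hx]
  have h2 := hf_zero_sq_mul_om_le m
  have h3 : hf m 0 ^ 2 ≤ 2 := by nlinarith [half_le_om m, sq_nonneg (hf m 0)]
  calc 2 * √Real.pi * |hf m 0| / 2 * |x / 2 * hf m x + hd m x|
      ≤ 2 * √Real.pi * |hf m 0| / 2 * (|hf m 0| * (1 + om m)) := by gcongr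
    _ = √Real.pi * (hf m 0 ^ 2 + hf m 0 ^ 2 * om m) := by rw [← sq_abs (hf m 0)]; ring
    _ ≤ 2 * (2 + 1) := by
        have := om_pos m
        have := sqrt_pi_bounds.2
        gcongr
    _ = 6 := by norm_num

lemma abs_sum_hc_mul_hf_le (m : ℕ) {x : ℝ} (hx : |x| ≤ 1) :
    |∑ j ∈ Finset.range m, hc j * hf j x| ≤ 14 := by
  have hd : ∀ x, HasDerivAt (fun x => ∑ j ∈ Finset.range m, hc j * hf j x)
      (∑ j ∈ Finset.range m, hc j * hd j x) x := fun x =>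
    HasDerivAt.fun_sum fun j _ => (hasDerivAt_hf j x).const_mul (hc j)
  have h1 := abs_sub_le_of_deriv hd x hx fun y hy => abs_sum_hc_mul_hd_le m hy
  have e : ∑ j ∈ Finset.range m, hc j * hf j 0 =
      2 * √Real.pi * ∑ j ∈ Finset.range m, (-1) ^ j * hf j 0 ^ 2 := by
    rw [Finset.mul_sum]
    refine Finset.sum_congr rfl fun j _ => ?_
    rw [hc_eq]; ring
  have h2 := alternating_sum_mem _ hf_zero_sq_antitone (fun j => sq_nonneg _) m
  have h3 : |∑ j ∈ Finset.range m, hc j * hf j 0| ≤ 8 := by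
    have h4 : hf 0 0 ^ 2 ≤ 2 := by
      nlinarith [half_le_om 0, sq_nonneg (hf 0 0), hf_zero_sq_mul_om_le 0]
    rw [e, abs_of_nonneg (mul_nonneg (by positivity) h2.1)]
    calc _ ≤ 2 * 2 * (2 : ℝ) := by
          have h5 := h2.1
          have h6 := sqrt_pi_bounds.2
          have h7 := h2.2.trans h4
          gcongr
      _ = 8 := by norm_num
  have h4 := abs_sub_abs_le_abs_sub (∑ j ∈ Finset.range m, hc j * hf j x)
    (∑ j ∈ Finset.range m, hc j * hf j 0)
  nlinarith [abs_nonneg x]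

/-- The odd-size Gaussian orthogonal kernels converge to the sine kernel. -/
lemma isSineLimit_odd (h : IsLocalScale κ) : IsSineLimit κ oS oD oI := by
  refine (isSineLimit_even h).of_close h (C := 40) (by norm_num) (fun m x y hx hy => ?_)
    (fun m x y hx hy => ?_) fun m x y hx hy => ?_
  · have e : oS m x y - kS m x y = hf m x / hc m - hf m x / hc m *
        ∑ j ∈ Finset.range m, hc j * hf j y +
        (∑ j ∈ Finset.range m, hc j * hd j x) * (hI m y / hc m) := by
      rw [oS, kS, Finset.mul_sum, Finset.sum_mul, add_sub_right_comm, ← Finset.sum_sub_distrib,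
        sub_add_eq_add_sub, add_sub_assoc, ← Finset.sum_sub_distrib, add_comm]
      congr 1
      refine Finset.sum_congr rfl fun j _ => ?_
      simp only [gf, gI]
      ring
    rw [e]
    have h1 := abs_hf_div_hc_le m hx
    have h2 := abs_mul_le_mul h1 (abs_sum_hc_mul_hf_le m hy)
    have h3 := abs_mul_le_mul (abs_sum_hc_mul_hd_le m hx) (abs_hI_div_hc_le m hy)
    have h4 := abs_add_le (hf m x / hc m - hf m x / hc m * ∑ j ∈ Finset.range m, hc j * hf j y)
      ((∑ j ∈ Finset.range m, hc j * hd j x) * (hI m y / hc m))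
    have h5 := abs_sub (hf m x / hc m) (hf m x / hc m * ∑ j ∈ Finset.range m, hc j * hf j y)
    linarith
  · have e : oD m x y - kD m x y = hf m x / hc m * (∑ j ∈ Finset.range m, hc j * hd j y) -
        hf m y / hc m * ∑ j ∈ Finset.range m, hc j * hd j x := by
      rw [oD, kD, Finset.mul_sum, Finset.mul_sum, ← Finset.sum_sub_distrib,
        ← Finset.sum_sub_distrib]
      refine Finset.sum_congr rfl fun j _ => ?_
      simp only [gf]
      ring
    rw [e]
    have h1 := abs_mul_le_mul (abs_hf_div_hc_le m hx) (abs_sum_hc_mul_hd_le m hy)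
    have h2 := abs_mul_le_mul (abs_hf_div_hc_le m hy) (abs_sum_hc_mul_hd_le m hx)
    refine (abs_sub _ _).trans ?_
    linarith
  · have e : oI m x y - kI m x y = hI m x / hc m - hI m y / hc m -
        (hI m x / hc m * (∑ j ∈ Finset.range m, hc j * hf j y) -
        hI m y / hc m * ∑ j ∈ Finset.range m, hc j * hf j x) := by
      rw [oI, kI, Finset.mul_sum, Finset.mul_sum, add_sub_right_comm, ← Finset.sum_sub_distrib,
        ← Finset.sum_sub_distrib, ← sub_div, add_comm, sub_eq_add_neg _ (Finset.sum _ _),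
        ← Finset.sum_neg_distrib]
      congr 1
      refine Finset.sum_congr rfl fun j _ => ?_
      simp only [gI]
      ring
    rw [e]
    have h1 := abs_mul_le_mul (abs_hI_div_hc_le m hx) (abs_sum_hc_mul_hf_le m hy)
    have h2 := abs_mul_le_mul (abs_hI_div_hc_le m hy) (abs_sum_hc_mul_hf_le m hx)
    refine (abs_sub _ _).trans ?_
    have h3 := abs_sub (hI m x / hc m) (hI m y / hc m)
    have h4 := abs_sub (hI m x / hc m * (∑ j ∈ Finset.range m, hc j * hf j y))
      (hI m y / hc m * ∑ j ∈ Finset.range m, hc j * hf j x)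
    have h5 := abs_hI_div_hc_le m hx
    have h6 := abs_hI_div_hc_le m hy
    linarith [abs_nonneg x, abs_nonneg y]

end

section

open MeasureTheory Filter Topology

lemma continuous_vand (N : ℕ) : Continuous (vand 1 N) := by
  refine Continuous.congr (Continuous.abs (Continuous.matrix_det (continuous_matrix fun i j => ?_)))
    fun x => (vand_one_eq N x).symm
  simp only [Matrix.vandermonde_apply]
  fun_prop

lemma vand_nonneg (N : ℕ) (x : Fin N → ℝ) : 0 ≤ vand 1 N x := by
  rw [vand_one_eq]; exact abs_nonneg _

lemma continuous_goe (N : ℕ) : Continuous (goe N) :=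
  (continuous_vand N).mul (by fun_prop)

lemma goe_nonneg (N : ℕ) (x : Fin N → ℝ) : 0 ≤ goe N x :=
  mul_nonneg (vand_nonneg N x) (Finset.prod_nonneg fun _ _ => (Real.exp_pos _).le)

lemma continuous_glue (n k : ℕ) :
    Continuous fun p : (Fin n → ℝ) × (Fin k → ℝ) => glue n k p.1 p.2 := by
  refine continuous_pi fun i => ?_
  by_cases h : (i : ℕ) < n
  · simp only [glue, h, dite_true]; fun_prop
  · simp only [glue, h, dite_false]; fun_prop

/-- The scaled correlation function of the Gaussian orthogonal ensemble with `k + n` particles. -/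
noncomputable def goeLocal (n k : ℕ) (t : Fin n → ℝ) : ℝ :=
  (Real.pi / √(k + n : ℕ)) ^ n * (((k + n).factorial : ℝ) / k.factorial *
    (∫ z, goe (k + n) z)⁻¹ *
      ∫ y, goe (k + n) (glue n k (fun i => Real.pi / √(k + n : ℕ) * t i) y))

lemma goeLocal_nonneg (n k : ℕ) (t : Fin n → ℝ) : 0 ≤ goeLocal n k t := by
  have h1 : 0 ≤ ∫ z, goe (k + n) z := integral_nonneg fun z => goe_nonneg _ z
  have h2 : 0 ≤ ∫ y, goe (k + n) (glue n k (fun i => Real.pi / √(k + n : ℕ) * t i) y) :=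
    integral_nonneg fun z => goe_nonneg _ _
  unfold goeLocal
  positivity

lemma stronglyMeasurable_goeLocal (n k : ℕ) : StronglyMeasurable (goeLocal n k) := by
  unfold goeLocal
  refine StronglyMeasurable.const_mul (StronglyMeasurable.const_mul ?_ _) _
  have hc : Continuous (fun p : (Fin n → ℝ) × (Fin k → ℝ) =>
      goe (k + n) (glue n k (fun i => Real.pi / √(k + n : ℕ) * p.1 i) p.2)) :=
    (continuous_goe _).comp ((continuous_glue n k).comp
      (g := fun p : (Fin n → ℝ) × (Fin k → ℝ) => glue n k p.1 p.2)
      (f := fun p : (Fin n → ℝ) × (Fin k → ℝ) => (fun i => Real.pi / √(k + n : ℕ) * p.1 i, p.2))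
      (by fun_prop))
  exact hc.stronglyMeasurable.integral_prod_right

lemma sign_pos_mul {c : ℝ} (hc : 0 < c) (u : ℝ) : Real.sign (c * u) = Real.sign u := by
  rcases lt_trichotomy u 0 with h | rfl | h
  · rw [Real.sign_of_neg h, Real.sign_of_neg (mul_neg_of_pos_of_neg hc h)]
  · rw [mul_zero]
  · rw [Real.sign_of_pos h, Real.sign_of_pos (mul_pos hc h)]

/-- Rescaling the points rescales the blocks. -/
lemma det_kerBlock_scale {n : ℕ} (S D I : ℝ → ℝ → ℝ) {κ : ℝ} (hκ : 0 < κ) (t : Fin n → ℝ) :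
    (κ ^ n) ^ 2 * (kerBlock S D I fun i => κ * t i).det =
      (kerBlock (fun s t => κ * S (κ * s) (κ * t)) (fun s t => κ ^ 2 * D (κ * s) (κ * t))
        (fun s t => I (κ * s) (κ * t)) t).det := by
  have e : kerBlock (fun s t => κ * S (κ * s) (κ * t)) (fun s t => κ ^ 2 * D (κ * s) (κ * t))
        (fun s t => I (κ * s) (κ * t)) t =
      Matrix.diagonal (Sum.elim (fun _ => κ) fun _ => 1) * (kerBlock S D I fun i => κ * t i) *
        Matrix.diagonal (Sum.elim (fun _ => 1) fun _ => κ) := by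
    ext a b
    rw [Matrix.mul_diagonal, Matrix.diagonal_mul]
    rcases a with a | a <;> rcases b with b | b <;>
      simp [kerBlock, ← mul_sub, sign_pos_mul hκ] <;> ring
  rw [e, Matrix.det_mul, Matrix.det_mul, Matrix.det_diagonal, Matrix.det_diagonal]
  simp
  ring

/-- The limiting scaled correlation function. -/
noncomputable def sineLimit {n : ℕ} (t : Fin n → ℝ) : ℝ :=
  √(kerBlock (fun s t => Ssin (s - t)) (fun s t => deriv Ssin (s - t))
    (fun s t => ∫ v in (0 : ℝ)..(s - t), Ssin v) t).det

lemma sineLimit_eq {n : ℕ} (t : Fin n → ℝ) : sineLimit t =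
    √(Matrix.det (Matrix.of fun p q : Fin n × Fin 2 => K1sine (t p.1) (t q.1) p.2 q.2)) := by
  let e : Fin n × Fin 2 ≃ Fin n ⊕ Fin n :=
    { toFun := fun p => if p.2 = 0 then Sum.inl p.1 else Sum.inr p.1
      invFun := Sum.elim (fun i => (i, 0)) fun i => (i, 1)
      left_inv := fun p => by
        obtain ⟨i, j⟩ := p
        fin_cases j <;> simp
      right_inv := fun p => by rcases p with i | i <;> simp }
  rw [sineLimit, ← Matrix.det_submatrix_equiv_self e]
  congr 2
  ext p q
  obtain ⟨i, a⟩ := p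
  obtain ⟨j, b⟩ := q
  fin_cases a <;> fin_cases b <;> simp [e, kerBlock, K1sine]
  rw [← Ssin_neg, neg_sub]

section
variable {κ : ℕ → ℝ} {S D I : ℕ → ℝ → ℝ → ℝ} {n : ℕ}

lemma IsSineLimit.tendsto_det (hk : IsSineLimit κ S D I) (t : Fin n → ℝ) :
    Tendsto (fun m => √(kerBlock (fun s t => κ m * S m (κ m * s) (κ m * t))
      (fun s t => κ m ^ 2 * D m (κ m * s) (κ m * t))
      (fun s t => I m (κ m * s) (κ m * t)) t).det) atTop (𝓝 (sineLimit t)) := by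
  refine Tendsto.sqrt ?_
  refine ((continuous_id.matrix_det).tendsto _).comp
    (tendsto_pi_nhds.2 fun a => tendsto_pi_nhds.2 fun b => ?_)
  rcases a with a | a <;> rcases b with b | b <;>
    simp only [Matrix.fromBlocks_apply₁₁, Matrix.fromBlocks_apply₁₂,
      Matrix.fromBlocks_apply₂₁, Matrix.fromBlocks_apply₂₂, Matrix.of_apply]
  · exact hk.tendsto_S _ _
  · exact hk.tendsto_D _ _
  · exact (hk.tendsto_I _ _).sub_const _
  · exact hk.tendsto_S _ _

lemma IsSineLimit.bound_det (hk : IsSineLimit κ S D I) (R : ℝ) :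
    ∃ C, ∀ᶠ m in atTop, ∀ t : Fin n → ℝ, (∀ i, |t i| ≤ R) →
      √(kerBlock (fun s t => κ m * S m (κ m * s) (κ m * t))
      (fun s t => κ m ^ 2 * D m (κ m * s) (κ m * t))
      (fun s t => I m (κ m * s) (κ m * t)) t).det ≤ C := by
  obtain ⟨C, hC⟩ := hk.bound R
  refine ⟨√((Fintype.card (Fin n ⊕ Fin n)).factorial • (C + 1) ^ Fintype.card (Fin n ⊕ Fin n)), ?_⟩
  filter_upwards [hC] with m hm t ht
  refine Real.sqrt_le_sqrt ((le_abs_self _).trans (Matrix.det_le (abv := AbsoluteValue.abs) ?_))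
  intro a b
  have hs : ∀ u : ℝ, |Real.sign u / 2| ≤ 1 := fun u => by
    rcases Real.sign_apply_eq u with h | h | h <;> rw [h] <;> norm_num
  rw [AbsoluteValue.abs_apply]
  rcases a with a | a <;> rcases b with b | b <;>
    simp only [kerBlock, Matrix.fromBlocks_apply₁₁, Matrix.fromBlocks_apply₁₂,
      Matrix.fromBlocks_apply₂₁, Matrix.fromBlocks_apply₂₂, Matrix.of_apply]
  · linarith [(hm _ _ (ht a) (ht b)).1]
  · linarith [(hm _ _ (ht a) (ht b)).2.1]
  · refine (abs_sub _ _).trans (add_le_add (hm _ _ (ht a) (ht b)).2.2 (hs _))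
  · linarith [(hm _ _ (ht b) (ht a)).1]

end

lemma tendsto_sqrt_ratio {c : ℝ} (hc : 0 ≤ c) :
    Tendsto (fun m : ℕ => √((2 * m + 1 / 2) / (2 * m + c))) atTop (𝓝 1) := by
  have h : Tendsto (fun m : ℕ => (1 : ℝ) + (1 / 2 - c) / (2 * m + c)) atTop (𝓝 (1 + 0)) := by
    refine tendsto_const_nhds.add (Tendsto.div_atTop tendsto_const_nhds ?_)
    exact tendsto_atTop_add_const_right _ _
      (Tendsto.const_mul_atTop two_pos tendsto_natCast_atTop_atTop)
  have h2 := h.sqrt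
  simp only [add_zero, Real.sqrt_one] at h2
  refine h2.congr' ?_
  filter_upwards [eventually_gt_atTop 0] with m hm
  have : (0 : ℝ) < m := by exact_mod_cast hm
  congr 1
  field_simp
  ring

lemma isLocalScale_even : IsLocalScale fun m => Real.pi / √(2 * m : ℕ) where
  nonneg m := by positivity
  lim := by
    have := (tendsto_sqrt_ratio le_rfl).const_mul Real.pi
    rw [mul_one] at this
    refine this.congr fun m => ?_
    rw [Real.sqrt_div (by positivity), add_zero, om]
    push_cast
    ring

lemma isLocalScale_odd : IsLocalScale fun m => Real.pi / √(2 * m + 1 : ℕ) where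
  nonneg m := by positivity
  lim := by
    have := (tendsto_sqrt_ratio zero_le_one).const_mul Real.pi
    rw [mul_one] at this
    refine this.congr fun m => ?_
    rw [Real.sqrt_div (by positivity), om]
    push_cast
    ring

lemma goeLocal_eq {n k N : ℕ} (hN : k + n = N) (hN0 : 0 < N) {S D I : ℝ → ℝ → ℝ}
    (h : ∀ x : Fin n → ℝ, (((k + n).factorial : ℝ) / k.factorial * (∫ z, goe (k + n) z)⁻¹ *
      ∫ y, goe (k + n) (glue n k x y)) ^ 2 = (kerBlock S D I x).det) (t : Fin n → ℝ) :
    goeLocal n k t = √(kerBlock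
      (fun s t => Real.pi / √(N : ℕ) * S (Real.pi / √(N : ℕ) * s) (Real.pi / √(N : ℕ) * t))
      (fun s t => (Real.pi / √(N : ℕ)) ^ 2 * D (Real.pi / √(N : ℕ) * s) (Real.pi / √(N : ℕ) * t))
      (fun s t => I (Real.pi / √(N : ℕ) * s) (Real.pi / √(N : ℕ) * t)) t).det := by
  subst hN
  have hκ : 0 < Real.pi / √(k + n : ℕ) := by
    have : (0 : ℝ) < (k + n : ℕ) := by exact_mod_cast hN0
    positivity
  rw [← det_kerBlock_scale S D I hκ, ← h, ← mul_pow, ← goeLocal, Real.sqrt_sq (goeLocal_nonneg _ _ _)]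

lemma eventually_of_parity {n : ℕ} {P : ℕ → Prop}
    (h0 : ∀ᶠ m in atTop, ∀ k, k + n = 2 * m → P k)
    (h1 : ∀ᶠ m in atTop, ∀ k, k + n = 2 * m + 1 → P k) : ∀ᶠ k in atTop, P k := by
  obtain ⟨a, ha⟩ := eventually_atTop.1 h0
  obtain ⟨b, hb⟩ := eventually_atTop.1 h1
  refine eventually_atTop.2 ⟨2 * a + 2 * b + 1, fun k hk => ?_⟩
  obtain ⟨m, hm | hm⟩ := Nat.even_or_odd' (k + n)
  · exact ha m (by omega) k hm
  · exact hb m (by omega) k hm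

lemma integral_goe_pos (n k : ℕ) : 0 < ∫ z, goe (k + n) z := by
  refine lt_of_le_of_ne (integral_nonneg fun z => goe_nonneg _ z) (Ne.symm ?_)
  obtain ⟨m, hm | hm⟩ := Nat.even_or_odd' (k + n)
  · exact (goe_correlation_even hm 0).1
  · exact (goe_correlation_odd hm 0).1

lemma tendsto_goeLocal {n : ℕ} (t : Fin n → ℝ) :
    Tendsto (fun k => goeLocal n k t) atTop (𝓝 (sineLimit t)) := by
  rw [Metric.tendsto_nhds]
  intro ε hε
  refine eventually_of_parity (n := n) ?_ ?_
  · filter_upwards [eventually_gt_atTop 0, Metric.tendsto_nhds.1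
      ((isSineLimit_even isLocalScale_even).tendsto_det t) ε hε] with m hm h k hk
    rw [goeLocal_eq hk (by omega) fun x => (goe_correlation_even hk x).2]
    exact h
  · filter_upwards [Metric.tendsto_nhds.1
      ((isSineLimit_odd isLocalScale_odd).tendsto_det t) ε hε] with m h k hk
    rw [goeLocal_eq hk (by omega) fun x => (goe_correlation_odd hk x).2]
    exact h

lemma exists_goeLocal_le (n : ℕ) (R : ℝ) : ∃ C, 0 ≤ C ∧ ∀ᶠ k in atTop, ∀ t : Fin n → ℝ,
    (∀ i, |t i| ≤ R) → goeLocal n k t ≤ C := by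
  obtain ⟨C, hC⟩ := (isSineLimit_even isLocalScale_even).bound_det (n := n) R
  obtain ⟨C', hC'⟩ := (isSineLimit_odd isLocalScale_odd).bound_det (n := n) R
  refine ⟨max 0 (max C C'), le_max_left _ _, eventually_of_parity (n := n) ?_ ?_⟩
  · filter_upwards [eventually_gt_atTop 0, hC] with m hm h k hk t ht
    rw [goeLocal_eq hk (by omega) fun x => (goe_correlation_even hk x).2]
    exact (h t ht).trans ((le_max_left _ _).trans (le_max_right _ _))
  · filter_upwards [hC'] with m h k hk t ht
    rw [goeLocal_eq hk (by omega) fun x => (goe_correlation_odd hk x).2]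
    exact (h t ht).trans ((le_max_right _ _).trans (le_max_right _ _))

/-- Local sine-kernel limit for the Gaussian orthogonal ensemble. -/
lemma tendsto_integral_goeLocal {n : ℕ} {f : (Fin n → ℝ) → ℝ} (hf : Continuous f)
    (hsupp : HasCompactSupport f) :
    Tendsto (fun k => ∫ t, f t * goeLocal n k t) atTop (𝓝 (∫ t, f t * sineLimit t)) := by
  obtain ⟨R, hR⟩ := hsupp.isCompact.isBounded.exists_norm_le
  obtain ⟨C, hC0, hC⟩ := exists_goeLocal_le n R
  refine tendsto_integral_filter_of_dominated_convergence (fun t => |f t| * C)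
    (Eventually.of_forall fun k => (hf.stronglyMeasurable.mul
      (stronglyMeasurable_goeLocal n k)).aestronglyMeasurable) ?_
    ((hf.abs.integrable_of_hasCompactSupport
      (hsupp.comp_left (g := fun x : ℝ => |x|) abs_zero)).mul_const C)
    (Eventually.of_forall fun t => (tendsto_goeLocal t).const_mul _)
  filter_upwards [hC] with k hk
  refine Eventually.of_forall fun t => ?_
  rw [norm_mul, Real.norm_eq_abs, Real.norm_of_nonneg (goeLocal_nonneg _ _ _)]
  by_cases ht : t ∈ tsupport f
  · gcongr
    exact hk t fun i => (norm_le_pi_norm t i).trans (hR t ht)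
  · simp [image_eq_zero_of_notMem_tsupport ht]

end

section

open MeasureTheory Filter Topology

/-- The first `n` coordinates of a vector of length `k + n`. -/
def front (n k : ℕ) (z : Fin (k + n) → ℝ) : Fin n → ℝ := fun i => z ⟨i, by omega⟩

lemma measurable_front (n k : ℕ) : Measurable (front n k) :=
  measurable_pi_lambda _ fun _ => measurable_pi_apply _

lemma front_smul (n k : ℕ) (c : ℝ) (z : Fin (k + n) → ℝ) : front n k (c • z) = c • front n k z :=
  rfl

lemma front_glue (n k : ℕ) (x : Fin n → ℝ) (y : Fin k → ℝ) : front n k (glue n k x y) = x := by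
  ext i
  simp [front, glue]

/-- `glue` as a measurable equivalence. -/
noncomputable def glueEquiv (n k : ℕ) : (Fin n → ℝ) × (Fin k → ℝ) ≃ᵐ (Fin (k + n) → ℝ) :=
  (MeasurableEquiv.sumPiEquivProdPi fun _ : Fin n ⊕ Fin k => ℝ).symm.trans
    (MeasurableEquiv.piCongrLeft (fun _ => ℝ)
      (finSumFinEquiv.trans (finCongr (Nat.add_comm n k))))

lemma glueEquiv_apply (n k : ℕ) (p : (Fin n → ℝ) × (Fin k → ℝ)) :
    glueEquiv n k p = glue n k p.1 p.2 := by
  ext i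
  obtain ⟨j, rfl⟩ := (finSumFinEquiv.trans (finCongr (Nat.add_comm n k))).surjective i
  simp only [glueEquiv, MeasurableEquiv.trans_apply]
  rw [MeasurableEquiv.piCongrLeft_apply_apply]
  rcases j with j | j <;> simp [glue, MeasurableEquiv.sumPiEquivProdPi, Equiv.sumPiEquivProdPi]

lemma measurePreserving_glueEquiv (n k : ℕ) :
    MeasurePreserving (glueEquiv n k) volume volume :=
  (volume_measurePreserving_piCongrLeft (fun _ => ℝ) _).comp
    (volume_measurePreserving_sumPiEquivProdPi_symm _)

lemma integral_mul_glue (n k : ℕ) {a : ℝ} (ha : 0 < a) {Ψ : (Fin (k + n) → ℝ) → ℝ}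
    (hΨ : Integrable Ψ) {g : (Fin n → ℝ) → ℝ} (hg : Measurable g) {C : ℝ} (hC : ∀ t, |g t| ≤ C) :
    ∫ t, g t * (a ^ n * ∫ y, Ψ (glue n k (a • t) y)) =
      ∫ z, g (a⁻¹ • front n k z) * Ψ z := by
  have hint : Integrable fun z => g (a⁻¹ • front n k z) * Ψ z := by
    refine hΨ.bdd_mul (c := C) ?_ (Eventually.of_forall fun z => hC _)
    exact (hg.comp ((measurable_front n k).const_smul a⁻¹)).aestronglyMeasurable
  have hmp := measurePreserving_glueEquiv n k
  rw [← hmp.integral_comp (glueEquiv n k).measurableEmbedding, Measure.volume_eq_prod,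
    integral_prod]
  · simp only [glueEquiv_apply, front_glue, integral_const_mul]
    have h := Measure.integral_comp_smul (volume : Measure (Fin n → ℝ))
      (fun x => g (a⁻¹ • x) * ∫ y, Ψ (glue n k x y)) a
    simp only [smul_smul, inv_mul_cancel₀ ha.ne', one_smul, Module.finrank_fin_fun, smul_eq_mul,
      abs_of_pos (inv_pos.2 (pow_pos ha n))] at h
    have h2 : ∀ t, g t * (a ^ n * ∫ y, Ψ (glue n k (a • t) y))
        = a ^ n * (g t * ∫ y, Ψ (glue n k (a • t) y)) := fun t => by ring
    simp only [h2]
    rw [integral_const_mul, h, ← mul_assoc, mul_inv_cancel₀ (pow_pos ha n).ne', one_mul]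
  · rw [← Measure.volume_eq_prod]
    exact (hmp.integrable_comp_emb (glueEquiv n k).measurableEmbedding).2 hint

lemma integral_combine (n k : ℕ) (Φ : (Fin (k + n) → ℝ) → ℝ) (x : Fin n → ℝ) :
    ∫ y : Fin (k + n - n) → ℝ, Φ (combine (k + n) n x y) = ∫ y : Fin k → ℝ, Φ (glue n k x y) := by
  have h : ∀ m (hm : m = k), ∫ y : Fin m → ℝ, Φ (fun i : Fin (k + n) =>
      if h : (i : ℕ) < n then x ⟨i, h⟩ else y ⟨i - n, by omega⟩) =
      ∫ y : Fin k → ℝ, Φ (glue n k x y) := by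
    rintro m rfl
    rfl
  exact h _ (by omega)

end

section

open MeasureTheory Filter Topology

lemma vand_smul (N : ℕ) {c : ℝ} (hc : 0 ≤ c) (z : Fin N → ℝ) :
    vand 1 N (c • z) = c ^ (∑ j ∈ Finset.range N, j) * vand 1 N z := by
  rw [vand_one_eq, vand_one_eq]
  have h : Matrix.vandermonde (c • z)
      = Matrix.of fun i (j : Fin N) => c ^ (j : ℕ) * Matrix.vandermonde z i j := by
    ext i j
    simp [Matrix.vandermonde_apply, mul_pow]
  rw [h, Matrix.det_mul_row, abs_mul, Finset.prod_pow_eq_pow_sum, Fin.sum_univ_eq_sum_range (fun j => j),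
    abs_of_nonneg (pow_nonneg hc _)]

lemma lintegral_Ioi_mul_exp_neg_sq {b q : ℝ} (hb : 0 < b) (hq : 0 ≤ q) :
    ∫⁻ c in Set.Ioi q, ENNReal.ofReal (c * Real.exp (-b * c ^ 2)) =
      ENNReal.ofReal (Real.exp (-b * q ^ 2) / (2 * b)) := by
  have hd : ∀ x ∈ Set.Ici q, HasDerivAt (fun c => -Real.exp (-b * c ^ 2) / (2 * b))
      (x * Real.exp (-b * x ^ 2)) x := by
    intro x _
    have h1 : HasDerivAt (fun c : ℝ => -b * c ^ 2) (-b * (2 * x)) x := by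
      simpa using (hasDerivAt_pow 2 x).const_mul (-b)
    refine (h1.exp.neg.div_const (2 * b)).congr_deriv ?_
    field_simp
  have hpos : ∀ x ∈ Set.Ioi q, 0 ≤ x * Real.exp (-b * x ^ 2) := fun x hx =>
    mul_nonneg (hq.trans (le_of_lt hx)) (Real.exp_nonneg _)
  have hlim : Tendsto (fun c => -Real.exp (-b * c ^ 2) / (2 * b)) atTop (𝓝 0) := by
    have h : Tendsto (fun c : ℝ => -b * c ^ 2) atTop atBot :=
      (tendsto_pow_atTop two_ne_zero).const_mul_atTop_of_neg (neg_lt_zero.2 hb)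
    simpa using ((Real.tendsto_exp_atBot.comp h).neg.div_const (2 * b))
  have hint := integrableOn_Ioi_deriv_of_nonneg' hd hpos hlim
  rw [← ofReal_integral_eq_lintegral_ofReal hint
    ((ae_restrict_iff' measurableSet_Ioi).2 (Eventually.of_forall hpos)),
    integral_Ioi_of_hasDerivAt_of_tendsto' hd hint hlim]
  congr 1
  ring

/-- The Euclidean ball in coordinates. -/
def sqBall (N : ℕ) (r : ℝ) : Set (Fin N → ℝ) := {z | ∑ i, z i ^ 2 ≤ r ^ 2}

lemma isClosed_sqBall (N : ℕ) (r : ℝ) : IsClosed (sqBall N r) :=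
  isClosed_le (by fun_prop) continuous_const

lemma smul_mem_sqBall {N : ℕ} {r σ : ℝ} (hσ : 0 < σ) (z : Fin N → ℝ) :
    σ⁻¹ • z ∈ sqBall N r ↔ z ∈ sqBall N (σ * r) := by
  simp only [sqBall, Set.mem_ofPred_eq, Pi.smul_apply, smul_eq_mul, mul_pow, ← Finset.mul_sum]
  rw [inv_pow, inv_mul_le_iff₀ (by positivity)]

lemma lintegral_comp_smul_pi (N : ℕ) {σ : ℝ} (hσ : 0 < σ) {H : (Fin N → ℝ) → ENNReal}
    (hH : Measurable H) :
    ∫⁻ v, H (σ • v) = ENNReal.ofReal (σ ^ N)⁻¹ * ∫⁻ z, H z := by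
  rw [← lintegral_map (f := H) (g := fun v => σ • v) hH (measurable_const_smul σ),
    Measure.map_addHaar_smul _ hσ.ne', lintegral_smul_measure, Module.finrank_fin_fun,
    abs_of_pos (by positivity), smul_eq_mul]

lemma lintegral_sqBall_comp_smul (N : ℕ) {r σ : ℝ} (hσ : 0 < σ) {G : (Fin N → ℝ) → ENNReal}
    (hG : Measurable G) :
    ∫⁻ v in sqBall N r, ENNReal.ofReal (vand 1 N v) * G (σ • v) =
      ENNReal.ofReal (σ ^ (N + ∑ j ∈ Finset.range N, j))⁻¹ *
        ∫⁻ z in sqBall N (σ * r), ENNReal.ofReal (vand 1 N z) * G z := by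
  set p := ∑ j ∈ Finset.range N, j with hp
  have hB := (isClosed_sqBall N r).measurableSet
  have hV : Measurable fun z => ENNReal.ofReal (vand 1 N z) :=
    (continuous_vand N).measurable.ennreal_ofReal
  have hVG : Measurable fun z => ENNReal.ofReal (vand 1 N z) * G z := hV.mul hG
  set H : (Fin N → ℝ) → ENNReal := fun z =>
    (sqBall N (σ * r)).indicator (fun z => ENNReal.ofReal ((σ ^ p)⁻¹) * (ENNReal.ofReal (vand 1 N z) * G z)) z
    with hH
  have hHm : Measurable H :=
    (measurable_const.mul hVG).indicator (isClosed_sqBall N _).measurableSet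
  have h := lintegral_comp_smul_pi N hσ hHm
  have h1 : ∀ v, H (σ • v) =
      (sqBall N r).indicator (fun v => ENNReal.ofReal (vand 1 N v) * G (σ • v)) v := by
    intro v
    have hm : σ • v ∈ sqBall N (σ * r) ↔ v ∈ sqBall N r := by
      rw [← smul_mem_sqBall hσ, smul_smul, inv_mul_cancel₀ hσ.ne', one_smul]
    by_cases hv : v ∈ sqBall N r
    · simp only [hH]
      rw [Set.indicator_of_mem (hm.2 hv), Set.indicator_of_mem hv, vand_smul N hσ.le, ← hp,
        ← mul_assoc, ← ENNReal.ofReal_mul (by positivity), ← mul_assoc,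
        inv_mul_cancel₀ (by positivity), one_mul]
    · simp only [hH]
      rw [Set.indicator_of_notMem (fun h => hv (hm.1 h)), Set.indicator_of_notMem hv]
  simp only [h1] at h
  rw [lintegral_indicator hB] at h
  rw [h, hH, lintegral_indicator (isClosed_sqBall N _).measurableSet, lintegral_const_mul _ hVG,
    ← mul_assoc, ← ENNReal.ofReal_mul (by positivity), pow_add, mul_inv]

lemma goe_eq_exp (N : ℕ) (z : Fin N → ℝ) :
    goe N z = vand 1 N z * Real.exp (-(∑ i, z i ^ 2) / 4) := by
  rw [goe, ← Real.exp_sum, ← Finset.sum_div, Finset.sum_neg_distrib]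

lemma lintegral_radial (N : ℕ) {r s : ℝ} (hr : 0 < r) (hs : 0 < s) {G : (Fin N → ℝ) → ENNReal}
    (hG : Measurable G) :
    ∫⁻ c in Set.Ioi (0 : ℝ), ENNReal.ofReal (c ^ (N + ∑ j ∈ Finset.range N, j + 1) *
        Real.exp (-((s * r) ^ 2 / 4) * c ^ 2)) *
        ∫⁻ v in sqBall N r, ENNReal.ofReal (vand 1 N v) * G ((s * c) • v) =
      ENNReal.ofReal ((s ^ (N + ∑ j ∈ Finset.range N, j))⁻¹ / (2 * ((s * r) ^ 2 / 4))) *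
        ∫⁻ z, ENNReal.ofReal (goe N z) * G z := by
  set d := N + ∑ j ∈ Finset.range N, j
  set b := (s * r) ^ 2 / 4 with hb
  have hb0 : 0 < b := by positivity
  have hV : Measurable fun z => ENNReal.ofReal (vand 1 N z) :=
    (continuous_vand N).measurable.ennreal_ofReal
  have hVG : Measurable fun z => ENNReal.ofReal (vand 1 N z) * G z := hV.mul hG
  have hsc : MeasurableSet {x : ℝ × (Fin N → ℝ) | ∑ i, x.2 i ^ 2 ≤ (s * x.1 * r) ^ 2} :=
    (isClosed_le (by fun_prop) (by fun_prop)).measurableSet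
  have hgG : Measurable fun z => ENNReal.ofReal (goe N z) * G z :=
    (continuous_goe N).measurable.ennreal_ofReal.mul hG
  set F : ℝ → (Fin N → ℝ) → ENNReal := fun c z =>
    ENNReal.ofReal (s ^ d)⁻¹ * ({x : ℝ × (Fin N → ℝ) | ∑ i, x.2 i ^ 2 ≤ (s * x.1 * r) ^ 2}.indicator
      (fun x => ENNReal.ofReal (x.1 * Real.exp (-b * x.1 ^ 2)) *
        (ENNReal.ofReal (vand 1 N x.2) * G x.2)) (c, z)) with hF
  have hFm : Measurable (Function.uncurry F) := by
    refine measurable_const.mul (Measurable.indicator ?_ hsc)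
    refine Measurable.mul ?_ (hVG.comp measurable_snd)
    exact (by fun_prop : Measurable fun x : ℝ × (Fin N → ℝ) =>
      x.1 * Real.exp (-b * x.1 ^ 2)).ennreal_ofReal
  have hleft : ∀ c ∈ Set.Ioi (0 : ℝ), ENNReal.ofReal (c ^ (d + 1) * Real.exp (-b * c ^ 2)) *
      ∫⁻ v in sqBall N r, ENNReal.ofReal (vand 1 N v) * G ((s * c) • v) = ∫⁻ z, F c z := by
    intro c hc
    have hc : 0 < c := hc
    have hsc : 0 < s * c := by positivity
    rw [lintegral_sqBall_comp_smul N hsc hG, ← lintegral_indicator (isClosed_sqBall N _).measurableSet]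
    have : ∀ z, F c z = ENNReal.ofReal (s ^ d)⁻¹ * ENNReal.ofReal (c * Real.exp (-b * c ^ 2)) *
        (sqBall N (s * c * r)).indicator (fun z => ENNReal.ofReal (vand 1 N z) * G z) z := by
      intro z
      simp only [hF]
      by_cases hz : z ∈ sqBall N (s * c * r)
      · rw [Set.indicator_of_mem hz, Set.indicator_of_mem (by exact hz)]
        ring
      · rw [Set.indicator_of_notMem hz, Set.indicator_of_notMem (by exact hz), mul_zero, mul_zero]
    simp only [this]
    rw [lintegral_const_mul _ (hVG.indicator (isClosed_sqBall N _).measurableSet), ← mul_assoc,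
      ← ENNReal.ofReal_mul (by positivity), ← ENNReal.ofReal_mul (by positivity)]
    congr 2
    rw [mul_pow, pow_succ]
    field_simp
    exact mul_comm _ _
  rw [setLIntegral_congr_fun measurableSet_Ioi hleft,
    lintegral_lintegral_swap hFm.aemeasurable, ← lintegral_const_mul _ hgG]
  refine lintegral_congr fun z => ?_
  set q := √(∑ i, z i ^ 2) / (s * r) with hq
  have hS : 0 ≤ ∑ i, z i ^ 2 := Finset.sum_nonneg fun i _ => sq_nonneg _
  have hq0 : 0 ≤ q := by positivity
  have hqc : ∀ c : ℝ, 0 < c → (∑ i, z i ^ 2 ≤ (s * c * r) ^ 2 ↔ q ≤ c) := by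
    intro c hc
    rw [hq, div_le_iff₀ (by positivity), Real.sqrt_le_left (by positivity)]
    ring_nf
  have h1 : ∀ c ∈ Set.Ioi (0 : ℝ), F c z = ENNReal.ofReal (s ^ d)⁻¹ *
      (ENNReal.ofReal (vand 1 N z) * G z) *
        (Set.Ici q).indicator (fun c => ENNReal.ofReal (c * Real.exp (-b * c ^ 2))) c := by
    intro c hc
    simp only [hF]
    by_cases hz : q ≤ c
    · rw [Set.indicator_of_mem (by exact (hqc c hc).2 hz), Set.indicator_of_mem (by exact hz)]
      ring
    · rw [Set.indicator_of_notMem (by exact fun h => hz ((hqc c hc).1 h)),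
        Set.indicator_of_notMem (by exact hz), mul_zero, mul_zero]
  have hem : Measurable fun c : ℝ => ENNReal.ofReal (c * Real.exp (-b * c ^ 2)) :=
    (by fun_prop : Measurable fun c : ℝ => c * Real.exp (-b * c ^ 2)).ennreal_ofReal
  rw [setLIntegral_congr_fun measurableSet_Ioi h1,
    lintegral_const_mul _ (hem.indicator measurableSet_Ici),
    lintegral_indicator measurableSet_Ici, Measure.restrict_restrict measurableSet_Ici]
  have hae : (Set.Ici q ∩ Set.Ioi (0 : ℝ) : Set ℝ) =ᵐ[volume] Set.Ioi q := by
    have h2 : (Set.Ici q ∩ Set.Ioi (0 : ℝ) : Set ℝ) =ᵐ[volume] (Set.Ioi q ∩ Set.Ioi 0 : Set ℝ) :=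
      Ioi_ae_eq_Ici.symm.inter (ae_eq_refl _)
    rwa [Set.Ioi_inter_Ioi, max_eq_left hq0] at h2
  rw [Measure.restrict_congr_set hae, lintegral_Ioi_mul_exp_neg_sq hb0 hq0, goe_eq_exp]
  have hexp : -b * q ^ 2 = -(∑ i, z i ^ 2) / 4 := by
    rw [hq, div_pow, Real.sq_sqrt hS, hb]
    field_simp
  rw [hexp, ENNReal.ofReal_mul (vand_nonneg N z), div_eq_mul_inv (s ^ d)⁻¹,
    div_eq_mul_inv (Real.exp _), ENNReal.ofReal_mul (by positivity),
    ENNReal.ofReal_mul (by positivity)]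
  ring

end

section

open MeasureTheory Filter Topology

/-- The law on `(0, ∞)` with unnormalised density `c ^ (d + 1) * exp (-b c ^ 2)`. -/
noncomputable def radialMeasure (d : ℕ) (b : ℝ) : Measure ℝ :=
  (volume.restrict (Set.Ioi 0)).withDensity
    fun c => ENNReal.ofReal (c ^ (d + 1) * Real.exp (-b * c ^ 2))

/-- The unnormalised bounded trace eigenvalue measure. -/
noncomputable def ballMeasure (N : ℕ) (r : ℝ) : Measure (Fin N → ℝ) :=
  (volume.restrict (sqBall N r)).withDensity fun v => ENNReal.ofReal (vand 1 N v)

/-- The unnormalised Gaussian orthogonal ensemble eigenvalue measure. -/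
noncomputable def goeMeasure (N : ℕ) : Measure (Fin N → ℝ) :=
  volume.withDensity fun z => ENNReal.ofReal (goe N z)

instance (N : ℕ) (r : ℝ) : SFinite (ballMeasure N r) := by
  unfold ballMeasure; infer_instance

lemma measurable_radial_density (d : ℕ) (b : ℝ) :
    Measurable fun c : ℝ => ENNReal.ofReal (c ^ (d + 1) * Real.exp (-b * c ^ 2)) :=
  (by fun_prop : Measurable fun c : ℝ => c ^ (d + 1) * Real.exp (-b * c ^ 2)).ennreal_ofReal

lemma measurable_vand_ofReal (N : ℕ) : Measurable fun v => ENNReal.ofReal (vand 1 N v) :=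
  (continuous_vand N).measurable.ennreal_ofReal

lemma measurable_goe_ofReal (N : ℕ) : Measurable fun v => ENNReal.ofReal (goe N v) :=
  (continuous_goe N).measurable.ennreal_ofReal

lemma measurable_stretch (N : ℕ) (s : ℝ) :
    Measurable fun x : ℝ × (Fin N → ℝ) => (s * x.1) • x.2 := by
  fun_prop

lemma map_radial_prod_ball (N : ℕ) {r s : ℝ} (hr : 0 < r) (hs : 0 < s) :
    ((radialMeasure (N + ∑ j ∈ Finset.range N, j) ((s * r) ^ 2 / 4)).prod (ballMeasure N r)).map
        (fun x => (s * x.1) • x.2) =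
      ENNReal.ofReal ((s ^ (N + ∑ j ∈ Finset.range N, j))⁻¹ / (2 * ((s * r) ^ 2 / 4))) •
        goeMeasure N := by
  refine Measure.ext_of_lintegral _ fun G hG => ?_
  have hGs : Measurable fun x : ℝ × (Fin N → ℝ) => G ((s * x.1) • x.2) :=
    hG.comp (measurable_stretch N s)
  rw [lintegral_map hG (measurable_stretch N s), lintegral_prod _ hGs.aemeasurable,
    lintegral_smul_measure, goeMeasure,
    lintegral_withDensity_eq_lintegral_mul _ (measurable_goe_ofReal N) hG, radialMeasure,
    lintegral_withDensity_eq_lintegral_mul _ (measurable_radial_density _ _)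
      (hGs.lintegral_prod_right'), smul_eq_mul]
  refine Eq.trans ?_ (lintegral_radial N hr hs hG)
  refine lintegral_congr fun c => ?_
  have hc : Measurable fun v => G ((s * c) • v) := hG.comp (measurable_const_smul _)
  have h := lintegral_withDensity_eq_lintegral_mul (volume.restrict (sqBall N r))
    (measurable_vand_ofReal N) hc
  rw [Pi.mul_apply, ballMeasure, h]
  rfl

lemma integrable_goe (N : ℕ) : Integrable (goe N) := by
  have h := integral_goe_pos 0 N
  by_contra hn
  rw [integral_undef (by simpa using hn)] at h
  exact lt_irrefl _ h

lemma integral_goe_pos' (N : ℕ) : 0 < ∫ z, goe N z := integral_goe_pos 0 N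

lemma goeMeasure_univ (N : ℕ) : goeMeasure N Set.univ = ENNReal.ofReal (∫ z, goe N z) := by
  rw [goeMeasure, withDensity_apply _ MeasurableSet.univ, Measure.restrict_univ,
    ofReal_integral_eq_lintegral_ofReal (integrable_goe N) (Eventually.of_forall (goe_nonneg N))]

lemma radial_mul_ball_univ (N : ℕ) {r s : ℝ} (hr : 0 < r) (hs : 0 < s) :
    radialMeasure (N + ∑ j ∈ Finset.range N, j) ((s * r) ^ 2 / 4) Set.univ *
        ballMeasure N r Set.univ =
      ENNReal.ofReal ((s ^ (N + ∑ j ∈ Finset.range N, j))⁻¹ / (2 * ((s * r) ^ 2 / 4))) *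
        ENNReal.ofReal (∫ z, goe N z) := by
  have h := congrArg (fun μ : Measure (Fin N → ℝ) => μ Set.univ) (map_radial_prod_ball N hr hs)
  simp only [Measure.map_apply (measurable_stretch N s) MeasurableSet.univ, Set.preimage_univ,
    Measure.smul_apply, goeMeasure_univ, smul_eq_mul] at h
  rwa [← Set.univ_prod_univ, Measure.prod_prod] at h

lemma ne_zero_ne_top_of_mul_eq_ofReal {a b : ENNReal} {x y : ℝ} (hx : 0 < x) (hy : 0 < y)
    (h : a * b = ENNReal.ofReal x * ENNReal.ofReal y) : (a ≠ 0 ∧ a ≠ ⊤) ∧ b ≠ 0 ∧ b ≠ ⊤ := by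
  have h0 : a * b ≠ 0 := by
    rw [h]; exact mul_ne_zero (by simpa using hx) (by simpa using hy)
  have ht : a * b ≠ ⊤ := by
    rw [h]; exact ENNReal.mul_ne_top ENNReal.ofReal_ne_top ENNReal.ofReal_ne_top
  have ha := left_ne_zero_of_mul h0
  have hb := right_ne_zero_of_mul h0
  exact ⟨⟨ha, fun h => ht (by rw [h, ENNReal.top_mul hb])⟩,
    hb, fun h => ht (by rw [h, ENNReal.mul_top ha])⟩

/-- A measure rescaled to total mass one. -/
noncomputable def unitMass {X : Type*} [MeasurableSpace X] (μ : Measure X) : Measure X :=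
  (μ Set.univ)⁻¹ • μ

lemma isProbabilityMeasure_unitMass {X : Type*} [MeasurableSpace X] {μ : Measure X}
    (h0 : μ Set.univ ≠ 0) (ht : μ Set.univ ≠ ⊤) : IsProbabilityMeasure (unitMass μ) :=
  ⟨by rw [unitMass, Measure.smul_apply, smul_eq_mul, ENNReal.inv_mul_cancel h0 ht]⟩

lemma isProbabilityMeasure_radial (N : ℕ) {r s : ℝ} (hr : 0 < r) (hs : 0 < s) :
    IsProbabilityMeasure
      (unitMass (radialMeasure (N + ∑ j ∈ Finset.range N, j) ((s * r) ^ 2 / 4))) := by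
  have h := ne_zero_ne_top_of_mul_eq_ofReal (by positivity) (integral_goe_pos' N)
    (radial_mul_ball_univ N hr hs)
  exact isProbabilityMeasure_unitMass h.1.1 h.1.2

lemma isProbabilityMeasure_ball (N : ℕ) {r : ℝ} (hr : 0 < r) :
    IsProbabilityMeasure (unitMass (ballMeasure N r)) := by
  have h := ne_zero_ne_top_of_mul_eq_ofReal (by positivity) (integral_goe_pos' N)
    (radial_mul_ball_univ N hr one_pos)
  exact isProbabilityMeasure_unitMass h.2.1 h.2.2

lemma isProbabilityMeasure_goe (N : ℕ) : IsProbabilityMeasure (unitMass (goeMeasure N)) :=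
  isProbabilityMeasure_unitMass (by rw [goeMeasure_univ]; simpa using integral_goe_pos' N)
    (by rw [goeMeasure_univ]; exact ENNReal.ofReal_ne_top)

lemma map_unitMass_radial_prod_ball (N : ℕ) {r s : ℝ} (hr : 0 < r) (hs : 0 < s) :
    ((unitMass (radialMeasure (N + ∑ j ∈ Finset.range N, j) ((s * r) ^ 2 / 4))).prod
      (unitMass (ballMeasure N r))).map (fun x => (s * x.1) • x.2) = unitMass (goeMeasure N) := by
  have h1 := isProbabilityMeasure_radial N hr hs
  have h2 := isProbabilityMeasure_ball N hr
  have h3 := isProbabilityMeasure_goe N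
  have hp : IsProbabilityMeasure (((unitMass (radialMeasure (N + ∑ j ∈ Finset.range N, j)
      ((s * r) ^ 2 / 4))).prod (unitMass (ballMeasure N r))).map (fun x => (s * x.1) • x.2)) :=
    Measure.isProbabilityMeasure_map (measurable_stretch N s).aemeasurable
  have ⟨a, ha⟩ : ∃ a : ENNReal, ((unitMass (radialMeasure (N + ∑ j ∈ Finset.range N, j)
      ((s * r) ^ 2 / 4))).prod (unitMass (ballMeasure N r))).map (fun x => (s * x.1) • x.2)
      = a • goeMeasure N := by
    unfold unitMass
    rw [Measure.prod_smul_left, Measure.prod_smul_right, Measure.map_smul, Measure.map_smul,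
      map_radial_prod_ball N hr hs, smul_smul, smul_smul]
    exact ⟨_, rfl⟩
  rw [ha] at hp ⊢
  have h := hp.measure_univ
  rw [Measure.smul_apply, smul_eq_mul] at h
  rw [unitMass, ENNReal.eq_inv_of_mul_eq_one_left h]

lemma integral_unitMass_goe (N : ℕ) (g : (Fin N → ℝ) → ℝ) :
    ∫ z, g z ∂unitMass (goeMeasure N) = (∫ z, goe N z)⁻¹ * ∫ z, g z * goe N z := by
  rw [unitMass, integral_smul_measure, goeMeasure_univ, ENNReal.toReal_inv,
    ENNReal.toReal_ofReal (integral_goe_pos' N).le, smul_eq_mul, goeMeasure,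
    integral_withDensity_eq_integral_toReal_smul (measurable_goe_ofReal N)
      (Eventually.of_forall fun _ => ENNReal.ofReal_lt_top)]
  congr 1
  refine integral_congr_ae (Eventually.of_forall fun z => ?_)
  simp only [ENNReal.toReal_ofReal (goe_nonneg N z), smul_eq_mul, mul_comm]

lemma lintegral_sqBall_vand (N : ℕ) (r : ℝ) :
    ∫⁻ z, ENNReal.ofReal ((sqBall N r).indicator (vand 1 N) z) = ballMeasure N r Set.univ := by
  rw [ballMeasure, withDensity_apply _ MeasurableSet.univ, Measure.restrict_univ,
    ← lintegral_indicator (isClosed_sqBall N r).measurableSet]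
  refine lintegral_congr fun z => ?_
  by_cases hz : z ∈ sqBall N r <;> simp [hz]

lemma integrable_sqBall_vand (N : ℕ) {r : ℝ} (hr : 0 < r) :
    Integrable ((sqBall N r).indicator (vand 1 N)) := by
  have hm := ((continuous_vand N).measurable.indicator
    (isClosed_sqBall N r).measurableSet).aestronglyMeasurable (μ := volume)
  refine ⟨hm, ?_⟩
  rw [hasFiniteIntegral_iff_ofReal
    (Eventually.of_forall (Set.indicator_nonneg fun z _ => vand_nonneg N z)), lintegral_sqBall_vand]
  exact lt_top_iff_ne_top.2 (ne_zero_ne_top_of_mul_eq_ofReal (by positivity) (integral_goe_pos' N)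
    (radial_mul_ball_univ N hr one_pos)).2.2

lemma ballMeasure_univ (N : ℕ) {r : ℝ} (hr : 0 < r) :
    (ballMeasure N r Set.univ).toReal = ∫ z, (sqBall N r).indicator (vand 1 N) z := by
  rw [← lintegral_sqBall_vand, integral_eq_lintegral_of_nonneg_ae
    (Eventually.of_forall (Set.indicator_nonneg fun z _ => vand_nonneg N z))
    (integrable_sqBall_vand N hr).1]

lemma integral_unitMass_ball (N : ℕ) {r : ℝ} (hr : 0 < r) (g : (Fin N → ℝ) → ℝ) :
    ∫ z, g z ∂unitMass (ballMeasure N r) = (∫ z, (sqBall N r).indicator (vand 1 N) z)⁻¹ *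
      ∫ z, g z * (sqBall N r).indicator (vand 1 N) z := by
  rw [unitMass, integral_smul_measure, ENNReal.toReal_inv, ballMeasure_univ N hr, smul_eq_mul,
    ballMeasure, integral_withDensity_eq_integral_toReal_smul (measurable_vand_ofReal N)
      (Eventually.of_forall fun _ => ENNReal.ofReal_lt_top),
    ← integral_indicator (isClosed_sqBall N r).measurableSet]
  congr 1
  refine integral_congr_ae (Eventually.of_forall fun z => ?_)
  by_cases hz : z ∈ sqBall N r
  · simp only [Set.indicator_of_mem hz, ENNReal.toReal_ofReal (vand_nonneg N z), smul_eq_mul,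
      mul_comm]
  · simp only [Set.indicator_of_notMem hz, mul_zero]

end

section

open MeasureTheory Filter Topology

lemma integrableOn_radial (d : ℕ) {b : ℝ} (hb : 0 < b) :
    IntegrableOn (fun c : ℝ => c ^ (d + 1) * Real.exp (-b * c ^ 2)) (Set.Ioi 0) := by
  have h := integrableOn_rpow_mul_exp_neg_mul_sq hb (s := ((d + 1 : ℕ) : ℝ))
    (by have : (0:ℝ) ≤ ((d + 1 : ℕ) : ℝ) := Nat.cast_nonneg _
        linarith)
  simpa only [Real.rpow_natCast] using h

lemma integral_radial (d : ℕ) {b : ℝ} (hb : 0 < b) :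
    ∫ c in Set.Ioi (0 : ℝ), c ^ (d + 1) * Real.exp (-b * c ^ 2) =
      b ^ (-((d : ℝ) + 2) / 2) * (1 / 2 * Real.Gamma (((d : ℝ) + 2) / 2)) := by
  have h := integral_rpow_mul_exp_neg_mul_rpow (p := 2) (q := ((d + 1 : ℕ) : ℝ)) two_pos
    (by have : (0:ℝ) ≤ ((d + 1 : ℕ) : ℝ) := Nat.cast_nonneg _
        linarith) hb
  have e : ((d + 1 : ℕ) : ℝ) + 1 = (d : ℝ) + 2 := by push_cast; ring
  rw [e] at h
  simpa only [Real.rpow_natCast, Real.rpow_two, mul_assoc] using h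

lemma radialMeasure_univ (d : ℕ) {b : ℝ} (hb : 0 < b) : radialMeasure d b Set.univ =
    ENNReal.ofReal (∫ c in Set.Ioi (0 : ℝ), c ^ (d + 1) * Real.exp (-b * c ^ 2)) := by
  rw [radialMeasure, withDensity_apply _ MeasurableSet.univ, Measure.restrict_univ,
    ofReal_integral_eq_lintegral_ofReal (integrableOn_radial d hb)]
  refine (ae_restrict_iff' measurableSet_Ioi).2 (Eventually.of_forall fun c hc => ?_)
  have : 0 < c := hc
  positivity

lemma radialMeasure_tail_le (d : ℕ) {b θ : ℝ} (hb : 0 < b) (hθ : -1 < θ) :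
    radialMeasure d b {c | 0 ≤ θ * (c ^ 2 - (1 + θ))} ≤
      ENNReal.ofReal (Real.exp (-b * θ)) * radialMeasure d (b / (1 + θ)) Set.univ := by
  have hθ' : 0 < 1 + θ := by linarith
  have hS : MeasurableSet {c : ℝ | 0 ≤ θ * (c ^ 2 - (1 + θ))} :=
    (isClosed_le continuous_const (by fun_prop)).measurableSet
  simp only [radialMeasure]
  rw [withDensity_apply _ hS, withDensity_apply _ MeasurableSet.univ, Measure.restrict_univ,
    ← lintegral_const_mul _ (measurable_radial_density _ _), ← lintegral_indicator hS]
  refine setLIntegral_mono' measurableSet_Ioi fun c hc => ?_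
  have hc : 0 < c := hc
  by_cases h : c ∈ {c : ℝ | 0 ≤ θ * (c ^ 2 - (1 + θ))}
  · rw [Set.indicator_of_mem h, ← ENNReal.ofReal_mul (by positivity)]
    refine ENNReal.ofReal_le_ofReal ?_
    rw [mul_left_comm, ← Real.exp_add]
    gcongr
    have h : 0 ≤ θ * (c ^ 2 - (1 + θ)) := h
    have : -b * θ + -(b / (1 + θ)) * c ^ 2 - -b * c ^ 2
        = b / (1 + θ) * (θ * (c ^ 2 - (1 + θ))) := by
      field_simp
      ring
    have h2 : 0 ≤ b / (1 + θ) * (θ * (c ^ 2 - (1 + θ))) := by positivity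
    linarith
  · rw [Set.indicator_of_notMem h]
    exact zero_le

lemma unitMass_radial_tail_le (d : ℕ) {b θ : ℝ} (hb : 0 < b) (hθ : -1 < θ) :
    (unitMass (radialMeasure d b) {c | 0 ≤ θ * (c ^ 2 - (1 + θ))}).toReal ≤
      Real.exp (-b * θ) * (1 + θ) ^ (((d : ℝ) + 2) / 2) := by
  have hθ' : 0 < 1 + θ := by linarith
  have hG : 0 < 1 / 2 * Real.Gamma (((d : ℝ) + 2) / 2) := by
    have := Real.Gamma_pos_of_pos (s := ((d : ℝ) + 2) / 2) (by positivity)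
    positivity
  have hb' : 0 < b / (1 + θ) := by positivity
  have h := radialMeasure_tail_le d hb hθ
  rw [radialMeasure_univ d hb', ← ENNReal.ofReal_mul (by positivity)] at h
  have hI : 0 < ∫ c in Set.Ioi (0 : ℝ), c ^ (d + 1) * Real.exp (-b * c ^ 2) := by
    rw [integral_radial d hb]; positivity
  have hI' : 0 < ∫ c in Set.Ioi (0 : ℝ), c ^ (d + 1) * Real.exp (-(b / (1 + θ)) * c ^ 2) := by
    rw [integral_radial d hb']; positivity
  have h2 := ENNReal.toReal_mono ENNReal.ofReal_ne_top h
  rw [ENNReal.toReal_ofReal (by positivity)] at h2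
  rw [unitMass, Measure.smul_apply, smul_eq_mul, ENNReal.toReal_mul, ENNReal.toReal_inv,
    radialMeasure_univ d hb, ENNReal.toReal_ofReal hI.le, inv_mul_le_iff₀ hI]
  refine h2.trans (le_of_eq ?_)
  rw [integral_radial d hb, integral_radial d hb', Real.div_rpow hb.le hθ'.le, neg_div,
    Real.rpow_neg hθ'.le, div_inv_eq_mul]
  ring

lemma tendsto_pow_mul_radial_tail (n : ℕ) {θ : ℝ} (hθ : -1 < θ) (hθ0 : θ ≠ 0) :
    Tendsto (fun N : ℕ => (N : ℝ) ^ n *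
      (unitMass (radialMeasure (N + ∑ j ∈ Finset.range N, j) ((N : ℝ) ^ 2 / 4))
        {c | 0 ≤ θ * (c ^ 2 - (1 + θ))}).toReal) atTop (𝓝 0) := by
  have hθ' : 0 < 1 + θ := by linarith
  set L := Real.log (1 + θ) with hL
  have hκ : 0 < θ - L := by
    have := Real.log_lt_sub_one_of_pos hθ' (by simpa using hθ0)
    linarith
  have hlim : Tendsto (fun N : ℕ => (N : ℝ) ^ n * Real.exp (-N)) atTop (𝓝 0) :=
    (Real.tendsto_pow_mul_exp_neg_atTop_nhds_zero n).comp tendsto_natCast_atTop_atTop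
  refine squeeze_zero' (Eventually.of_forall fun N => by positivity) ?_ hlim
  obtain ⟨N0, hN0⟩ := exists_nat_gt (4 * (1 + 2 * |L|) / (θ - L))
  filter_upwards [eventually_ge_atTop N0, eventually_ge_atTop 1] with N hN hN1
  have hN1' : (1 : ℝ) ≤ N := by exact_mod_cast hN1
  gcongr
  refine (unitMass_radial_tail_le _ (by positivity) hθ).trans ?_
  rw [Real.rpow_def_of_pos hθ', ← Real.exp_add]
  refine Real.exp_le_exp.2 ?_
  have hd : ((N + ∑ j ∈ Finset.range N, j : ℕ) : ℝ) = ((N : ℝ) ^ 2 + N) / 2 := by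
    have h := Finset.sum_range_id_mul_two N
    have h' : (((∑ j ∈ Finset.range N, j : ℕ) : ℝ)) * 2 = N * (N - 1) := by
      rw [← Nat.cast_pred (by omega)]
      exact_mod_cast h
    push_cast at h' ⊢
    linarith
  rw [hd, ← hL]
  have h1 : 4 * (1 + 2 * |L|) < N * (θ - L) := by
    rw [div_lt_iff₀ hκ] at hN0
    have : (N0 : ℝ) ≤ N := by exact_mod_cast hN
    nlinarith
  have h2 : L * (N / 4 + 1) ≤ 2 * |L| * N := by
    have h3 : L * (N / 4 + 1) ≤ |L| * (N / 4 + 1) := by gcongr; exact le_abs_self L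
    nlinarith [abs_nonneg L]
  nlinarith

lemma tendsto_pow_mul_radial_deviation (n : ℕ) {δ : ℝ} (hδ : 0 < δ) (hδ1 : δ < 1) :
    Tendsto (fun N : ℕ => (N : ℝ) ^ n *
      (unitMass (radialMeasure (N + ∑ j ∈ Finset.range N, j) ((N : ℝ) ^ 2 / 4))
        {c | δ < |c - 1|}).toReal) atTop (𝓝 0) := by
  have h1 := tendsto_pow_mul_radial_tail n (θ := δ) (by linarith) hδ.ne'
  have h2 := tendsto_pow_mul_radial_tail n (θ := -δ) (by linarith) (neg_ne_zero.2 hδ.ne')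
  have h := h1.add h2
  rw [add_zero] at h
  refine squeeze_zero' (Eventually.of_forall fun N => by positivity) ?_ h
  filter_upwards [eventually_ge_atTop 1] with N hN1
  have hN1' : (1 : ℝ) ≤ N := by exact_mod_cast hN1
  set ν := unitMass (radialMeasure (N + ∑ j ∈ Finset.range N, j) ((N : ℝ) ^ 2 / 4)) with hν
  have : IsProbabilityMeasure ν := by
    have := isProbabilityMeasure_radial N (r := N) (s := 1) (by positivity) one_pos
    rwa [one_mul] at this
  rw [← mul_add]
  gcongr
  rw [← ENNReal.toReal_add (measure_ne_top _ _) (measure_ne_top _ _)]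
  refine ENNReal.toReal_mono (by finiteness) (le_trans ?_ (measure_union_le _ _))
  have hpos : ∀ᵐ c ∂ν, 0 < c := by
    refine Measure.ae_smul_measure (c := (radialMeasure _ _ Set.univ)⁻¹)
      ((withDensity_absolutelyContinuous _ _).ae_le ?_)
    exact (ae_restrict_iff' measurableSet_Ioi).2 (Eventually.of_forall fun c hc => hc)
  refine measure_mono_ae ?_
  filter_upwards [hpos] with c hc hd
  have hd : δ < |c - 1| := hd
  rcases lt_abs.1 hd with h | h
  · left
    change 0 ≤ δ * (c ^ 2 - (1 + δ))
    have : 0 ≤ c ^ 2 - (1 + δ) := by nlinarith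
    positivity
  · right
    change 0 ≤ -δ * (c ^ 2 - (1 + -δ))
    have : 0 ≤ (1 + -δ) - c ^ 2 := by nlinarith
    nlinarith

end

section

open MeasureTheory Filter Topology

section Stretch

variable {X E : Type*} [MeasurableSpace X] [NormedAddCommGroup E] [NormedSpace ℝ E]
  {ν : Measure ℝ} {μ : Measure X} [IsProbabilityMeasure ν] [IsProbabilityMeasure μ]

lemma measureReal_le_stretch (u : X → E) (R : ℝ) :
    μ.real {x | ‖u x‖ ≤ 2 * R} * (1 - ν.real {c | 1 / 2 < |c - 1|}) ≤
      (ν.prod μ).real {p | ‖p.1 • u p.2‖ ≤ 3 * R} := by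
  have hD : MeasurableSet {c : ℝ | 1 / 2 < |c - 1|} :=
    (isOpen_lt continuous_const (by fun_prop)).measurableSet
  rw [← probReal_compl_eq_one_sub hD, mul_comm, ← measureReal_prod_prod]
  refine measureReal_mono ?_
  rintro ⟨c, x⟩ ⟨hc, hx⟩
  have hc : |c - 1| ≤ 1 / 2 := not_lt.1 hc
  have hx : ‖u x‖ ≤ 2 * R := hx
  change ‖c • u x‖ ≤ 3 * R
  rw [norm_smul, Real.norm_eq_abs]
  have hc' : |c| ≤ 3 / 2 := abs_le.2 ⟨by linarith [(abs_le.1 hc).1], by linarith [(abs_le.1 hc).2]⟩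
  nlinarith [norm_nonneg (u x)]

lemma abs_integral_stretch_sub_le [MeasurableSpace E] [BorelSpace E] [SecondCountableTopology E]
    {u : X → E} (hu : Measurable u) {f : E → ℝ} (hf : Continuous f)
    {F R ε δ : ℝ} (hF : ∀ x, |f x| ≤ F) (hfR : ∀ x, R < ‖x‖ → f x = 0) (hR : 0 ≤ R) (hε : 0 ≤ ε)
    (hδ : δ ≤ 1 / 2)
    (hfε : ∀ c x, |c - 1| ≤ δ → ‖x‖ ≤ 2 * R → |f (c • x) - f x| ≤ ε) :
    |∫ p, f (p.1 • u p.2) ∂ν.prod μ - ∫ x, f (u x) ∂μ| ≤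
      ε * μ.real {x | ‖u x‖ ≤ 2 * R} + 2 * F * ν.real {c | δ < |c - 1|} := by
  have hA : MeasurableSet {x | ‖u x‖ ≤ 2 * R} := measurableSet_le hu.norm measurable_const
  have hD : MeasurableSet {c : ℝ | δ < |c - 1|} :=
    (isOpen_lt continuous_const (by fun_prop)).measurableSet
  have hm1 : Measurable fun p : ℝ × X => f (p.1 • u p.2) :=
    hf.measurable.comp (measurable_fst.smul (hu.comp measurable_snd))
  have hm2 : Measurable fun p : ℝ × X => f (u p.2) := hf.measurable.comp (hu.comp measurable_snd)
  have hi1 : Integrable (fun p : ℝ × X => f (p.1 • u p.2)) (ν.prod μ) :=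
    Integrable.of_bound hm1.aestronglyMeasurable F (Eventually.of_forall fun p => hF _)
  have hi2 : Integrable (fun p : ℝ × X => f (u p.2)) (ν.prod μ) :=
    Integrable.of_bound hm2.aestronglyMeasurable F (Eventually.of_forall fun p => hF _)
  have hF0 : 0 ≤ F := (abs_nonneg _).trans (hF 0)
  have h2 : ∫ x, f (u x) ∂μ = ∫ p, f (u p.2) ∂ν.prod μ := by
    rw [integral_fun_snd (fun x => f (u x))]
    simp
  rw [h2, ← integral_sub hi1 hi2]
  have hiA : Integrable (fun p : ℝ × X => ε * {x | ‖u x‖ ≤ 2 * R}.indicator 1 p.2) (ν.prod μ) :=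
    ((integrable_const (1 : ℝ)).indicator hA).comp_snd ν |>.const_mul ε
  have hiD : Integrable (fun p : ℝ × X => 2 * F * {c : ℝ | δ < |c - 1|}.indicator 1 p.1)
      (ν.prod μ) :=
    ((integrable_const (1 : ℝ)).indicator hD).comp_fst μ |>.const_mul (2 * F)
  have hrhs : ε * μ.real {x | ‖u x‖ ≤ 2 * R} + 2 * F * ν.real {c | δ < |c - 1|} =
      ∫ p : ℝ × X, (ε * {x | ‖u x‖ ≤ 2 * R}.indicator 1 p.2 +
        2 * F * {c : ℝ | δ < |c - 1|}.indicator 1 p.1) ∂ν.prod μ := by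
    rw [integral_add hiA hiD, integral_const_mul, integral_const_mul,
      integral_fun_snd ({x | ‖u x‖ ≤ 2 * R}.indicator 1),
      integral_fun_fst ({c : ℝ | δ < |c - 1|}.indicator 1), integral_indicator_one hA,
      integral_indicator_one hD]
    simp
  rw [hrhs]
  refine (abs_integral_le_integral_abs).trans (integral_mono (hi1.sub hi2).abs (hiA.add hiD) ?_)
  rintro ⟨c, x⟩
  simp only
  by_cases hc : δ < |c - 1|
  · have h1 : |f (c • u x) - f (u x)| ≤ 2 * F :=
      (abs_sub _ _).trans (by linarith [hF (c • u x), hF (u x)])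
    have h3 : (0 : ℝ) ≤ {x | ‖u x‖ ≤ 2 * R}.indicator 1 x :=
      Set.indicator_nonneg (fun _ _ => zero_le_one) _
    rw [Set.indicator_of_mem (by exact hc) (1 : ℝ → ℝ), Pi.one_apply, mul_one]
    nlinarith
  · rw [Set.indicator_of_notMem (by exact hc) (1 : ℝ → ℝ), mul_zero, add_zero]
    push Not at hc
    by_cases hx : ‖u x‖ ≤ 2 * R
    · rw [Set.indicator_of_mem (by exact hx) (1 : X → ℝ), Pi.one_apply, mul_one]
      exact hfε c _ hc hx
    · rw [Set.indicator_of_notMem (by exact hx) (1 : X → ℝ), mul_zero]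
      push Not at hx
      have hc' : 1 / 2 ≤ |c| := by
        have := (abs_le.1 hc).1
        exact le_trans (by linarith) (le_abs_self c)
      rw [hfR (u x) (by linarith), hfR (c • u x), sub_zero, abs_zero]
      rw [norm_smul, Real.norm_eq_abs]
      nlinarith

end Stretch

lemma factorial_ratio_le (n k : ℕ) :
    ((k + n).factorial : ℝ) / k.factorial ≤ ((k + n : ℕ) : ℝ) ^ n := by
  have h := Nat.factorial_mul_descFactorial (Nat.le_add_left n k)
  rw [Nat.add_sub_cancel] at h
  rw [← h, Nat.cast_mul, mul_div_cancel_left₀ _ (by positivity)]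
  exact_mod_cast Nat.descFactorial_le_pow (k + n) n

lemma integral_mul_goeLocal (n k : ℕ) (hN : 0 < k + n) {g : (Fin n → ℝ) → ℝ} (hg : Measurable g)
    {C : ℝ} (hC : ∀ t, |g t| ≤ C) :
    ∫ t, g t * goeLocal n k t = ((k + n).factorial : ℝ) / k.factorial *
      ∫ z, g ((√(k + n : ℕ) / Real.pi) • front n k z) ∂unitMass (goeMeasure (k + n)) := by
  have ha : 0 < Real.pi / √(k + n : ℕ) := by
    have := Real.pi_pos
    have : (0 : ℝ) < (k + n : ℕ) := by exact_mod_cast hN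
    positivity
  have h := integral_mul_glue n k ha (integrable_goe (k + n)) hg hC
  rw [inv_div] at h
  rw [integral_unitMass_goe, ← h, ← mul_assoc, ← integral_const_mul]
  refine integral_congr_ae (Eventually.of_forall fun t => ?_)
  simp only [goeLocal]
  change _ = _ * (_ * (_ * ∫ y, goe (k + n) (glue n k (fun i => Real.pi / √(k + n : ℕ) * t i) y)))
  ring

lemma integral_mul_Rbt (n k : ℕ) (hN : 0 < k + n) {g : (Fin n → ℝ) → ℝ} (hg : Measurable g)
    {C : ℝ} (hC : ∀ t, |g t| ≤ C) :
    ∫ t, g t * (Real.pi / (2 * (k + n : ℕ))) ^ n *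
        Rbt 1 n (k + n) (√(k + n : ℕ) / 2) (fun i => Real.pi * t i / (2 * (k + n : ℕ))) =
      ((k + n).factorial : ℝ) / k.factorial *
        ∫ z, g ((2 * (k + n : ℕ) / Real.pi) • front n k z)
          ∂unitMass (ballMeasure (k + n) (√(k + n : ℕ) / 2)) := by
  have hN' : (0 : ℝ) < (k + n : ℕ) := by exact_mod_cast hN
  have hr : 0 < √(k + n : ℕ) / 2 := by positivity
  have ha : 0 < Real.pi / (2 * (k + n : ℕ)) := by
    have := Real.pi_pos
    positivity
  have h := integral_mul_glue n k ha (integrable_sqBall_vand (k + n) hr) hg hC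
  rw [inv_div] at h
  rw [integral_unitMass_ball _ hr, ← h, ← mul_assoc, ← integral_const_mul]
  refine integral_congr_ae (Eventually.of_forall fun t => ?_)
  have hx : (fun i => Real.pi * t i / (2 * (k + n : ℕ))) = (Real.pi / (2 * (k + n : ℕ))) • t := by
    ext i
    simp only [Pi.smul_apply, smul_eq_mul]
    ring
  have hI := integral_combine n k ((sqBall (k + n) (√(k + n : ℕ) / 2)).indicator (vand 1 (k + n)))
    ((Real.pi / (2 * (k + n : ℕ))) • t)
  simp only [Rbt, Zbt, hx]
  simp only [sqBall] at hI ⊢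
  rw [hI, Nat.add_sub_cancel]
  ring

end

section

open MeasureTheory Filter Topology

/-- The law of the random dilation relating the two ensembles of size `N`. -/
noncomputable def dilationLaw (N : ℕ) : Measure ℝ :=
  unitMass (radialMeasure (N + ∑ j ∈ Finset.range N, j) ((N : ℝ) ^ 2 / 4))

/-- The bounded trace ensemble of size `N` and strength `√N / 2`. -/
noncomputable def ballLaw (N : ℕ) : Measure (Fin N → ℝ) := unitMass (ballMeasure N (√N / 2))

lemma two_sqrt_mul_half_sqrt (N : ℕ) : 2 * √(N : ℝ) * (√N / 2) = N := by
  rw [mul_div_assoc', mul_div_right_comm, mul_div_cancel_left₀ _ two_ne_zero,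
    Real.mul_self_sqrt (Nat.cast_nonneg N)]

lemma isProbabilityMeasure_dilationLaw {N : ℕ} (hN : 0 < N) :
    IsProbabilityMeasure (dilationLaw N) := by
  have hN' : (0 : ℝ) < N := by exact_mod_cast hN
  have h := isProbabilityMeasure_radial N (r := √N / 2) (s := 2 * √N) (by positivity)
    (by positivity)
  rwa [two_sqrt_mul_half_sqrt] at h

lemma isProbabilityMeasure_ballLaw {N : ℕ} (hN : 0 < N) : IsProbabilityMeasure (ballLaw N) := by
  have hN' : (0 : ℝ) < N := by exact_mod_cast hN
  exact isProbabilityMeasure_ball N (by positivity)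

lemma map_dilationLaw_prod_ballLaw {N : ℕ} (hN : 0 < N) :
    ((dilationLaw N).prod (ballLaw N)).map (fun x => (2 * √N * x.1) • x.2) =
      unitMass (goeMeasure N) := by
  have hN' : (0 : ℝ) < N := by exact_mod_cast hN
  have h := map_unitMass_radial_prod_ball N (r := √N / 2) (s := 2 * √N) (by positivity)
    (by positivity)
  rwa [two_sqrt_mul_half_sqrt] at h

lemma integral_goe_eq_integral_dilation (n k : ℕ) (hN : 0 < k + n) {g : (Fin n → ℝ) → ℝ}
    (hg : Measurable g) :
    ∫ z, g ((√(k + n : ℕ) / Real.pi) • front n k z) ∂unitMass (goeMeasure (k + n)) =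
      ∫ p, g (p.1 • (2 * (k + n : ℕ) / Real.pi) • front n k p.2)
        ∂(dilationLaw (k + n)).prod (ballLaw (k + n)) := by
  have hm : Measurable fun z => g ((√(k + n : ℕ) / Real.pi) • front n k z) :=
    hg.comp ((measurable_front n k).const_smul (√(k + n : ℕ) / Real.pi))
  rw [← map_dilationLaw_prod_ballLaw hN, integral_map (measurable_stretch _ _).aemeasurable
    hm.aestronglyMeasurable]
  refine integral_congr_ae (Eventually.of_forall fun p => ?_)
  simp only [front_smul, smul_smul]
  congr 2
  have h := Real.mul_self_sqrt (Nat.cast_nonneg (α := ℝ) (k + n))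
  calc √(k + n : ℕ) / Real.pi * (2 * √(k + n : ℕ) * p.1)
      = p.1 * (2 * (√(k + n : ℕ) * √(k + n : ℕ)) / Real.pi) := by ring
    _ = _ := by rw [h]

lemma exists_dilation_mass_le (n : ℕ) (R : ℝ) : ∃ K, 0 ≤ K ∧ ∀ᶠ k in atTop,
    ((k + n).factorial : ℝ) / k.factorial *
      ((dilationLaw (k + n)).prod (ballLaw (k + n))).real
        {p | ‖p.1 • (2 * (k + n : ℕ) / Real.pi) • front n k p.2‖ ≤ R} ≤ K := by
  obtain ⟨C, hC, hCk⟩ := exists_goeLocal_le n R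
  refine ⟨C * volume.real (Metric.closedBall (0 : Fin n → ℝ) R), by positivity, ?_⟩
  filter_upwards [hCk, eventually_gt_atTop 0] with k hk hk0
  have hS : MeasurableSet (Metric.closedBall (0 : Fin n → ℝ) R) := measurableSet_closedBall
  have hg : Measurable ((Metric.closedBall (0 : Fin n → ℝ) R).indicator (1 : (Fin n → ℝ) → ℝ)) :=
    measurable_one.indicator hS
  have hb : ∀ t, |(Metric.closedBall (0 : Fin n → ℝ) R).indicator (1 : (Fin n → ℝ) → ℝ) t| ≤ 1 := by
    intro t
    by_cases ht : t ∈ Metric.closedBall (0 : Fin n → ℝ) R <;> simp [ht]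
  have h1 := integral_mul_goeLocal n k (by omega) hg hb
  rw [integral_goe_eq_integral_dilation n k (by omega) hg] at h1
  have hu : Measurable fun p : ℝ × (Fin (k + n) → ℝ) =>
      p.1 • (2 * (k + n : ℕ) / Real.pi) • front n k p.2 :=
    measurable_fst.smul (((measurable_front n k).comp measurable_snd).const_smul
      (2 * ((k + n : ℕ) : ℝ) / Real.pi))
  have h2 : ∫ p, (Metric.closedBall (0 : Fin n → ℝ) R).indicator (1 : (Fin n → ℝ) → ℝ)
      (p.1 • (2 * (k + n : ℕ) / Real.pi) • front n k p.2)
        ∂(dilationLaw (k + n)).prod (ballLaw (k + n)) =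
      ((dilationLaw (k + n)).prod (ballLaw (k + n))).real
        {p | ‖p.1 • (2 * (k + n : ℕ) / Real.pi) • front n k p.2‖ ≤ R} := by
    rw [← integral_indicator_one (measurableSet_le hu.norm measurable_const)]
    refine integral_congr_ae (Eventually.of_forall fun p => ?_)
    by_cases hp : ‖p.1 • (2 * ((k + n : ℕ) : ℝ) / Real.pi) • front n k p.2‖ ≤ R
    · simp only
      rw [Set.indicator_of_mem (mem_closedBall_zero_iff.2 hp), Set.indicator_of_mem (by exact hp)]
      rfl
    · simp only
      rw [Set.indicator_of_notMem (fun h => hp (mem_closedBall_zero_iff.1 h)),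
        Set.indicator_of_notMem (by exact hp)]
  rw [← h2, ← h1]
  have h3 : ∀ t, (Metric.closedBall (0 : Fin n → ℝ) R).indicator (1 : (Fin n → ℝ) → ℝ) t *
      goeLocal n k t = (Metric.closedBall (0 : Fin n → ℝ) R).indicator (goeLocal n k) t := by
    intro t
    by_cases ht : t ∈ Metric.closedBall (0 : Fin n → ℝ) R <;> simp [ht]
  simp only [h3]
  rw [integral_indicator hS]
  refine (Real.le_norm_self _).trans (norm_setIntegral_le_of_norm_le_const
    (isCompact_closedBall _ _).measure_lt_top fun t ht => ?_)
  rw [Real.norm_eq_abs, abs_of_nonneg (goeLocal_nonneg n k t)]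
  exact hk t fun i => (norm_le_pi_norm t i).trans (by simpa using ht)

lemma tendsto_dilation_deviation (n : ℕ) {δ : ℝ} (hδ : 0 < δ) (hδ1 : δ < 1) :
    Tendsto (fun k : ℕ => ((k + n : ℕ) : ℝ) ^ n * (dilationLaw (k + n)).real {c | δ < |c - 1|})
      atTop (𝓝 0) :=
  (tendsto_pow_mul_radial_deviation n hδ hδ1).comp (tendsto_add_atTop_nat n)

lemma exists_ball_mass_le (n : ℕ) (R : ℝ) : ∃ K, 0 ≤ K ∧ ∀ᶠ k in atTop,
    ((k + n).factorial : ℝ) / k.factorial * (ballLaw (k + n)).real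
        {v | ‖(2 * (k + n : ℕ) / Real.pi) • front n k v‖ ≤ 2 * R} ≤ K := by
  obtain ⟨K, hK, hKk⟩ := exists_dilation_mass_le n (3 * R)
  refine ⟨2 * K, by positivity, ?_⟩
  have hdev := (tendsto_pow_mul_radial_deviation 0 (δ := 1 / 2) (by norm_num) (by norm_num)).comp
    (tendsto_add_atTop_nat n)
  filter_upwards [hKk, eventually_gt_atTop 0,
    hdev.eventually (gt_mem_nhds (show (0 : ℝ) < 1 / 2 by norm_num))] with k hk hk0 hd
  have := isProbabilityMeasure_dilationLaw (N := k + n) (by omega)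
  have := isProbabilityMeasure_ballLaw (N := k + n) (by omega)
  have h := measureReal_le_stretch (ν := dilationLaw (k + n)) (μ := ballLaw (k + n))
    (fun v => (2 * ((k + n : ℕ) : ℝ) / Real.pi) • front n k v) R
  have hd' : (dilationLaw (k + n)).real {c | 1 / 2 < |c - 1|} < 1 / 2 := by
    simp only [Function.comp_apply, pow_zero, one_mul] at hd
    exact hd
  set m := (ballLaw (k + n)).real {v | ‖(2 * ((k + n : ℕ) : ℝ) / Real.pi) • front n k v‖ ≤ 2 * R}
  have hm : 0 ≤ m := measureReal_nonneg
  have hle : m ≤ 2 * ((dilationLaw (k + n)).prod (ballLaw (k + n))).real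
      {p | ‖p.1 • (2 * ((k + n : ℕ) : ℝ) / Real.pi) • front n k p.2‖ ≤ 3 * R} := by
    nlinarith
  have hM : (0 : ℝ) ≤ ((k + n).factorial : ℝ) / k.factorial := by positivity
  nlinarith

lemma exists_dilation_modulus {E : Type*} [NormedAddCommGroup E] [NormedSpace ℝ E] {f : E → ℝ}
    (hf : UniformContinuous f) {R ε : ℝ} (hR : 0 ≤ R) (hε : 0 < ε) :
    ∃ δ : ℝ, 0 < δ ∧ δ ≤ 1 / 2 ∧ ∀ (c : ℝ) (x : E), |c - 1| ≤ δ → ‖x‖ ≤ 2 * R → |f (c • x) - f x| ≤ ε := by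
  obtain ⟨η, hη, h⟩ := Metric.uniformContinuous_iff.1 hf ε hε
  refine ⟨min (1 / 2) (η / (2 * R + 1)), by positivity, min_le_left _ _, fun c x hc hx => ?_⟩
  refine (h (a := c • x) (b := x) ?_).le
  have e : c • x - x = (c - 1) • x := by rw [sub_smul, one_smul]
  rw [dist_eq_norm, e, norm_smul, Real.norm_eq_abs]
  have h1 : |c - 1| ≤ η / (2 * R + 1) := hc.trans (min_le_right _ _)
  calc |c - 1| * ‖x‖ ≤ η / (2 * R + 1) * (2 * R) := by gcongr
    _ < η / (2 * R + 1) * (2 * R + 1) := by gcongr; linarith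
    _ = η := by field_simp

lemma tendsto_integral_goeLocal_sub_Rbt {n : ℕ} {f : (Fin n → ℝ) → ℝ} (hf : Continuous f)
    (hsupp : HasCompactSupport f) :
    Tendsto (fun k : ℕ => (∫ t, f t * goeLocal n k t) -
      ∫ t, f t * (Real.pi / (2 * (k + n : ℕ))) ^ n *
        Rbt 1 n (k + n) (√(k + n : ℕ) / 2) (fun i => Real.pi * t i / (2 * (k + n : ℕ))))
      atTop (𝓝 0) := by
  obtain ⟨F, hF⟩ := hf.bounded_above_of_compact_support hsupp
  simp only [Real.norm_eq_abs] at hF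
  have hF0 : 0 ≤ F := (abs_nonneg _).trans (hF 0)
  obtain ⟨R, hR, hfR⟩ := hsupp.exists_pos_le_norm
  have huc : UniformContinuous f := hf.uniformContinuous_of_tendsto_cocompact hsupp.is_zero_at_infty
  obtain ⟨K, hK, hKk⟩ := exists_ball_mass_le n R
  refine Metric.tendsto_nhds.2 fun ε hε => ?_
  obtain ⟨δ, hδ, hδ2, hfδ⟩ := exists_dilation_modulus huc hR.le
    (show 0 < ε / (2 * (K + 1)) by positivity)
  have hdev := (tendsto_dilation_deviation n hδ (by linarith)).const_mul (2 * F)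
  rw [mul_zero] at hdev
  filter_upwards [hKk, eventually_gt_atTop 0,
    hdev.eventually (gt_mem_nhds (show 0 < ε / 2 by positivity))] with k hk hk0 hd
  have := isProbabilityMeasure_dilationLaw (N := k + n) (by omega)
  have := isProbabilityMeasure_ballLaw (N := k + n) (by omega)
  have hu : Measurable fun v => (2 * ((k + n : ℕ) : ℝ) / Real.pi) • front n k v :=
    (measurable_front n k).const_smul (2 * ((k + n : ℕ) : ℝ) / Real.pi)
  have h := abs_integral_stretch_sub_le (ν := dilationLaw (k + n)) (μ := ballLaw (k + n)) hu hf
    hF (fun x hx => hfR x hx.le) hR.le (by positivity) hδ2 hfδ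
  rw [dist_zero_right, Real.norm_eq_abs, integral_mul_goeLocal n k (by omega) hf.measurable hF,
    integral_mul_Rbt n k (by omega) hf.measurable hF,
    integral_goe_eq_integral_dilation n k (by omega) hf.measurable, ← mul_sub, abs_mul,
    abs_of_nonneg (by positivity)]
  set M := ((k + n).factorial : ℝ) / k.factorial with hM
  have hM0 : 0 ≤ M := by positivity
  have hMle : M ≤ ((k + n : ℕ) : ℝ) ^ n := factorial_ratio_le n k
  refine (mul_le_mul_of_nonneg_left h hM0).trans_lt ?_
  have h1 : ε / (2 * (K + 1)) * (M * (ballLaw (k + n)).real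
      {v | ‖(2 * ((k + n : ℕ) : ℝ) / Real.pi) • front n k v‖ ≤ 2 * R}) ≤ ε / 2 := by
    calc _ ≤ ε / (2 * (K + 1)) * (K + 1) := by gcongr; linarith
      _ = ε / 2 := by field_simp
  have h2 : M * (dilationLaw (k + n)).real {c | δ < |c - 1|} ≤
      ((k + n : ℕ) : ℝ) ^ n * (dilationLaw (k + n)).real {c | δ < |c - 1|} := by gcongr
  have h3 := mul_le_mul_of_nonneg_left h2 (show 0 ≤ 2 * F by positivity)
  linarith

end

/-- Sine-kernel universality at zero for the bounded trace GOE. -/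
theorem bounded_trace_GOE_sine_at_zero (n : ℕ) (hn : 1 ≤ n)
    (f : (Fin n → ℝ) → ℝ) (hf : Continuous f) (hsupp : HasCompactSupport f) :
    Filter.Tendsto
      (fun N : ℕ => ∫ t : Fin n → ℝ,
        f t * (π / (2 * N)) ^ n *
          Rbt 1 n N (Real.sqrt N / 2) (fun i => π * t i / (2 * N)))
      atTop
      (𝓝 (∫ t : Fin n → ℝ,
        f t * Real.sqrt (Matrix.det (Matrix.of fun p q : Fin n × Fin 2 =>
          K1sine (t p.1) (t q.1) p.2 q.2)))) := by
  refine (tendsto_add_atTop_iff_nat n).1 ?_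
  have h := (tendsto_integral_goeLocal hf hsupp).sub (tendsto_integral_goeLocal_sub_Rbt hf hsupp)
  simp only [sub_sub_cancel, sub_zero, sineLimit_eq] at h
  exact h
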